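/- Let α∈(0,1/2] and let F satisfy the regular right tail condition (with exponent α) and the converging tail ratio condition. Suppose there exist L∈ℛ with L(x)≥1 for all x, a constant T≥0 and η∈(0,1] such that, as x→∞: (a) L(x)/ℓ(x)→0 and (x/ℓ(x))·∑_{n<L(x)} F^{*n}((x,x+h]) → 0; (b) if α∈(0,1/2), then I_η(x,T) = o( ℓ(x)²·ℓ⁻(L(x)) / L(x)² ); (c) if α=1/2, then, setting u(x)=∫₁^x (ℓ(s)/s)² ds and k(x)=ℓ(x)²/u(x), one has I_η(x,T)=O(k(x)) in case u(x)/u(ℓ⁻(L(x)))→1, and I_η(x,T)=o(k(x)) otherwise. Then the SRT holds for F. -/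

import Mathlib

open MeasureTheory Filter Set Real Asymptotics

attribute [local instance] Classical.propDecidable

noncomputable section

namespace SRT

/-- Convolution of two measures on `ℝ`. -/
def mconv (μ ν : Measure ℝ) : Measure ℝ := μ.bind fun x => ν.map fun y => x + y

/-- `n`-fold self-convolution of `μ`, with the 0-th power the unit mass at `0`. -/
def convPow (μ : Measure ℝ) : ℕ → Measure ℝ
  | 0 => Measure.dirac 0
  | n + 1 => mconv (convPow μ n) μ

/-- The renewal measure `U = ∑ₙ F^{*n}`. -/
def renewal (μ : Measure ℝ) : Measure ℝ := Measure.sum fun n => convPow μ n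

/-- Right tail `F̄(x) = μ((x,∞))`. -/
def rtail (μ : Measure ℝ) (x : ℝ) : ℝ := (μ (Set.Ioi x)).toReal

/-- `f` is strictly positive on `(0,∞)` and regularly varying at `∞` with exponent `β`. -/
def RegVary (f : ℝ → ℝ) (β : ℝ) : Prop :=
  (∀ x > 0, 0 < f x) ∧
    ∀ c > 0, Tendsto (fun x => f (c * x) / f x) atTop (nhds (c ^ β))

/-- `f` is regularly varying at `∞` with some exponent. -/
def RegVaryAny (f : ℝ → ℝ) : Prop := ∃ β : ℝ, RegVary f β

/-- Regular right tail condition: `F̄(x) ∼ 1/ℓ(x)` as `x → ∞`. -/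
def RightTail (μ : Measure ℝ) (ℓ : ℝ → ℝ) : Prop :=
  Tendsto (fun x => rtail μ x * ℓ x) atTop (nhds 1)

/-- Converging tail ratio condition: `F(-x)/F̄(x)` converges to a finite limit. -/
def TailRatio (μ : Measure ℝ) : Prop :=
  ∃ p : ℝ, Tendsto (fun x => (μ (Set.Iic (-x))).toReal / rtail μ x) atTop (nhds p)

/-- `μ` is concentrated on `dℤ`. -/
def ConcOn (μ : Measure ℝ) (d : ℝ) : Prop := μ {x : ℝ | ∃ k : ℤ, x = k * d} = 1

/-- `μ` is arithmetic. -/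
def Arith (μ : Measure ℝ) : Prop := ∃ d > 0, ConcOn μ d

/-- `h` is admissible: any positive number if `μ` is non-arithmetic, and
the span of `μ` if `μ` is arithmetic. -/
def SpanOK (μ : Measure ℝ) (h : ℝ) : Prop :=
  0 < h ∧ (¬ Arith μ ∨ (ConcOn μ h ∧ ∀ d > 0, ConcOn μ d → d ≤ h))

/-- `μ` is concentrated on `a + dℤ`. -/
def ConcOnLat (μ : Measure ℝ) (a d : ℝ) : Prop :=
  μ {x : ℝ | ∃ k : ℤ, x = a + k * d} = 1

/-- `μ` is lattice. -/
def IsLattice (μ : Measure ℝ) : Prop := ∃ a d : ℝ, 0 ≤ a ∧ a < d ∧ ConcOnLat μ a d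

/-- `h` is admissible: any positive number if `μ` is non-lattice, and
the span of `μ` if `μ` is lattice. -/
def LatSpanOK (μ : Measure ℝ) (h : ℝ) : Prop :=
  0 < h ∧ (¬ IsLattice μ ∨
    ((∃ a, 0 ≤ a ∧ a < h ∧ ConcOnLat μ a h) ∧
      ∀ a d : ℝ, 0 ≤ a → a < d → ConcOnLat μ a d → d ≤ h))

/-- Generalized inverse `ℓ⁻(x) = inf {t ≥ 1 : ℓ(t) > x}`. -/
def linv (ℓ : ℝ → ℝ) (x : ℝ) : ℝ := sInf {t : ℝ | 1 ≤ t ∧ x < ℓ t}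

/-- `ω(x) = x F((x,x+h]) / F̄(x)`. -/
def omegaFn (μ : Measure ℝ) (h x : ℝ) : ℝ :=
  x * (μ (Set.Ioc x (x + h))).toReal / rtail μ x

/-- `I_η(x,T) = ∫_{(1-η)x}^x (ω(y)-T)⁺ dy`. -/
def Iof (μ : Measure ℝ) (h η x T : ℝ) : ℝ :=
  ∫ y in (1 - η) * x..x, max (omegaFn μ h y - T) 0

/-- `Î_{η,n,r}(x,T) = ∫_{(1-η)x}^x e^{-(x-y)/(r aₙ)} (ω(y)-T)⁺ dy`. -/
def IofHat (μ : Measure ℝ) (ℓ : ℝ → ℝ) (h η : ℝ) (n : ℕ) (r x T : ℝ) : ℝ :=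
  ∫ y in (1 - η) * x..x,
    Real.exp (-(x - y) / (r * linv ℓ (n : ℝ))) * max (omegaFn μ h y - T) 0

/-- `Sₙ/aₙ` converges in distribution to a law with density `g`. -/
def StableLimit (F : Measure ℝ) (ℓ : ℝ → ℝ) (g : ℝ → ℝ) : Prop :=
  ∀ f : BoundedContinuousFunction ℝ ℝ,
    Tendsto (fun n : ℕ =>
        ∫ x, f x ∂((convPow F n).map fun y => y / linv ℓ (n : ℝ))) atTop
      (nhds (∫ x, f x * g x))

/-- `Sₙ/aₙ` converges in distribution to the law `μζ`. -/
def WeakLimit (F : Measure ℝ) (ℓ : ℝ → ℝ) (μζ : Measure ℝ) : Prop :=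
  ∀ f : BoundedContinuousFunction ℝ ℝ,
    Tendsto (fun n : ℕ =>
        ∫ x, f x ∂((convPow F n).map fun y => y / linv ℓ (n : ℝ))) atTop
      (nhds (∫ x, f x ∂μζ))

/-- The law `μ` is stable: for each `n`, the `n`-fold convolution is the law of
`cₙ X + dₙ` for some `cₙ > 0`, `dₙ`. -/
def IsStable (μ : Measure ℝ) : Prop :=
  ∀ n : ℕ, 0 < n → ∃ c : ℝ, 0 < c ∧ ∃ d : ℝ, convPow μ n = μ.map fun x => c * x + d

/-- The strong renewal theorem:
`x F̄(x) U((x,x+h]) → α h ∫₀^∞ t^{-α} g(t) dt`. -/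
def SRTholds (F : Measure ℝ) (h α : ℝ) (g : ℝ → ℝ) : Prop :=
  Tendsto (fun x : ℝ => x * rtail F x * ((renewal F) (Set.Ioc x (x + h))).toReal)
    atTop (nhds (α * h * ∫ t in Set.Ioi (0:ℝ), t ^ (-α) * g t))

variable {Ω : Type*} [MeasurableSpace Ω]

/-- Partial sums `Sₙ = X₁ + ⋯ + Xₙ`. -/
def pSum (X : ℕ → Ω → ℝ) (n : ℕ) (ω : Ω) : ℝ := ∑ i ∈ Finset.range n, X i ω

/-- `X` is an i.i.d. sequence with common law `F` under `P`. -/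
def IIDseq (P : Measure Ω) (F : Measure ℝ) (X : ℕ → Ω → ℝ) : Prop :=
  (∀ i, Measurable (X i)) ∧ (∀ i, P.map (X i) = F) ∧
    ProbabilityTheory.iIndepFun X P

/-- `Nₙ = #{i ≤ n : Xᵢ > 0}`. -/
def Ncount (X : ℕ → Ω → ℝ) (n : ℕ) (ω : Ω) : ℕ :=
  ((Finset.range n).filter fun i => 0 < X i ω).card

/-- `Sₙ⁻ = ∑_{i ≤ n} Xᵢ⁻`. -/
def sMinus (X : ℕ → Ω → ℝ) (n : ℕ) (ω : Ω) : ℝ :=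
  ∑ i ∈ Finset.range n, max (-(X i ω)) 0

/-- The quantity `R_{T,η,r,c₁,c₂}(x,δ)` of Theorem `t:sum-small-n`, with
`xₙ = x + Sₙ⁻` and `κ = ⌊1/α⌋`. -/
def Rquant (F : Measure ℝ) (ℓ : ℝ → ℝ) (h α : ℝ) (P : Measure Ω) (X : ℕ → Ω → ℝ)
    (L : ℝ → ℝ) (T η r c₁ c₂ x δ : ℝ) : ℝ :=
  (x / ℓ x) * ∑ n ∈ Finset.Ico ⌈L x⌉₊ ⌈ℓ (δ * x)⌉₊,
    ∫ ω, ((Ncount X n ω : ℝ) / linv ℓ ((Ncount X n ω : ℕ) : ℝ)) *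
        (rtail F (x + sMinus X n ω) / (x + sMinus X n ω)) *
        sSup ((fun t => IofHat F ℓ h η (Ncount X n ω) r t T) ''
          Set.Icc (c₁ * (x + sMinus X n ω) / (⌊1/α⌋₊ : ℝ))
            (c₂ * (x + sMinus X n ω) + 2 * h)) ∂P

/-- Strict ascending ladder epochs. -/
def ladderTime (X : ℕ → Ω → ℝ) : ℕ → Ω → ℕ
  | 0 => fun _ => 0
  | k + 1 => fun ω =>
      sInf {n : ℕ | ladderTime X k ω < n ∧ pSum X (ladderTime X k ω) ω < pSum X n ω}

/-- Strict ascending ladder heights `H_k`. -/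
def ladderHeight (X : ℕ → Ω → ℝ) (k : ℕ) (ω : Ω) : ℝ := pSum X (ladderTime X k ω) ω

/-- Weak descending ladder epochs (weak ascending epochs of `-S`). -/
def wLadderTimeDesc (X : ℕ → Ω → ℝ) : ℕ → Ω → ℕ
  | 0 => fun _ => 0
  | k + 1 => fun ω =>
      sInf {n : ℕ | wLadderTimeDesc X k ω < n ∧
        pSum X n ω ≤ pSum X (wLadderTimeDesc X k ω) ω}

/-- Weak descending ladder heights (ladder heights of the walk `-S`). -/
def wLadderHeightDesc (X : ℕ → Ω → ℝ) (k : ℕ) (ω : Ω) : ℝ :=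
  - pSum X (wLadderTimeDesc X k ω) ω

/-- `X_{n:k}`, the `k`-th largest among `X₁,…,Xₙ`; by convention `0` if `k > n`. -/
def ordStat (X : ℕ → Ω → ℝ) (n k : ℕ) (ω : Ω) : ℝ :=
  sSup {t : ℝ | k ≤ ((Finset.range n).filter fun i => t ≤ X i ω).card}

/-- `S_{n:k} = X_{n:1} + ⋯ + X_{n:k}`. -/
def topSum (X : ℕ → Ω → ℝ) (n k : ℕ) (ω : Ω) : ℝ :=
  ∑ j ∈ Finset.Icc 1 k, ordStat X n j ω

/-- `ζ_{n,x} = aₙ^{1-γ} x^γ`. -/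
def zetaCut (ℓ : ℝ → ℝ) (γ : ℝ) (n : ℕ) (x : ℝ) : ℝ :=
  (linv ℓ (n : ℝ)) ^ (1 - γ) * x ^ γ

/-- The event `E_{n,k,x} = {Sₙ ∈ (x,x+h], X_{n:k} > ζ_{n,x} ≥ X_{n:k+1}}`,
with the convention `X_{n:0} = ∞`. -/
def Eevent (X : ℕ → Ω → ℝ) (ℓ : ℝ → ℝ) (h γ : ℝ) (n k : ℕ) (x : ℝ) : Set Ω :=
  {ω | pSum X n ω ∈ Set.Ioc x (x + h) ∧
    (k = 0 ∨ zetaCut ℓ γ n x < ordStat X n k ω) ∧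
    ordStat X n (k + 1) ω ≤ zetaCut ℓ γ n x}

end SRT

open SRT

namespace SRT

open scoped Topology ENNReal

section

open scoped ENNReal

/-! ### Convolution powers -/

lemma measurable_map_add_left (ν : Measure ℝ) [SFinite ν] :
    Measurable fun x : ℝ => ν.map fun y => x + y := by
  refine Measure.measurable_of_measurable_coe _ fun s hs => ?_
  have : (fun x : ℝ => (ν.map fun y => x + y) s)
      = fun x => ν (Prod.mk x ⁻¹' ((fun p : ℝ × ℝ => p.1 + p.2) ⁻¹' s)) := by
    funext x
    rw [Measure.map_apply (by fun_prop) hs]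
    rfl
  rw [this]
  exact measurable_measure_prodMk_left ((by fun_prop : Measurable fun p : ℝ × ℝ => p.1 + p.2) hs)

lemma mconv_eq_conv (μ ν : Measure ℝ) [SFinite ν] : mconv μ ν = μ.conv ν := by
  ext s hs
  rw [mconv, Measure.bind_apply hs (measurable_map_add_left ν).aemeasurable,
    ← lintegral_indicator_one hs,
    Measure.lintegral_conv (measurable_one.indicator hs)]
  refine lintegral_congr fun x => ?_
  rw [← lintegral_indicator_one hs, lintegral_map (measurable_one.indicator hs) (by fun_prop)]

instance mconv_isFiniteMeasure (μ ν : Measure ℝ) [IsFiniteMeasure μ] [IsFiniteMeasure ν] :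
    IsFiniteMeasure (mconv μ ν) := by
  rw [mconv_eq_conv]; infer_instance

instance convPow_isFiniteMeasure (μ : Measure ℝ) [IsFiniteMeasure μ] (n : ℕ) :
    IsFiniteMeasure (convPow μ n) := by
  induction n with
  | zero => rw [convPow]; infer_instance
  | succ n ih => rw [convPow]; infer_instance

instance convPow_isProbabilityMeasure (μ : Measure ℝ) [IsProbabilityMeasure μ] (n : ℕ) :
    IsProbabilityMeasure (convPow μ n) := by
  induction n with
  | zero => rw [convPow]; infer_instance
  | succ n ih => rw [convPow, mconv_eq_conv]; infer_instance

lemma charFun_convPow (μ : Measure ℝ) [IsFiniteMeasure μ] (n : ℕ) (t : ℝ) :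
    charFun (convPow μ n) t = charFun μ t ^ n := by
  induction n with
  | zero => simp [convPow, charFun_dirac]
  | succ n ih => rw [convPow, mconv_eq_conv, charFun_conv, ih, pow_succ]

lemma lintegral_mconv {μ ν : Measure ℝ} [SFinite ν] {f : ℝ → ℝ≥0∞} (hf : Measurable f) :
    ∫⁻ z, f z ∂(mconv μ ν) = ∫⁻ x, ∫⁻ y, f (x + y) ∂ν ∂μ := by
  rw [mconv_eq_conv, Measure.lintegral_conv hf]

lemma mconv_comm (μ ν : Measure ℝ) [IsFiniteMeasure μ] [IsFiniteMeasure ν] :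
    mconv μ ν = mconv ν μ := by
  rw [mconv_eq_conv, mconv_eq_conv, Measure.conv_comm]

lemma mconv_assoc (μ ν ρ : Measure ℝ) [IsFiniteMeasure μ] [IsFiniteMeasure ν]
    [IsFiniteMeasure ρ] : mconv (mconv μ ν) ρ = mconv μ (mconv ν ρ) := by
  simp only [mconv_eq_conv, Measure.conv_assoc]

lemma convPow_add (μ : Measure ℝ) [IsFiniteMeasure μ] (m n : ℕ) :
    convPow μ (m + n) = mconv (convPow μ m) (convPow μ n) := by
  induction n with
  | zero => simp [convPow, mconv_eq_conv]
  | succ n ih => rw [← add_assoc, convPow, ih, convPow, mconv_assoc]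

lemma mconv_mono {μ μ' ν ν' : Measure ℝ} [SFinite ν] [SFinite ν'] (h : μ ≤ μ') (h' : ν ≤ ν') :
    mconv μ ν ≤ mconv μ' ν' := by
  refine Measure.le_iff.2 fun s hs => ?_
  rw [← lintegral_indicator_one hs, ← lintegral_indicator_one hs,
    lintegral_mconv (measurable_one.indicator hs), lintegral_mconv (measurable_one.indicator hs)]
  exact lintegral_mono' h fun x => lintegral_mono' h' le_rfl

lemma convPow_mono {μ μ' : Measure ℝ} [IsFiniteMeasure μ] [IsFiniteMeasure μ'] (h : μ ≤ μ')
    (n : ℕ) : convPow μ n ≤ convPow μ' n := by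
  induction n with
  | zero => exact le_rfl
  | succ n ih => exact mconv_mono ih h

/-- Either no step exceeds `y`, or one of the `n` steps does. -/
lemma convPow_succ_le (F : Measure ℝ) [IsFiniteMeasure F] (y : ℝ) (n : ℕ) (s : Set ℝ) :
    convPow F (n + 1) s ≤ convPow (F.restrict (Iic y)) (n + 1) s +
      (n + 1 : ℕ) * mconv (F.restrict (Ioi y)) (convPow F n) s := by
  have hF : F = F.restrict (Iic y) + F.restrict (Ioi y) := by
    rw [← compl_Iic, Measure.restrict_add_restrict_compl measurableSet_Iic]
  have hle : F.restrict (Iic y) ≤ F := Measure.restrict_le_self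
  have key : ∀ n : ℕ, convPow F (n + 1) ≤ convPow (F.restrict (Iic y)) (n + 1) +
      ((n + 1 : ℕ) : ℝ≥0∞) • mconv (F.restrict (Ioi y)) (convPow F n) := by
    intro n
    induction n with
    | zero =>
      simp only [convPow, mconv_eq_conv, zero_add, Nat.cast_one, one_smul,
        Measure.dirac_zero_conv, Measure.conv_dirac_zero]
      exact hF.le
    | succ n ih =>
      have e1 : convPow F (n + 2) = mconv (convPow F (n + 1)) (F.restrict (Iic y))
          + mconv (convPow F (n + 1)) (F.restrict (Ioi y)) := by
        rw [convPow, mconv_eq_conv, mconv_eq_conv, mconv_eq_conv, ← Measure.conv_add, ← hF]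
      have e2 : mconv (convPow F (n + 1)) (F.restrict (Iic y)) ≤
          convPow (F.restrict (Iic y)) (n + 2) +
            ((n + 1 : ℕ) : ℝ≥0∞) • mconv (F.restrict (Ioi y)) (convPow F (n + 1)) := by
        refine (mconv_mono ih le_rfl).trans ?_
        have : mconv (convPow (F.restrict (Iic y)) (n + 1) +
            ((n + 1 : ℕ) : ℝ≥0∞) • mconv (F.restrict (Ioi y)) (convPow F n)) (F.restrict (Iic y))
            = convPow (F.restrict (Iic y)) (n + 2) + ((n + 1 : ℕ) : ℝ≥0∞) •
              mconv (mconv (F.restrict (Ioi y)) (convPow F n)) (F.restrict (Iic y)) := by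
          rw [mconv_eq_conv, Measure.add_conv, Measure.conv_smul_left, ← mconv_eq_conv,
            ← mconv_eq_conv]
          rfl
        rw [this, mconv_assoc]
        gcongr
        exact mconv_mono le_rfl (mconv_mono le_rfl hle)
      rw [e1, mconv_comm (convPow F (n + 1)) (F.restrict (Ioi y))]
      refine (add_le_add e2 le_rfl).trans (le_of_eq ?_)
      rw [add_assoc, show ((n + 1 + 1 : ℕ) : ℝ≥0∞) = ((n + 1 : ℕ) : ℝ≥0∞) + 1 by push_cast; rfl,
        add_smul _ (1 : ℝ≥0∞), one_smul]
  have := key n s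
  simpa using this

end

section

/-! ### Monotone regularly varying functions and their asymptotic inverses -/

/-- `H` is nondecreasing, at least `1`, and regularly varying with exponent `α`. -/
structure MonoRV (H : ℝ → ℝ) (α : ℝ) : Prop where
  mono : Monotone H
  one_le : ∀ x, 1 ≤ H x
  ratio : ∀ c > 0, Tendsto (fun x => H (c * x) / H x) atTop (𝓝 (c ^ α))

namespace MonoRV

variable {H : ℝ → ℝ} {α : ℝ}

lemma pos (hH : MonoRV H α) (x : ℝ) : 0 < H x := one_pos.trans_le (hH.one_le x)

/-- Potter's upper bound. -/
lemma potter_upper (hH : MonoRV H α) {q : ℝ} (hq : α < q) (hq0 : 0 ≤ q) :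
    ∃ C ≥ 1, ∀ u w : ℝ, 1 ≤ u → u ≤ w → H w ≤ C * (w / u) ^ q * H u := by
  have h2 : (2:ℝ) ^ α < 2 ^ q := Real.rpow_lt_rpow_of_exponent_lt one_lt_two hq
  obtain ⟨x0, hx0⟩ := eventually_atTop.1 ((hH.ratio 2 two_pos).eventually (gt_mem_nhds h2))
  set x1 := max x0 1
  have hstep : ∀ x ≥ x1, H (2 * x) ≤ 2 ^ q * H x := fun x hx =>
    ((div_lt_iff₀ (hH.pos x)).1 (hx0 x ((le_max_left _ _).trans hx))).le
  have hiter : ∀ k : ℕ, ∀ x ≥ x1, H (2 ^ k * x) ≤ (2 ^ k : ℝ) ^ q * H x := by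
    intro k
    induction k with
    | zero => intro x _; simp
    | succ k ih =>
      intro x hx
      have hxx : x1 ≤ 2 ^ k * x := hx.le.trans (le_mul_of_one_le_left
        (zero_le_one.trans ((le_max_right _ _).trans hx)) (one_le_pow₀ one_le_two))
      calc H (2 ^ (k + 1) * x) = H (2 * (2 ^ k * x)) := by ring_nf
        _ ≤ 2 ^ q * H (2 ^ k * x) := hstep _ hxx
        _ ≤ 2 ^ q * ((2 ^ k : ℝ) ^ q * H x) := by gcongr; exact ih x hx
        _ = (2 ^ (k + 1) : ℝ) ^ q * H x := by
          rw [pow_succ, Real.mul_rpow (by positivity) (by positivity)]; ring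
  have hlam : ∀ l ≥ (1:ℝ), ∀ x ≥ x1, H (l * x) ≤ 2 ^ q * l ^ q * H x := by
    intro l hl x hx
    obtain ⟨k, hk1, hk2⟩ := exists_nat_pow_near hl one_lt_two
    have hx0' : 0 ≤ x := zero_le_one.trans ((le_max_right _ _).trans hx)
    calc H (l * x) ≤ H (2 ^ (k + 1) * x) := hH.mono (by gcongr)
      _ ≤ (2 ^ (k + 1) : ℝ) ^ q * H x := hiter _ x hx
      _ = 2 ^ q * (2 ^ k : ℝ) ^ q * H x := by
          rw [pow_succ, Real.mul_rpow (by positivity) (by positivity)]; ring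
      _ ≤ 2 ^ q * l ^ q * H x := by
          have := (hH.pos x).le
          gcongr
  have h2q : (1:ℝ) ≤ 2 ^ q := Real.one_le_rpow one_le_two hq0
  refine ⟨2 ^ q * H x1, one_le_mul_of_one_le_of_one_le h2q (hH.one_le _), fun u w hu huw => ?_⟩
  have hu0 : 0 < u := one_pos.trans_le hu
  have hl : 1 ≤ w / u := (one_le_div hu0).2 huw
  have hlq : (0:ℝ) ≤ (w / u) ^ q := Real.rpow_nonneg (by positivity) _
  rcases le_total x1 u with h | h
  · calc H w = H (w / u * u) := by rw [div_mul_cancel₀ _ hu0.ne']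
      _ ≤ 2 ^ q * (w / u) ^ q * H u := hlam _ hl u h
      _ = 2 ^ q * 1 * (w / u) ^ q * H u := by ring
      _ ≤ 2 ^ q * H x1 * (w / u) ^ q * H u := by
          have := (hH.pos u).le
          gcongr
          exact hH.one_le _
  · calc H w = H (w / u * u) := by rw [div_mul_cancel₀ _ hu0.ne']
      _ ≤ H (w / u * x1) := hH.mono (by gcongr)
      _ ≤ 2 ^ q * (w / u) ^ q * H x1 := hlam _ hl x1 le_rfl
      _ = 2 ^ q * H x1 * (w / u) ^ q * 1 := by ring
      _ ≤ 2 ^ q * H x1 * (w / u) ^ q * H u := by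
          have := (hH.pos x1).le
          gcongr
          exact hH.one_le _

/-- Potter's lower bound. -/
lemma potter_lower (hH : MonoRV H α) {q : ℝ} (hq : q < α) (hq0 : 0 ≤ q) :
    ∃ C ≥ 1, ∀ u w : ℝ, 1 ≤ u → u ≤ w → (w / u) ^ q * H u ≤ C * H w := by
  have h2 : (2:ℝ) ^ q < 2 ^ α := Real.rpow_lt_rpow_of_exponent_lt one_lt_two hq
  obtain ⟨x0, hx0⟩ := eventually_atTop.1 ((hH.ratio 2 two_pos).eventually (lt_mem_nhds h2))
  set x1 := max x0 1
  have hx11 : 1 ≤ x1 := le_max_right _ _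
  have hx1p : 0 < x1 := one_pos.trans_le hx11
  have hstep : ∀ x ≥ x1, 2 ^ q * H x ≤ H (2 * x) := fun x hx =>
    ((lt_div_iff₀ (hH.pos x)).1 (hx0 x ((le_max_left _ _).trans hx))).le
  have hiter : ∀ k : ℕ, ∀ x ≥ x1, (2 ^ k : ℝ) ^ q * H x ≤ H (2 ^ k * x) := by
    intro k
    induction k with
    | zero => intro x _; simp
    | succ k ih =>
      intro x hx
      have hxx : x1 ≤ 2 ^ k * x := hx.le.trans (le_mul_of_one_le_left
        (zero_le_one.trans (hx11.trans hx)) (one_le_pow₀ one_le_two))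
      calc (2 ^ (k + 1) : ℝ) ^ q * H x = 2 ^ q * ((2 ^ k : ℝ) ^ q * H x) := by
            rw [pow_succ, Real.mul_rpow (by positivity) (by positivity)]; ring
        _ ≤ 2 ^ q * H (2 ^ k * x) := by gcongr; exact ih x hx
        _ ≤ H (2 * (2 ^ k * x)) := hstep _ hxx
        _ = H (2 ^ (k + 1) * x) := by ring_nf
  have hlam : ∀ l ≥ (1:ℝ), ∀ x ≥ x1, l ^ q * H x ≤ 2 ^ q * H (l * x) := by
    intro l hl x hx
    obtain ⟨k, hk1, hk2⟩ := exists_nat_pow_near hl one_lt_two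
    have hx0' : 0 ≤ x := zero_le_one.trans (hx11.trans hx)
    have hHx := (hH.pos x).le
    calc l ^ q * H x ≤ (2 ^ (k + 1) : ℝ) ^ q * H x := by gcongr
      _ = 2 ^ q * ((2 ^ k : ℝ) ^ q * H x) := by
          rw [pow_succ, Real.mul_rpow (by positivity) (by positivity)]; ring
      _ ≤ 2 ^ q * H (2 ^ k * x) := by gcongr; exact hiter k x hx
      _ ≤ 2 ^ q * H (l * x) := by gcongr; exact hH.mono (by gcongr)
  have h2q : (1:ℝ) ≤ 2 ^ q := Real.one_le_rpow one_le_two hq0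
  have hxq : (1:ℝ) ≤ x1 ^ q := Real.one_le_rpow hx11 hq0
  refine ⟨2 ^ q * x1 ^ q, one_le_mul_of_one_le_of_one_le h2q hxq, fun u w hu huw => ?_⟩
  have hu0 : 0 < u := one_pos.trans_le hu
  have hl : 1 ≤ w / u := (one_le_div hu0).2 huw
  have hHw := (hH.pos w).le
  rcases le_total x1 u with h | h
  · have := hlam _ hl u h
    rw [div_mul_cancel₀ _ hu0.ne'] at this
    refine this.trans ?_
    have : (2:ℝ) ^ q * 1 * H w ≤ 2 ^ q * x1 ^ q * H w := by gcongr
    simpa using this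
  · rcases le_total x1 w with h' | h'
    · have h3 := hlam (w / x1) ((one_le_div hx1p).2 h') x1 le_rfl
      rw [div_mul_cancel₀ _ hx1p.ne'] at h3
      calc (w / u) ^ q * H u ≤ (x1 * (w / x1)) ^ q * H x1 := by
            have := (hH.pos u).le
            have hw0 : 0 < w := hx1p.trans_le h'
            gcongr
            · rw [mul_div_cancel₀ _ hx1p.ne']
              exact div_le_self hw0.le hu
            · exact hH.mono h
        _ = x1 ^ q * ((w / x1) ^ q * H x1) := by
            rw [Real.mul_rpow hx1p.le (div_nonneg (hx1p.le.trans h') hx1p.le)]; ring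
        _ ≤ x1 ^ q * (2 ^ q * H w) := by gcongr
        _ = _ := by ring
    · calc (w / u) ^ q * H u ≤ x1 ^ q * H w := by
            have := (hH.pos u).le
            gcongr
            · exact (div_le_self (hu0.le.trans huw) hu).trans h'
            · exact hH.mono huw
        _ = 1 * x1 ^ q * H w := by ring
        _ ≤ 2 ^ q * x1 ^ q * H w := by gcongr

lemma tendsto_atTop (hH : MonoRV H α) (hα : 0 < α) : Tendsto H atTop atTop := by
  obtain ⟨C, hC, h⟩ := hH.potter_lower (q := α / 2) (by linarith) (by linarith)
  have h1 : Tendsto (fun x : ℝ => x ^ (α / 2) * (H 1 / C)) atTop atTop :=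
    (tendsto_rpow_atTop (by linarith)).atTop_mul_const
      (div_pos (hH.pos 1) (one_pos.trans_le hC))
  refine tendsto_atTop_mono' _ ?_ h1
  filter_upwards [eventually_ge_atTop 1] with x hx
  have := h 1 x le_rfl hx
  rw [div_one] at this
  rw [← mul_div_assoc, div_le_iff₀ (one_pos.trans_le hC)]
  linarith

end MonoRV

/-- `b` is an asymptotic inverse of `H` up to constants. -/
structure AsympInv (H b : ℝ → ℝ) : Prop where
  mono : Monotone b
  one_le : ∀ y, 1 ≤ b y
  bounds : ∃ C ≥ 1, ∀ y ≥ 1, y ≤ C * H (b y) ∧ H (b y) ≤ C * y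

namespace AsympInv

variable {H b : ℝ → ℝ} {α : ℝ}

lemma pos (hb : AsympInv H b) (x : ℝ) : 0 < b x := one_pos.trans_le (hb.one_le x)

lemma ratio_le (hH : MonoRV H α) (hb : AsympInv H b) {q : ℝ} (hq : q < α) (hq0 : 0 ≤ q) :
    ∃ C ≥ 1, ∀ y y' : ℝ, 1 ≤ y → y ≤ y' → (b y' / b y) ^ q ≤ C * (y' / y) := by
  obtain ⟨C, hC, h⟩ := hH.potter_lower hq hq0
  obtain ⟨D, hD, hD'⟩ := hb.bounds
  refine ⟨C * D * D, one_le_mul_of_one_le_of_one_le (one_le_mul_of_one_le_of_one_le hC hD) hD,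
    fun y y' hy hyy => ?_⟩
  have h1 := h _ _ (hb.one_le y) (hb.mono hyy)
  have hy0 : 0 < y := by linarith
  have hr : 0 ≤ (b y' / b y) ^ q := Real.rpow_nonneg (div_nonneg (hb.pos _).le (hb.pos _).le) _
  rw [← mul_div_assoc, le_div_iff₀ hy0]
  calc (b y' / b y) ^ q * y ≤ (b y' / b y) ^ q * (D * H (b y)) := by
        gcongr; exact (hD' y hy).1
    _ = D * ((b y' / b y) ^ q * H (b y)) := by ring
    _ ≤ D * (C * H (b y')) := by gcongr
    _ ≤ D * (C * (D * y')) := by gcongr; exact (hD' y' (hy.trans hyy)).2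
    _ = _ := by ring

lemma le_ratio (hH : MonoRV H α) (hb : AsympInv H b) {q : ℝ} (hq : α < q) (hq0 : 0 ≤ q) :
    ∃ C ≥ 1, ∀ y y' : ℝ, 1 ≤ y → y ≤ y' → y' / y ≤ C * (b y' / b y) ^ q := by
  obtain ⟨C, hC, h⟩ := hH.potter_upper hq hq0
  obtain ⟨D, hD, hD'⟩ := hb.bounds
  refine ⟨C * D * D, one_le_mul_of_one_le_of_one_le (one_le_mul_of_one_le_of_one_le hC hD) hD,
    fun y y' hy hyy => ?_⟩
  have h1 := h _ _ (hb.one_le y) (hb.mono hyy)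
  have hy0 : 0 < y := by linarith
  have hr : 0 ≤ (b y' / b y) ^ q := Real.rpow_nonneg (div_nonneg (hb.pos _).le (hb.pos _).le) _
  rw [div_le_iff₀ hy0]
  calc y' ≤ D * H (b y') := (hD' y' (hy.trans hyy)).1
    _ ≤ D * (C * (b y' / b y) ^ q * H (b y)) := by gcongr
    _ ≤ D * (C * (b y' / b y) ^ q * (D * y)) := by gcongr; exact (hD' y hy).2
    _ = _ := by ring

lemma div_le_of_le (hH : MonoRV H α) (hb : AsympInv H b) {q : ℝ} (hq : q < α) (hq0 : 0 ≤ q) :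
    ∃ C ≥ 1, ∀ x y : ℝ, 1 ≤ x → 1 ≤ y → y ≤ H x → (x / b y) ^ q ≤ C * (H x / y) := by
  obtain ⟨C, hC, h⟩ := hH.potter_lower hq hq0
  obtain ⟨D, hD, hD'⟩ := hb.bounds
  refine ⟨C * D, one_le_mul_of_one_le_of_one_le hC hD, fun x y hx hy hyx => ?_⟩
  have hy0 : 0 < y := by linarith
  rcases le_total x (b y) with hxb | hxb
  · calc (x / b y) ^ q ≤ 1 := Real.rpow_le_one (div_nonneg (by linarith) (hb.pos _).le)
          ((div_le_one (hb.pos _)).2 hxb) hq0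
      _ ≤ C * D * (H x / y) := one_le_mul_of_one_le_of_one_le
          (one_le_mul_of_one_le_of_one_le hC hD) ((one_le_div hy0).2 hyx)
  · have h1 := h _ _ (hb.one_le y) hxb
    have hr : 0 ≤ (x / b y) ^ q := Real.rpow_nonneg (div_nonneg (by linarith) (hb.pos _).le) _
    rw [← mul_div_assoc, le_div_iff₀ hy0]
    calc (x / b y) ^ q * y ≤ (x / b y) ^ q * (D * H (b y)) := by
          gcongr; exact (hD' y hy).1
      _ = D * ((x / b y) ^ q * H (b y)) := by ring
      _ ≤ D * (C * H x) := by gcongr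
      _ = _ := by ring

lemma le_div_of_le (hH : MonoRV H α) (hb : AsympInv H b) (hα : 0 < α) {q : ℝ} (hq : α < q) :
    ∃ C ≥ 1, ∀ x y : ℝ, 1 ≤ x → H x ≤ y → y / H x ≤ C * (b y / x) ^ q := by
  have hq0 : 0 < q := hα.trans hq
  obtain ⟨C, hC, h⟩ := hH.potter_upper hq hq0.le
  obtain ⟨D, hD, hD'⟩ := hb.bounds
  obtain ⟨E, hE, h'⟩ := div_le_of_le hH hb (q := α / 2) (by linarith) (by linarith)
  have hE0 : 0 < E := by linarith
  set K : ℝ := (E ^ (2 / α)) ^ q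
  have hK : 1 ≤ K := Real.one_le_rpow (Real.one_le_rpow hE (by positivity)) hq0.le
  refine ⟨C * D * K, one_le_mul_of_one_le_of_one_le (one_le_mul_of_one_le_of_one_le hC hD) hK,
    fun x y hx hyx => ?_⟩
  have hy1 : 1 ≤ y := (hH.one_le x).trans hyx
  have hx0 : 0 < x := by linarith
  have hHx := hH.pos x
  have hr : 0 ≤ (b y / x) ^ q := Real.rpow_nonneg (div_nonneg (hb.pos _).le hx0.le) _
  rcases le_total x (b y) with hxb | hxb
  · rw [div_le_iff₀ hHx]
    calc y ≤ D * H (b y) := (hD' y hy1).1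
      _ ≤ D * (C * (b y / x) ^ q * H x) := by gcongr; exact h _ _ hx hxb
      _ = C * D * 1 * (b y / x) ^ q * H x := by ring
      _ ≤ C * D * K * (b y / x) ^ q * H x := by gcongr
  · have h1 : (x / b (H x)) ^ (α / 2) ≤ E := by
      have := h' x (H x) hx (hH.one_le x) le_rfl
      rwa [div_self hHx.ne', mul_one] at this
    have h2 : x / b y ≤ E ^ (2 / α) := by
      have h3 : x / b y ≤ x / b (H x) := by
        have := hb.pos (H x)
        gcongr
        exact hb.mono hyx
      refine h3.trans ?_
      have h4 := Real.rpow_le_rpow (Real.rpow_nonneg (div_nonneg hx0.le (hb.pos _).le) _) h1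
        (show 0 ≤ 2 / α by positivity)
      rwa [← Real.rpow_mul (div_nonneg hx0.le (hb.pos _).le),
        show α / 2 * (2 / α) = 1 by field_simp, Real.rpow_one] at h4
    have h5 : 1 ≤ K * (b y / x) ^ q := by
      rw [← Real.mul_rpow (by positivity) (div_nonneg (hb.pos _).le hx0.le)]
      refine Real.one_le_rpow ?_ hq0.le
      rw [← mul_div_assoc, one_le_div hx0]
      exact (div_le_iff₀ (hb.pos _)).1 h2
    have h6 : y / H x ≤ D := by
      rw [div_le_iff₀ hHx]
      exact (hD' y hy1).1.trans (by gcongr; exact hH.mono hxb)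
    calc y / H x ≤ D := h6
      _ ≤ C * D := le_mul_of_one_le_left (by linarith) hC
      _ ≤ C * D * (K * (b y / x) ^ q) := le_mul_of_one_le_right (by positivity) h5
      _ = _ := by ring

/-- Halving the argument costs a constant. -/
lemma exists_le_of_le_two_mul_add_one (hH : MonoRV H α) (hb : AsympInv H b) (hα : 0 < α) :
    ∃ C ≥ 1, ∀ m n : ℕ, n ≤ 2 * m + 1 → b n ≤ C * b m := by
  obtain ⟨C, hC, h⟩ := ratio_le hH hb (q := α / 2) (by linarith) (by linarith)
  have hC0 : 0 < C := by linarith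
  set K := (C * 3) ^ (2 / α)
  have hK : 1 ≤ K := Real.one_le_rpow (by linarith) (by positivity)
  refine ⟨K * b 1, one_le_mul_of_one_le_of_one_le hK (hb.one_le _), fun m n hn => ?_⟩
  rcases Nat.eq_zero_or_pos m with rfl | hm
  · have : (n : ℝ) ≤ 1 := by exact_mod_cast (by omega : n ≤ 1)
    calc b n ≤ b 1 := hb.mono this
      _ = 1 * b 1 * 1 := by ring
      _ ≤ K * b 1 * b ((0 : ℕ) : ℝ) := by
        have := (hb.pos 1).le
        gcongr
        exact hb.one_le _
  · have hm1 : (1:ℝ) ≤ m := by exact_mod_cast hm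
    have hn3 : (n : ℝ) ≤ 3 * m := by exact_mod_cast (by omega : n ≤ 3 * m)
    have h1 := h m (3 * m) hm1 (by linarith)
    rw [mul_div_cancel_right₀ _ (by positivity : (m : ℝ) ≠ 0)] at h1
    have hnn : 0 ≤ b (3 * m) / b m := div_nonneg (hb.pos _).le (hb.pos _).le
    have h4 := Real.rpow_le_rpow (Real.rpow_nonneg hnn _) h1 (show 0 ≤ 2 / α by positivity)
    rw [← Real.rpow_mul hnn, show α / 2 * (2 / α) = 1 by field_simp, Real.rpow_one,
      div_le_iff₀ (hb.pos _)] at h4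
    calc b n ≤ b (3 * m) := hb.mono hn3
      _ ≤ K * b m := h4
      _ = K * 1 * b m := by ring
      _ ≤ K * b 1 * b m := by
        have := (hb.pos m).le
        gcongr
        exact hb.one_le _

end AsympInv

/-- Tails of convergent `p`-series. -/
lemma sum_Ico_rpow_neg_le {p : ℝ} (hp : 1 < p) :
    ∃ C ≥ 0, ∀ (X : ℝ) (M : ℕ), 1 ≤ X →
      ∑ n ∈ Finset.Ico ⌈X⌉₊ M, (n : ℝ) ^ (-p) ≤ C * X ^ (1 - p) := by
  refine ⟨1 + 1 / (p - 1), by have : 0 < p - 1 := by linarith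
                              positivity, fun X M hX => ?_⟩
  have hp1 : 0 < p - 1 := by linarith
  set N := ⌈X⌉₊
  have hN : X ≤ N := Nat.le_ceil X
  have hN1 : (1:ℝ) ≤ N := hX.trans hN
  have hX0 : 0 < X := by linarith
  have hXp : 0 ≤ X ^ (1 - p) := Real.rpow_nonneg hX0.le _
  have hNX : (N : ℝ) ^ (1 - p) ≤ X ^ (1 - p) :=
    Real.rpow_le_rpow_of_nonpos hX0 hN (by linarith)
  rcases Nat.lt_or_ge N M with hM | hM
  swap
  · rw [Finset.Ico_eq_empty_of_le hM, Finset.sum_empty]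
    positivity
  obtain ⟨K, rfl⟩ : ∃ K, M = K + 1 := ⟨M - 1, by omega⟩
  have hNK : N ≤ K := by omega
  rw [Finset.sum_eq_sum_Ico_succ_bot hM, ← Finset.sum_Ico_add' (fun n : ℕ => (n : ℝ) ^ (-p)) N K 1]
  have hanti : AntitoneOn (fun x : ℝ => x ^ (-p)) (Set.Icc (N : ℝ) K) := by
    intro x hx y hy hxy
    exact Real.rpow_le_rpow_of_nonpos (by linarith [hx.1]) hxy (by linarith)
  have h1 := hanti.sum_le_integral_Ico hNK
  have h2 : ∫ x in (N : ℝ)..K, x ^ (-p) = ((K : ℝ) ^ (-p + 1) - (N : ℝ) ^ (-p + 1)) / (-p + 1) := by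
    rw [integral_rpow]
    right
    refine ⟨by linarith, ?_⟩
    rw [Set.uIcc_of_le (by exact_mod_cast hNK)]
    intro h
    linarith [h.1]
  have h3 : ∫ x in (N : ℝ)..K, x ^ (-p) ≤ 1 / (p - 1) * X ^ (1 - p) := by
    rw [h2, show ((K : ℝ) ^ (-p + 1) - (N : ℝ) ^ (-p + 1)) / (-p + 1)
      = 1 / (p - 1) * ((N : ℝ) ^ (1 - p) - (K : ℝ) ^ (1 - p)) by
        rw [show -p + 1 = 1 - p by ring]
        have : 1 - p ≠ 0 := by linarith
        field_simp
        ring]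
    gcongr
    have : 0 ≤ (K : ℝ) ^ (1 - p) := by positivity
    linarith
  have h4 : (N : ℝ) ^ (-p) ≤ X ^ (1 - p) := by
    refine le_trans ?_ hNX
    exact Real.rpow_le_rpow_of_exponent_le hN1 (by linarith)
  calc _ ≤ X ^ (1 - p) + 1 / (p - 1) * X ^ (1 - p) := add_le_add h4 (h1.trans h3)
    _ = _ := by ring

end

section

/-! ### The inverse of the right tail -/

/-- The reciprocal of the right tail. -/
def invTail (F : Measure ℝ) (x : ℝ) : ℝ := (rtail F x)⁻¹

lemma rtail_antitone (F : Measure ℝ) [IsFiniteMeasure F] : Antitone (rtail F) := fun _ _ h =>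
  ENNReal.toReal_mono (measure_ne_top _ _) (measure_mono (Ioi_subset_Ioi h))

lemma rtail_le_one (F : Measure ℝ) [IsProbabilityMeasure F] (x : ℝ) : rtail F x ≤ 1 :=
  measureReal_le_one

lemma rtail_pos {F : Measure ℝ} [IsProbabilityMeasure F] {ℓ : ℝ → ℝ} (hRT : RightTail F ℓ)
    (x : ℝ) : 0 < rtail F x := by
  obtain ⟨y, hy, hxy⟩ := ((hRT.eventually (lt_mem_nhds (show (1/2:ℝ) < 1 by norm_num))).and
    (eventually_ge_atTop x)).exists
  refine lt_of_lt_of_le (lt_of_le_of_ne ENNReal.toReal_nonneg fun h => ?_) (rtail_antitone F hxy)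
  have h0 : rtail F y = 0 := h.symm
  rw [h0] at hy
  norm_num at hy

lemma monoRV_invTail {F : Measure ℝ} [IsProbabilityMeasure F] {ℓ : ℝ → ℝ} {α : ℝ}
    (hℓ : RegVary ℓ α) (hRT : RightTail F ℓ) : MonoRV (invTail F) α where
  mono x y h := inv_anti₀ (rtail_pos hRT y) (rtail_antitone F h)
  one_le x := (one_le_inv₀ (rtail_pos hRT x)).2 (rtail_le_one F x)
  ratio c hc := by
    have h1 : Tendsto (fun x => rtail F (c * x) * ℓ (c * x)) atTop (𝓝 1) :=
      hRT.comp (tendsto_id.const_mul_atTop hc)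
    have h2 := (hRT.div h1 one_ne_zero).mul (hℓ.2 c hc)
    rw [div_one, one_mul] at h2
    refine h2.congr' ?_
    filter_upwards [eventually_gt_atTop 0] with x hx
    have a1 := (hℓ.1 x hx).ne'
    have a2 := (hℓ.1 (c * x) (by positivity)).ne'
    have a3 := (rtail_pos hRT x).ne'
    have a4 := (rtail_pos hRT (c * x)).ne'
    simp only [invTail, Pi.div_apply]
    field_simp

lemma tendsto_div_invTail {F : Measure ℝ} {ℓ : ℝ → ℝ} (hRT : RightTail F ℓ) :
    Tendsto (fun x => ℓ x / invTail F x) atTop (𝓝 1) := by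
  refine hRT.congr fun x => ?_
  rw [invTail, div_inv_eq_mul, mul_comm]

/-! ### The generalized inverse -/

section linv

variable {H ℓ : ℝ → ℝ} {α : ℝ}

lemma linv_nonempty (hH : MonoRV H α) (hα : 0 < α)
    (hℓH : Tendsto (fun x => ℓ x / H x) atTop (𝓝 1)) (y : ℝ) :
    {t : ℝ | 1 ≤ t ∧ y < ℓ t}.Nonempty := by
  obtain ⟨t, h1, h2, h3⟩ := ((hℓH.eventually (lt_mem_nhds (show (1/2:ℝ) < 1 by norm_num))).and
    (((hH.tendsto_atTop hα).eventually_gt_atTop (2 * |y|)).and (eventually_ge_atTop 1))).exists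
  refine ⟨t, h3, ?_⟩
  rw [lt_div_iff₀ (hH.pos t)] at h1
  linarith [le_abs_self y]

lemma linv_bddBelow (y : ℝ) : BddBelow {t : ℝ | 1 ≤ t ∧ y < ℓ t} := ⟨1, fun _ h => h.1⟩

lemma linv_mono (hH : MonoRV H α) (hα : 0 < α)
    (hℓH : Tendsto (fun x => ℓ x / H x) atTop (𝓝 1)) : Monotone (linv ℓ) := fun _ _ h =>
  csInf_le_csInf (linv_bddBelow _) (linv_nonempty hH hα hℓH _) fun _ ht => ⟨ht.1, h.trans_lt ht.2⟩

lemma one_le_linv (hH : MonoRV H α) (hα : 0 < α)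
    (hℓH : Tendsto (fun x => ℓ x / H x) atTop (𝓝 1)) (y : ℝ) : 1 ≤ linv ℓ y :=
  le_csInf (linv_nonempty hH hα hℓH _) fun _ ht => ht.1

lemma asympInv_linv (hH : MonoRV H α) (hα : 0 < α)
    (hℓH : Tendsto (fun x => ℓ x / H x) atTop (𝓝 1))
    (hinf : Tendsto (linv ℓ) atTop atTop) : AsympInv H (linv ℓ) where
  mono := linv_mono hH hα hℓH
  one_le := one_le_linv hH hα hℓH
  bounds := by
    obtain ⟨C, hC, h⟩ := hH.potter_upper (q := α + 1) (by linarith) (by linarith)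
    obtain ⟨x0, hx0⟩ := eventually_atTop.1
      ((hℓH.eventually (lt_mem_nhds (show (1/2:ℝ) < 1 by norm_num))).and
      (hℓH.eventually (gt_mem_nhds (show (1:ℝ) < 2 by norm_num))))
    obtain ⟨y0, hy0⟩ := eventually_atTop.1 ((hinf.eventually_ge_atTop (2 * max x0 1)).and
      (eventually_ge_atTop 1))
    have hy01 : 1 ≤ y0 := (hy0 y0 le_rfl).2
    set D := max (2 * C * 2 ^ (α + 1)) (max y0 (H (linv ℓ y0)))
    have hD0 : 1 ≤ D := hy01.trans ((le_max_left _ _).trans (le_max_right _ _))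
    refine ⟨D, hD0, fun y hy => ?_⟩
    have hy' : 0 < y := by linarith
    have hHb := hH.one_le (linv ℓ y)
    rcases le_total y0 y with hyy | hyy
    · have hb := (hy0 y hyy).1
      set b := linv ℓ y
      have hxb : x0 ≤ b / 2 := by linarith [le_max_left x0 1]
      have h1b : 1 ≤ b / 2 := by linarith [le_max_right x0 1]
      have hDle : 2 * C * 2 ^ (α + 1) ≤ D := le_max_left _ _
      constructor
      · obtain ⟨t, ht, htb⟩ := exists_lt_of_csInf_lt (linv_nonempty hH hα hℓH y)
          (show sInf _ < 2 * b by change b < 2 * b; linarith)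
        have hbt : b ≤ t := csInf_le (linv_bddBelow y) ht
        have h2 := (hx0 t (by linarith)).2
        rw [div_lt_iff₀ (hH.pos t)] at h2
        have h3 := h b (2 * b) (by linarith) (by linarith)
        rw [mul_div_cancel_right₀ _ (by linarith : b ≠ 0)] at h3
        have h4 := hH.mono htb.le
        calc y ≤ 2 * (C * 2 ^ (α + 1) * H b) := by linarith [ht.2]
          _ = 2 * C * 2 ^ (α + 1) * H b := by ring
          _ ≤ D * H b := by gcongr
      · have h2 : ℓ (b / 2) ≤ y := by
          by_contra hcon
          have := csInf_le (linv_bddBelow y) (show b / 2 ∈ {t : ℝ | 1 ≤ t ∧ y < ℓ t} from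
            ⟨h1b, not_le.1 hcon⟩)
          change b ≤ b / 2 at this
          linarith
        have h3 := (hx0 (b / 2) hxb).1
        rw [lt_div_iff₀ (hH.pos _)] at h3
        have h4 := h (b / 2) b h1b (by linarith)
        have hb0 : b ≠ 0 := by linarith
        rw [show b / (b / 2) = 2 by field_simp] at h4
        calc H b ≤ C * 2 ^ (α + 1) * H (b / 2) := h4
          _ ≤ C * 2 ^ (α + 1) * (2 * y) := by gcongr; linarith
          _ = 2 * C * 2 ^ (α + 1) * y := by ring
          _ ≤ D * y := by gcongr
    · constructor
      · calc y ≤ y0 := hyy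
          _ ≤ D := (le_max_left _ _).trans (le_max_right _ _)
          _ ≤ D * H (linv ℓ y) := le_mul_of_one_le_right (by linarith) hHb
      · calc H (linv ℓ y) ≤ H (linv ℓ y0) := hH.mono (linv_mono hH hα hℓH hyy)
          _ ≤ D := (le_max_right _ _).trans (le_max_right _ _)
          _ ≤ D * y := le_mul_of_one_le_right (by linarith) hy

lemma tendsto_linv_div (hH : MonoRV H α) (hα : 0 < α)
    (hℓH : Tendsto (fun x => ℓ x / H x) atTop (𝓝 1))
    (hinf : Tendsto (linv ℓ) atTop atTop) {v : ℝ} (hv : 0 < v) {y : ℝ → ℝ}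
    (hy : Tendsto (fun x => y x / H x) atTop (𝓝 v)) :
    Tendsto (fun x => linv ℓ (y x) / x) atTop (𝓝 (v ^ (1 / α))) := by
  have hHinf := hH.tendsto_atTop hα
  have hyinf : Tendsto y atTop atTop := by
    refine (hHinf.atTop_mul_pos hv hy).congr fun x => ?_
    rw [mul_div_cancel₀ _ (hH.pos x).ne']
  have hvα : (v ^ (1 / α)) ^ α = v := by
    rw [← Real.rpow_mul hv.le, one_div, inv_mul_cancel₀ hα.ne', Real.rpow_one]
  have hvp : 0 < v ^ (1 / α) := Real.rpow_pos_of_pos hv _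
  refine tendsto_order.2 ⟨fun c hc => ?_, fun c hc => ?_⟩
  · obtain ⟨d, hcd, hdv⟩ := exists_between (max_lt hc hvp)
    have hd0 : 0 < d := (le_max_right _ _).trans_lt hcd
    have hdα : d ^ α < v := by
      rw [← hvα]; exact Real.rpow_lt_rpow hd0.le hdv hα
    obtain ⟨e, he1, he2⟩ := exists_between ((one_lt_div (Real.rpow_pos_of_pos hd0 α)).2 hdα)
    obtain ⟨x0, hx0⟩ := eventually_atTop.1 (hℓH.eventually (gt_mem_nhds he1))
    have h1 : Tendsto (fun x => e * (H (d * x) / H x)) atTop (𝓝 (e * d ^ α)) :=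
      (hH.ratio d hd0).const_mul e
    have h2 : e * d ^ α < v := by rwa [lt_div_iff₀ (Real.rpow_pos_of_pos hd0 α)] at he2
    filter_upwards [h1.eventually_lt hy h2, (hinf.comp hyinf).eventually_gt_atTop x0,
      eventually_gt_atTop 0] with x hx1 hx2 hx3
    rw [lt_div_iff₀ hx3]
    refine lt_of_lt_of_le (mul_lt_mul_of_pos_right ((le_max_left _ _).trans_lt hcd) hx3) ?_
    refine le_csInf (linv_nonempty hH hα hℓH _) fun t ht => ?_
    by_contra hcon
    have hbt : linv ℓ (y x) ≤ t := csInf_le (linv_bddBelow _) ht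
    have h3 := hx0 t (hx2.le.trans hbt)
    rw [div_lt_iff₀ (hH.pos t)] at h3
    have h4 : H t ≤ H (d * x) := hH.mono (not_le.1 hcon).le
    rw [← mul_div_assoc, div_lt_div_iff_of_pos_right (hH.pos x)] at hx1
    have he0 : 0 < e := by linarith
    have : e * H t ≤ e * H (d * x) := by gcongr
    linarith [ht.2]
  · obtain ⟨d, hvd, hdc⟩ := exists_between hc
    have hd0 : 0 < d := hvp.trans hvd
    have hdα : v < d ^ α := by
      rw [← hvα]; exact Real.rpow_lt_rpow hvp.le hvd hα
    have h1 : Tendsto (fun x => ℓ (d * x) / H (d * x) * (H (d * x) / H x)) atTop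
        (𝓝 (1 * d ^ α)) :=
      (hℓH.comp (tendsto_id.const_mul_atTop hd0)).mul (hH.ratio d hd0)
    rw [one_mul] at h1
    filter_upwards [hy.eventually_lt h1 hdα, eventually_ge_atTop (1 / d),
      eventually_gt_atTop 0] with x hx1 hx2 hx3
    rw [div_mul_div_cancel₀ (hH.pos _).ne', div_lt_div_iff_of_pos_right (hH.pos x)] at hx1
    rw [div_lt_iff₀ hx3]
    refine lt_of_le_of_lt (csInf_le (linv_bddBelow _) ⟨?_, hx1⟩) (mul_lt_mul_of_pos_right hdc hx3)
    rw [div_le_iff₀ hd0] at hx2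
    linarith

end linv

/-! ### Symmetrization and decay of the characteristic function -/

/-- The symmetrization of `μ`. -/
def symmetrization (μ : Measure ℝ) : Measure ℝ := mconv μ (μ.map fun x => -x)

instance (μ : Measure ℝ) [IsProbabilityMeasure μ] :
    IsProbabilityMeasure (μ.map fun x : ℝ => -x) :=
  Measure.isProbabilityMeasure_map (by fun_prop)

instance (μ : Measure ℝ) [IsProbabilityMeasure μ] : IsProbabilityMeasure (symmetrization μ) := by
  rw [symmetrization, mconv_eq_conv]
  infer_instance

lemma charFun_symmetrization (μ : Measure ℝ) [IsProbabilityMeasure μ] (t : ℝ) :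
    charFun (symmetrization μ) t = ((‖charFun μ t‖ ^ 2 : ℝ) : ℂ) := by
  have h := charFun_map_mul (μ := μ) (-1) t
  simp only [neg_mul, one_mul] at h
  rw [symmetrization, mconv_eq_conv, charFun_conv, h, charFun_neg, Complex.mul_conj']
  push_cast
  rfl

lemma norm_charFun_sq (μ : Measure ℝ) [IsProbabilityMeasure μ] (t : ℝ) :
    ‖charFun μ t‖ ^ 2 = ∫ x, Real.cos (t * x) ∂(symmetrization μ) := by
  have h := congrArg Complex.re (charFun_symmetrization μ t)
  rw [Complex.ofReal_re, charFun_apply_real] at h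
  rw [← h]
  have hi : Integrable (fun x : ℝ => Complex.exp (t * x * Complex.I)) (symmetrization μ) := by
    refine (integrable_const (1:ℝ)).mono' (by fun_prop) (Eventually.of_forall fun x => ?_)
    rw [← Complex.ofReal_mul, Complex.norm_exp_ofReal_mul_I]
  have h2 := integral_re hi
  simp only [RCLike.re_eq_complex_re] at h2
  rw [← h2]
  refine integral_congr_ae (Eventually.of_forall fun x => ?_)
  simp only
  rw [← Complex.ofReal_mul, Complex.exp_ofReal_mul_I_re]

lemma exists_Icc_half (F : Measure ℝ) [IsProbabilityMeasure F] :
    ∃ M > 0, (1/2 : ℝ≥0∞) ≤ F (Icc (-M) M) := by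
  have h : Tendsto (fun n : ℕ => F (Icc (-(n:ℝ)) n)) atTop (𝓝 (F (⋃ n : ℕ, Icc (-(n:ℝ)) n))) :=
    tendsto_measure_iUnion_atTop fun m n hmn => by
      have : (m:ℝ) ≤ n := by exact_mod_cast hmn
      exact Icc_subset_Icc (by linarith) this
  have hU : (⋃ n : ℕ, Icc (-(n:ℝ)) n) = univ := by
    refine eq_univ_of_forall fun x => mem_iUnion.2 ?_
    obtain ⟨n, hn⟩ := exists_nat_ge |x|
    exact ⟨n, abs_le.1 hn⟩
  rw [hU, measure_univ] at h
  obtain ⟨n, hn, hn0⟩ := ((h.eventually (lt_mem_nhds ENNReal.one_half_lt_one)).and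
    (eventually_gt_atTop 0)).exists
  exact ⟨n, by exact_mod_cast hn0, by simpa using hn.le⟩

/-- Decay of the characteristic function near `0`. -/
lemma exists_norm_charFun_le {F : Measure ℝ} [IsProbabilityMeasure F] {α : ℝ} (hα : 0 < α)
    (hH : MonoRV (invTail F) α) (hpos : ∀ x, 0 < rtail F x) :
    ∃ c > 0, ∃ r > 0, r ≤ 1 ∧ ∀ t : ℝ, t ≠ 0 → |t| ≤ r →
      ‖charFun F t‖ ≤ Real.exp (-(c / invTail F (1 / |t|))) := by
  obtain ⟨M, hM, hMF⟩ := exists_Icc_half F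
  have h2 : (1:ℝ) < 2 ^ α := Real.one_lt_rpow one_lt_two hα
  obtain ⟨e, he1, he2⟩ := exists_between h2
  obtain ⟨y0, hy0⟩ := eventually_atTop.1 ((hH.ratio 2 two_pos).eventually (lt_mem_nhds he2))
  set c0 := 1 - Real.cos (1/2)
  have hc0 : 0 < c0 := by
    have : Real.cos (1/2) < Real.cos 0 := Real.cos_lt_cos_of_nonneg_of_le_pi le_rfl
      (by linarith [Real.pi_gt_three]) (by norm_num)
    rw [Real.cos_zero] at this
    simp only [c0]; linarith
  set c1 := c0 * ((1 - 1 / e) * (1 / 2))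
  have he0 : 0 < 1 - 1 / e := by
    have : 1 / e < 1 := (div_lt_one (by linarith)).2 he1
    linarith
  have hc1 : 0 < c1 := by positivity
  set r := min 1 (min (1 / (|y0| + 1)) (1 / (2 * M)))
  have hr0 : 0 < r := by
    refine lt_min one_pos (lt_min ?_ ?_) <;> positivity
  have key : ∀ t : ℝ, 0 < t → t ≤ r →
      ‖charFun F t‖ ≤ Real.exp (-(c1 / 2 / invTail F (1 / t))) := by
    intro t ht htr
    have hty : y0 ≤ 1 / t := by
      have : t ≤ 1 / (|y0| + 1) := htr.trans ((min_le_right _ _).trans (min_le_left _ _))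
      rw [le_div_iff₀ (by positivity)] at this
      rw [le_div_iff₀ ht]
      nlinarith [le_abs_self y0]
    have htM : t * M ≤ 1 / 2 := by
      have : t ≤ 1 / (2 * M) := htr.trans ((min_le_right _ _).trans (min_le_right _ _))
      rw [le_div_iff₀ (by positivity)] at this
      linarith
    set y := 1 / t
    set A : Set ℝ := {x | 1/2 ≤ t * x ∧ t * x ≤ 5/2}
    have hA : MeasurableSet A :=
      measurableSet_Icc.preimage (by fun_prop : Measurable fun x : ℝ => t * x)
    have hGA : F (Ioc y (2 * y)) * (1/2) ≤ symmetrization F A := by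
      rw [symmetrization, ← lintegral_indicator_one hA, lintegral_mconv (measurable_one.indicator hA)]
      calc F (Ioc y (2 * y)) * (1/2)
          = ∫⁻ x in Ioc y (2 * y), 1/2 ∂F := by rw [setLIntegral_const, mul_comm]
        _ ≤ ∫⁻ x in Ioc y (2 * y), ∫⁻ z, A.indicator 1 (x + z) ∂(F.map fun x => -x) ∂F := by
            refine setLIntegral_mono' measurableSet_Ioc fun x hx => ?_
            refine hMF.trans ?_
            have : F (Icc (-M) M) = (F.map fun x => -x) (Icc (-M) M) := by
              rw [Measure.map_apply (by fun_prop) measurableSet_Icc]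
              congr 1
              ext z
              simp only [mem_Icc, mem_preimage]
              constructor <;> rintro ⟨h1, h2⟩ <;> constructor <;> linarith
            rw [this, ← lintegral_indicator_one measurableSet_Icc]
            refine lintegral_mono fun z => ?_
            by_cases hz : z ∈ Icc (-M) M
            · have : x + z ∈ A := by
                have e1 : 1 < t * x := by
                  have := mul_lt_mul_of_pos_left hx.1 ht
                  rwa [mul_one_div_cancel ht.ne'] at this
                have e2 : t * x ≤ 2 := by
                  have := mul_le_mul_of_nonneg_left hx.2 ht.le
                  rwa [mul_left_comm, mul_one_div_cancel ht.ne', mul_one] at this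
                have e3 : t * z ≤ t * M := mul_le_mul_of_nonneg_left hz.2 ht.le
                have e4 : t * (-M) ≤ t * z := mul_le_mul_of_nonneg_left hz.1 ht.le
                constructor <;> rw [mul_add] <;> linarith
              rw [indicator_of_mem hz, indicator_of_mem this]
              simp
            · rw [indicator_of_notMem hz]
              exact zero_le
        _ ≤ _ := setLIntegral_le_lintegral _ _
    have hreal : (rtail F y - rtail F (2 * y)) * (1 / 2) ≤ (symmetrization F).real A := by
      have h3 := ENNReal.toReal_mono (measure_ne_top _ _) hGA
      rw [ENNReal.toReal_mul] at h3
      have h4 : (F (Ioc y (2 * y))).toReal = rtail F y - rtail F (2 * y) := by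
        have hsub : Ioi (2 * y) ⊆ Ioi y := Ioi_subset_Ioi (by
          have : 0 < y := by positivity
          linarith)
        rw [← Ioi_sdiff_Ioi, measure_sdiff hsub measurableSet_Ioi.nullMeasurableSet
          (measure_ne_top _ _), ENNReal.toReal_sub_of_le (measure_mono hsub) (measure_ne_top _ _)]
        rfl
      rw [h4] at h3
      simpa [Measure.real] using h3
    have htail : rtail F y - rtail F (2 * y) ≥ (1 - 1 / e) * rtail F y := by
      have h5 := hy0 y hty
      simp only [invTail] at h5
      rw [inv_div_inv, lt_div_iff₀ (hpos _)] at h5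
      have : rtail F (2 * y) ≤ 1 / e * rtail F y := by
        rw [one_div_mul_eq_div, le_div_iff₀ (by linarith)]
        linarith
      linarith
    have hint : c0 * (symmetrization F).real A ≤ 1 - ‖charFun F t‖ ^ 2 := by
      rw [norm_charFun_sq]
      have hicos : Integrable (fun x => Real.cos (t * x)) (symmetrization F) :=
        (integrable_const (1:ℝ)).mono' (by fun_prop)
          (Eventually.of_forall fun x => Real.abs_cos_le_one _)
      have e1 : 1 - ∫ x, Real.cos (t * x) ∂(symmetrization F)
          = ∫ x, (1 - Real.cos (t * x)) ∂(symmetrization F) := by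
        rw [integral_sub (integrable_const _) hicos]
        simp
      have e2 : c0 * (symmetrization F).real A
          = ∫ x, A.indicator (fun _ => c0) x ∂(symmetrization F) := by
        rw [integral_indicator_const _ hA, smul_eq_mul, mul_comm]
      rw [e1, e2]
      refine integral_mono ((integrable_const _).indicator hA)
        ((integrable_const _).sub hicos) fun x => ?_
      by_cases hx : x ∈ A
      · rw [indicator_of_mem hx]
        have : Real.cos (t * x) ≤ Real.cos (1/2) :=
          Real.cos_le_cos_of_nonneg_of_le_pi (by norm_num)
            (hx.2.trans (by linarith [Real.pi_gt_three])) hx.1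
        simp only [c0]; linarith
      · rw [indicator_of_notMem hx]
        linarith [Real.cos_le_one (t * x)]
    have hfin : ‖charFun F t‖ ^ 2 ≤ Real.exp (-(c1 / invTail F y)) := by
      have e3 : c1 / invTail F y = c1 * rtail F y := by rw [invTail, div_inv_eq_mul]
      have e4 : c1 * rtail F y ≤ 1 - ‖charFun F t‖ ^ 2 := by
        refine le_trans ?_ hint
        calc c1 * rtail F y = c0 * ((1 - 1 / e) * rtail F y * (1/2)) := by simp only [c1]; ring
          _ ≤ c0 * ((rtail F y - rtail F (2 * y)) * (1/2)) := by gcongr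
          _ ≤ _ := by gcongr
      have := Real.add_one_le_exp (-(c1 / invTail F y))
      rw [e3] at this ⊢
      linarith
    have e5 : Real.exp (-(c1 / invTail F y)) = Real.exp (-(c1 / 2 / invTail F y)) ^ 2 := by
      rw [← Real.exp_nat_mul]
      congr 1
      push_cast
      ring
    rw [e5] at hfin
    exact (sq_le_sq₀ (norm_nonneg _) (Real.exp_nonneg _)).1 hfin
  refine ⟨c1 / 2, by positivity, r, hr0, min_le_left _ _, fun t ht htr => ?_⟩
  rcases lt_or_gt_of_ne ht with h | h
  · rw [abs_of_neg h] at htr ⊢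
    have := key (-t) (by linarith) htr
    rwa [charFun_neg, RCLike.norm_conj] at this
  · rw [abs_of_pos h] at htr ⊢
    exact key t h htr

end

section

open scoped Topology ENNReal FourierTransform

/-! ### Fourier inversion almost everywhere -/

lemma integral_fourier_mul_flip {f k : ℝ → ℂ} (hf : Integrable f) (hk : Integrable k) :
    ∫ x, 𝓕 f x * k x = ∫ x, f x * 𝓕 k x := by
  simpa using! (VectorFourier.integral_fourierIntegral_smul_eq_flip (L := innerₗ ℝ)
      Real.continuous_fourierChar continuous_inner hf hk)

lemma ae_eq_fourierInv_fourier {f : ℝ → ℂ} (hf : Integrable f) (hF : Integrable (𝓕 f)) :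
    ∀ᵐ x, f x = 𝓕⁻ (𝓕 f) x := by
  have hcont : Continuous (𝓕⁻ (𝓕 f)) := by
    rw [Real.fourierInv_eq_fourier_comp_neg]
    exact VectorFourier.fourierIntegral_continuous Real.continuous_fourierChar
      continuous_inner hF.comp_neg
  refine ae_eq_of_integral_contDiff_smul_eq hf.locallyIntegrable hcont.locallyIntegrable ?_
  intro φ hφ hφc
  set ψ : SchwartzMap ℝ ℂ := HasCompactSupport.toSchwartzMap (f := fun x => (φ x : ℂ))
    (hφc.comp_left (g := Complex.ofReal) (by simp))
    (Complex.ofRealCLM.contDiff.comp hφ)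
  have hψ : ∀ x, ψ x = φ x := fun x => rfl
  have h1 : (ψ : ℝ → ℂ) = 𝓕 (𝓕⁻ (ψ : ℝ → ℂ)) := by
    rw [← SchwartzMap.fourierInv_coe, ← SchwartzMap.fourier_coe, FourierTransform.fourier_fourierInv_eq]
  have hinv : Integrable (𝓕⁻ (ψ : ℝ → ℂ)) := by
    rw [← SchwartzMap.fourierInv_coe]; exact SchwartzMap.integrable _
  have hneg : ∀ x, 𝓕⁻ (ψ : ℝ → ℂ) x = 𝓕 (ψ : ℝ → ℂ) (-x) := fun x => by
    rw [Real.fourierInv_eq_fourier_neg]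
  calc ∫ x, φ x • f x = ∫ x, 𝓕 (𝓕⁻ (ψ : ℝ → ℂ)) x * f x := by
        rw [← h1]; simp only [hψ, Complex.real_smul]
    _ = ∫ x, 𝓕⁻ (ψ : ℝ → ℂ) x * 𝓕 f x := integral_fourier_mul_flip hinv hf
    _ = ∫ x, 𝓕 (ψ : ℝ → ℂ) (-x) * 𝓕 f (- -x) := by simp only [hneg, neg_neg]
    _ = ∫ x, 𝓕 (ψ : ℝ → ℂ) x * 𝓕 f (-x) := integral_neg_eq_self
          (fun x => 𝓕 (ψ : ℝ → ℂ) x * 𝓕 f (-x)) volume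
    _ = ∫ x, ψ x * 𝓕 (fun y => 𝓕 f (-y)) x :=
        integral_fourier_mul_flip ψ.integrable hF.comp_neg
    _ = ∫ x, φ x • 𝓕⁻ (𝓕 f) x := by
        rw [Real.fourierInv_eq_fourier_comp_neg]; simp only [hψ, Complex.real_smul]

lemma integrable_exp_neg_mul_abs_rpow {c κ : ℝ} (hc : 0 < c) (hκ : 0 < κ) :
    Integrable fun s : ℝ => Real.exp (-(c * |s| ^ κ)) := by
  have h := integrableOn_rpow_mul_exp_neg_mul_rpow (s := 0) (by norm_num) hκ hc
  have h0 : IntegrableOn (fun s : ℝ => Real.exp (-(c * |s| ^ κ))) (Ioi 0) := by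
    refine h.congr_fun (fun x hx => ?_) measurableSet_Ioi
    have hx' : (0:ℝ) < x := hx
    simp only [Real.rpow_zero, one_mul, abs_of_pos hx', neg_mul]
  rw [← integrableOn_univ, ← Iic_union_Ioi (a := (0:ℝ))]
  refine IntegrableOn.union ?_ h0
  rw [← integrableOn_Ici_iff_integrableOn_Ioi] at h0
  have := h0.comp_neg
  simpa using this

/-! ### The limit law and its characteristic function -/

/-- The Fourier transform of the density `g`, in the normalization of characteristic functions. -/
def gHat (g : ℝ → ℝ) (s : ℝ) : ℂ := ∫ y : ℝ, Complex.exp (s * y * Complex.I) * (g y : ℂ)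

section StableLimit

variable {F : Measure ℝ} [IsProbabilityMeasure F] {ℓ g : ℝ → ℝ}

lemma StableLimit.integral_eq_one (hg : StableLimit F ℓ g) : ∫ x, g x = 1 := by
  have h := hg (BoundedContinuousFunction.const ℝ 1)
  simp only [BoundedContinuousFunction.const_apply, one_mul] at h
  refine tendsto_nhds_unique h ?_
  refine tendsto_const_nhds.congr fun n => ?_
  have : IsProbabilityMeasure ((convPow F n).map fun y => y / linv ℓ (n : ℝ)) :=
    Measure.isProbabilityMeasure_map (by fun_prop)
  simp

lemma StableLimit.integrable (hg : StableLimit F ℓ g) : Integrable g := by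
  by_contra h
  have := hg.integral_eq_one
  rw [integral_undef h] at this
  norm_num at this

lemma integrable_exp_mul_of_integrable {g : ℝ → ℝ} (hg : Integrable g) (s : ℝ) :
    Integrable fun y : ℝ => Complex.exp (s * y * Complex.I) * (g y : ℂ) := by
  refine (hg.ofReal (𝕜 := ℂ)).bdd_mul (c := 1) (by fun_prop) (Eventually.of_forall fun x => ?_)
  rw [← Complex.ofReal_mul, Complex.norm_exp_ofReal_mul_I]

lemma gHat_eq_fourier (g : ℝ → ℝ) (w : ℝ) :
    𝓕 (fun y => (g y : ℂ)) w = gHat g (-(2 * π * w)) := by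
  rw [Real.fourier_real_eq_integral_exp_smul, gHat]
  congr 1
  ext y
  rw [smul_eq_mul]
  congr 2
  push_cast
  ring

lemma continuous_gHat {g : ℝ → ℝ} (hg : Integrable g) : Continuous (gHat g) := by
  refine continuous_of_dominated (bound := fun y => ‖g y‖) (fun s => ?_) (fun s => ?_) hg.norm ?_
  · exact (integrable_exp_mul_of_integrable hg s).aestronglyMeasurable
  · refine Eventually.of_forall fun y => ?_
    rw [norm_mul, ← Complex.ofReal_mul, Complex.norm_exp_ofReal_mul_I, one_mul, Complex.norm_real]
  · exact Eventually.of_forall fun y => by fun_prop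

lemma gHat_zero (hg : StableLimit F ℓ g) : gHat g 0 = 1 := by
  simp only [gHat, Complex.ofReal_zero, zero_mul, Complex.exp_zero, one_mul]
  rw [integral_complex_ofReal, hg.integral_eq_one, Complex.ofReal_one]

/-- The law of the normalized sum. -/
def scaledLaw (F : Measure ℝ) (ℓ : ℝ → ℝ) (n : ℕ) : Measure ℝ :=
  (convPow F n).map fun y => y / linv ℓ (n : ℝ)

instance (n : ℕ) : IsProbabilityMeasure (scaledLaw F ℓ n) :=
  Measure.isProbabilityMeasure_map (by fun_prop)

lemma charFun_scaledLaw (n : ℕ) (s : ℝ) :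
    charFun (scaledLaw F ℓ n) s = charFun F (s / linv ℓ n) ^ n := by
  rw [← charFun_convPow, scaledLaw]
  have := charFun_map_mul (μ := convPow F n) (linv ℓ n)⁻¹ s
  rw [show (fun y : ℝ => y / linv ℓ n) = fun y => (linv ℓ n)⁻¹ * y by
    ext y; rw [div_eq_inv_mul], this, div_eq_inv_mul]

lemma integrable_exp_mul_I (μ : Measure ℝ) [IsFiniteMeasure μ] (s : ℝ) :
    Integrable (fun x : ℝ => Complex.exp (s * x * Complex.I)) μ := by
  refine (integrable_const (1:ℝ)).mono' (by fun_prop) (Eventually.of_forall fun x => ?_)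
  rw [← Complex.ofReal_mul, Complex.norm_exp_ofReal_mul_I]

lemma StableLimit.tendsto_charFun (hg : StableLimit F ℓ g) (s : ℝ) :
    Tendsto (fun n => charFun (scaledLaw F ℓ n) s) atTop (𝓝 (gHat g s)) := by
  have hc := hg (BoundedContinuousFunction.ofNormedAddCommGroup (fun x => Real.cos (s * x))
    (by fun_prop) 1 fun x => Real.abs_cos_le_one _)
  have hs := hg (BoundedContinuousFunction.ofNormedAddCommGroup (fun x => Real.sin (s * x))
    (by fun_prop) 1 fun x => Real.abs_sin_le_one _)
  simp only [BoundedContinuousFunction.coe_ofNormedAddCommGroup] at hc hs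
  have key : ∀ (z : ℂ), z = (z.re : ℂ) + z.im * Complex.I := fun z => (Complex.re_add_im z).symm
  have h1 : ∀ n : ℕ, charFun (scaledLaw F ℓ n) s =
      ((∫ x, Real.cos (s * x) ∂(scaledLaw F ℓ n) : ℝ) : ℂ) +
        ((∫ x, Real.sin (s * x) ∂(scaledLaw F ℓ n) : ℝ) : ℂ) * Complex.I := by
    intro n
    rw [charFun_apply_real]
    have hi := integrable_exp_mul_I (scaledLaw F ℓ n) s
    have e1 := integral_re hi
    have e2 := integral_im hi
    simp only [RCLike.re_eq_complex_re, RCLike.im_eq_complex_im] at e1 e2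
    rw [key (∫ x : ℝ, Complex.exp (s * x * Complex.I) ∂(scaledLaw F ℓ n)), ← e1, ← e2]
    simp only [← Complex.ofReal_mul, Complex.exp_ofReal_mul_I_re, Complex.exp_ofReal_mul_I_im]
  have h2 : gHat g s = ((∫ x, Real.cos (s * x) * g x : ℝ) : ℂ) +
        ((∫ x, Real.sin (s * x) * g x : ℝ) : ℂ) * Complex.I := by
    have hi := integrable_exp_mul_of_integrable hg.integrable s
    have e1 := integral_re hi
    have e2 := integral_im hi
    simp only [RCLike.re_eq_complex_re, RCLike.im_eq_complex_im, Complex.re_mul_ofReal,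
      Complex.im_mul_ofReal] at e1 e2
    rw [gHat, key (∫ x : ℝ, Complex.exp (s * x * Complex.I) * (g x : ℂ)), ← e1, ← e2]
    simp only [← Complex.ofReal_mul, Complex.exp_ofReal_mul_I_re, Complex.exp_ofReal_mul_I_im]
  rw [h2]
  simp only [h1]
  exact ((Complex.continuous_ofReal.tendsto _).comp hc).add
    (((Complex.continuous_ofReal.tendsto _).comp hs).mul_const _)

/-- Characteristic functions converge along convergent arguments. -/
lemma StableLimit.tendsto_charFun_of_tendsto (hg : StableLimit F ℓ g) {ι : Type*} {l : Filter ι}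
    {n : ι → ℕ} (hn : Tendsto n l atTop) {s : ι → ℝ} {σ : ℝ} (hs : Tendsto s l (𝓝 σ)) :
    Tendsto (fun i => charFun (scaledLaw F ℓ (n i)) (s i)) l (𝓝 (gHat g σ)) := by
  have hmin : ∀ e : ℝ, ∀ y : ℝ, 0 ≤ e → ‖min (e * |y|) 2‖ ≤ 2 := fun e y he => by
    rw [Real.norm_eq_abs, abs_of_nonneg (le_min (by positivity) two_pos.le)]
    exact min_le_right _ _
  have hdiff : ∀ (m : ℕ) (s' : ℝ), ‖charFun (scaledLaw F ℓ m) s' - charFun (scaledLaw F ℓ m) σ‖ ≤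
      ∫ y, min (|s' - σ| * |y|) 2 ∂(scaledLaw F ℓ m) := by
    intro m s'
    rw [charFun_apply_real, charFun_apply_real, ← integral_sub (integrable_exp_mul_I _ _)
      (integrable_exp_mul_I _ _)]
    refine norm_integral_le_of_norm_le ((integrable_const (2:ℝ)).mono' (by fun_prop)
      (Eventually.of_forall fun y => hmin _ y (abs_nonneg _))) (Eventually.of_forall fun y => ?_)
    refine le_min ?_ ?_
    · have : Complex.exp (s' * y * Complex.I) - Complex.exp (σ * y * Complex.I) =
          Complex.exp (σ * y * Complex.I) * (Complex.exp (Complex.I * ((s' - σ) * y : ℝ)) - 1) := by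
        rw [mul_sub, ← Complex.exp_add, mul_one]
        congr 2
        push_cast
        ring
      rw [this, norm_mul, ← Complex.ofReal_mul, Complex.norm_exp_ofReal_mul_I, one_mul, ← abs_mul]
      exact Real.norm_exp_I_mul_ofReal_sub_one_le
    · refine (norm_sub_le _ _).trans ?_
      rw [← Complex.ofReal_mul, ← Complex.ofReal_mul, Complex.norm_exp_ofReal_mul_I,
        Complex.norm_exp_ofReal_mul_I]
      norm_num
  have hsmall : ∀ ε > 0, ∃ e > 0, ∫ y, min (e * |y|) 2 * g y < ε := by
    intro ε hε
    have : Tendsto (fun e : ℝ => ∫ y, min (e * |y|) 2 * g y) (𝓝[>] 0)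
        (𝓝 (∫ y, min (0 * |y|) 2 * g y)) := by
      refine tendsto_integral_filter_of_dominated_convergence (fun y => 2 * ‖g y‖) ?_ ?_
        (hg.integrable.norm.const_mul 2) ?_
      · refine Eventually.of_forall fun e => ?_
        exact (by fun_prop : Continuous fun y : ℝ => min (e * |y|) 2).aestronglyMeasurable.mul
          hg.integrable.aestronglyMeasurable
      · filter_upwards [self_mem_nhdsWithin] with e he
        refine Eventually.of_forall fun y => ?_
        rw [norm_mul]
        gcongr
        exact hmin e y (le_of_lt he)
      · refine Eventually.of_forall fun y => ?_
        refine (Tendsto.mul_const _ ?_)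
        exact ((by fun_prop : Continuous fun e : ℝ => min (e * |y|) 2).tendsto 0).mono_left
          nhdsWithin_le_nhds
    simp only [zero_mul, min_eq_left two_pos.le, integral_zero] at this
    obtain ⟨e, he1, he2⟩ := ((this.eventually (gt_mem_nhds hε)).and self_mem_nhdsWithin).exists
    exact ⟨e, he2, he1⟩
  have h0 : Tendsto (fun i => charFun (scaledLaw F ℓ (n i)) (s i) - charFun (scaledLaw F ℓ (n i)) σ)
      l (𝓝 0) := by
    rw [tendsto_zero_iff_norm_tendsto_zero, tendsto_order]
    refine ⟨fun a ha => Eventually.of_forall fun i => ha.trans_le (norm_nonneg _), fun ε hε => ?_⟩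
    obtain ⟨e, he, hlt⟩ := hsmall ε hε
    have h1 := hg (BoundedContinuousFunction.ofNormedAddCommGroup (fun y => min (e * |y|) 2)
      (by fun_prop) 2 fun y => hmin e y he.le)
    simp only [BoundedContinuousFunction.coe_ofNormedAddCommGroup] at h1
    have h2 := (h1.comp hn).eventually (gt_mem_nhds hlt)
    have h3 : ∀ᶠ i in l, |s i - σ| < e := by
      have := (hs.sub_const σ).abs
      rw [sub_self, abs_zero] at this
      exact this.eventually (gt_mem_nhds he)
    filter_upwards [h2, h3] with i hi2 hi3
    refine (hdiff _ _).trans_lt (lt_of_le_of_lt ?_ hi2)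
    refine integral_mono ?_ ?_ fun y => ?_
    · exact (integrable_const (2:ℝ)).mono' (by fun_prop)
        (Eventually.of_forall fun y => hmin _ y (abs_nonneg _))
    · exact (integrable_const (2:ℝ)).mono' (by fun_prop)
        (Eventually.of_forall fun y => hmin _ y he.le)
    · simp only
      gcongr
  simpa using h0.add ((hg.tendsto_charFun σ).comp hn)

end StableLimit

end

section

open scoped Topology ENNReal FourierTransform

/-- The standing assumptions on the step distribution. -/
structure Setup (F : Measure ℝ) (ℓ g : ℝ → ℝ) (α : ℝ) : Prop where
  pos : 0 < α
  le_half : α ≤ 1 / 2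
  regVary : RegVary ℓ α
  rightTail : RightTail F ℓ
  stable : StableLimit F ℓ g

namespace Setup

variable {F : Measure ℝ} [IsProbabilityMeasure F] {ℓ g : ℝ → ℝ} {α : ℝ}

lemma rv (S : Setup F ℓ g α) : MonoRV (invTail F) α := monoRV_invTail S.regVary S.rightTail

lemma tendsto_ratio (S : Setup F ℓ g α) : Tendsto (fun x => ℓ x / invTail F x) atTop (𝓝 1) :=
  tendsto_div_invTail S.rightTail

lemma tendsto_linv (S : Setup F ℓ g α) : Tendsto (linv ℓ) atTop atTop := by
  have hmono := linv_mono S.rv S.pos S.tendsto_ratio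
  have hone := one_le_linv S.rv S.pos S.tendsto_ratio
  refine tendsto_atTop_atTop_of_monotone hmono ?_
  by_contra! hcon
  obtain ⟨B, hB⟩ := hcon
  obtain ⟨c, hc, r, hr, -, hφ⟩ := exists_norm_charFun_le S.pos S.rv (rtail_pos S.rightTail)
  have hB0 : 0 < B := by linarith [hB 0, hone 0]
  have hzero : ∀ s : ℝ, 0 < s → s ≤ r → gHat g s = 0 := by
    intro s hs hsr
    refine tendsto_nhds_unique (S.stable.tendsto_charFun s) ?_
    have hlim : Tendsto (fun n : ℕ => Real.exp (-(c / invTail F (B / s))) ^ n) atTop (𝓝 0) := by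
      refine tendsto_pow_atTop_nhds_zero_of_lt_one (Real.exp_nonneg _) ?_
      rw [Real.exp_lt_one_iff]
      have := S.rv.pos (B / s)
      have : 0 < c / invTail F (B / s) := by positivity
      linarith
    refine squeeze_zero_norm (fun n => ?_) hlim
    rw [charFun_scaledLaw, norm_pow]
    have ha := hone n
    have ha0 : 0 < linv ℓ n := by linarith
    refine pow_le_pow_left₀ (norm_nonneg _) ?_ n
    have hsn : 0 < s / linv ℓ n := by positivity
    refine (hφ (s / linv ℓ n) hsn.ne' ?_).trans ?_
    · rw [abs_of_pos hsn]
      exact (div_le_self hs.le ha).trans hsr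
    · rw [abs_of_pos hsn, one_div_div]
      refine Real.exp_le_exp.2 (neg_le_neg (div_le_div_of_nonneg_left hc.le (S.rv.pos _) ?_))
      refine S.rv.mono ?_
      gcongr
      exact (hB n).le
  have h1 : Tendsto (gHat g) (𝓝[>] 0) (𝓝 (gHat g 0)) :=
    ((continuous_gHat S.stable.integrable).tendsto 0).mono_left nhdsWithin_le_nhds
  have h2 : Tendsto (gHat g) (𝓝[>] 0) (𝓝 0) := by
    refine tendsto_const_nhds.congr' ?_
    filter_upwards [Ioc_mem_nhdsGT hr] with s hs
    exact (hzero s hs.1 hs.2).symm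
  have := tendsto_nhds_unique h1 h2
  rw [gHat_zero S.stable] at this
  exact one_ne_zero this

lemma inv (S : Setup F ℓ g α) : AsympInv (invTail F) (linv ℓ) :=
  asympInv_linv S.rv S.pos S.tendsto_ratio S.tendsto_linv

/-- Stretched exponential bound for the powers of the characteristic function. -/
lemma exists_norm_charFun_pow_le (S : Setup F ℓ g α) :
    ∃ C > 0, ∃ c > 0, ∃ r > 0, ∀ (n : ℕ) (t : ℝ), |t| ≤ r →
      ‖charFun F t‖ ^ n ≤ C * Real.exp (-(c * |linv ℓ n * t| ^ (α / 2))) := by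
  obtain ⟨c, hc, r, hr, hr1, hφ⟩ := exists_norm_charFun_le S.pos S.rv (rtail_pos S.rightTail)
  obtain ⟨C1, hC1, hP⟩ := S.rv.potter_lower (q := α / 2) (by linarith [S.pos]) (by linarith [S.pos])
  obtain ⟨C2, hC2, hB⟩ := S.inv.bounds
  have hκ : 0 < α / 2 := by linarith [S.pos]
  set c' := c / (C1 * C2)
  have hc' : 0 < c' := by positivity
  have hb1 := S.inv.one_le 1
  refine ⟨Real.exp (c' * linv ℓ 1 ^ (α / 2)), Real.exp_pos _, c', hc', r, hr, fun n t ht => ?_⟩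
  have hbn := S.inv.one_le n
  have htriv : |linv ℓ n * t| ≤ linv ℓ 1 →
      ‖charFun F t‖ ^ n ≤ Real.exp (c' * linv ℓ 1 ^ (α / 2)) *
        Real.exp (-(c' * |linv ℓ n * t| ^ (α / 2))) := by
    intro h
    refine (pow_le_one₀ (norm_nonneg _) (norm_charFun_le_one t)).trans ?_
    rw [← Real.exp_add]
    refine Real.one_le_exp ?_
    have := Real.rpow_le_rpow (abs_nonneg _) h hκ.le
    have := mul_le_mul_of_nonneg_left this hc'.le
    linarith
  rcases eq_or_ne t 0 with rfl | ht0
  · exact htriv (by rw [mul_zero, abs_zero]; linarith)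
  have htpos : 0 < |t| := abs_pos.2 ht0
  rcases le_total |linv ℓ n * t| 1 with h1 | h1
  · exact htriv (h1.trans hb1)
  rcases Nat.eq_zero_or_pos n with rfl | hn
  · refine htriv ?_
    rw [abs_mul, abs_of_pos (by linarith)]
    have : linv ℓ (0:ℕ) ≤ linv ℓ 1 := S.inv.mono (by norm_num)
    nlinarith
  have hn1 : (1:ℝ) ≤ n := by exact_mod_cast hn
  have habs : |linv ℓ n * t| = linv ℓ n / (1 / |t|) := by
    rw [abs_mul, abs_of_pos (by linarith : 0 < linv ℓ n)]
    field_simp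
  have hp := hP (1 / |t|) (linv ℓ n) ((one_le_div htpos).2 (ht.trans hr1)) (by
    rw [div_le_iff₀ htpos]
    rwa [abs_mul, abs_of_pos (by linarith : 0 < linv ℓ n)] at h1)
  rw [← habs] at hp
  have hHb := (hB n hn1).2
  have hHt := S.rv.pos (1 / |t|)
  have hmain : c' * |linv ℓ n * t| ^ (α / 2) ≤ n * (c / invTail F (1 / |t|)) := by
    rw [← mul_div_assoc, le_div_iff₀ hHt, mul_assoc]
    calc c' * (|linv ℓ n * t| ^ (α / 2) * invTail F (1 / |t|))
        ≤ c' * (C1 * (C2 * n)) := by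
          refine mul_le_mul_of_nonneg_left (hp.trans ?_) hc'.le
          gcongr
      _ = n * c := by simp only [c']; field_simp
  calc ‖charFun F t‖ ^ n ≤ Real.exp (-(c / invTail F (1 / |t|))) ^ n :=
        pow_le_pow_left₀ (norm_nonneg _) (hφ t ht0 ht) n
    _ = Real.exp (-(n * (c / invTail F (1 / |t|)))) := by
        rw [← Real.exp_nat_mul]; congr 1; ring
    _ ≤ Real.exp (-(c' * |linv ℓ n * t| ^ (α / 2))) := Real.exp_le_exp.2 (neg_le_neg hmain)
    _ ≤ _ := le_mul_of_one_le_left (Real.exp_nonneg _) (Real.one_le_exp (by positivity))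

lemma exists_norm_gHat_le (S : Setup F ℓ g α) :
    ∃ C > 0, ∃ c > 0, ∀ s : ℝ, ‖gHat g s‖ ≤ C * Real.exp (-(c * |s| ^ (α / 2))) := by
  obtain ⟨C, hC, c, hc, r, hr, h⟩ := S.exists_norm_charFun_pow_le
  refine ⟨C, hC, c, hc, fun s => ?_⟩
  refine le_of_tendsto (S.stable.tendsto_charFun s).norm ?_
  have : Tendsto (fun n : ℕ => linv ℓ n) atTop atTop :=
    S.tendsto_linv.comp tendsto_natCast_atTop_atTop
  filter_upwards [this.eventually_ge_atTop (|s| / r)] with n hn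
  have hb : 0 < linv ℓ n := by linarith [S.inv.one_le n]
  rw [charFun_scaledLaw, norm_pow]
  have := h n (s / linv ℓ n) (by
    rw [abs_div, abs_of_pos hb, div_le_iff₀ hb]
    rw [div_le_iff₀ hr] at hn
    linarith)
  rwa [mul_div_cancel₀ _ hb.ne'] at this

lemma integrable_gHat (S : Setup F ℓ g α) : Integrable (gHat g) := by
  obtain ⟨C, hC, c, hc, h⟩ := S.exists_norm_gHat_le
  exact ((integrable_exp_neg_mul_abs_rpow hc (by linarith [S.pos])).const_mul C).mono'
    (continuous_gHat S.stable.integrable).aestronglyMeasurable (Eventually.of_forall h)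

end Setup

/-- The inverse Fourier transform of `gHat g`, the continuous version of the density. -/
def gInv (g : ℝ → ℝ) (y : ℝ) : ℂ :=
  (2 * π : ℝ)⁻¹ * ∫ s : ℝ, Complex.exp (-(s * y * Complex.I)) * gHat g s

lemma gInv_eq_fourierInv (g : ℝ → ℝ) (y : ℝ) :
    gInv g y = 𝓕⁻ (𝓕 fun y => (g y : ℂ)) y := by
  have h := Measure.integral_comp_mul_left
    (fun s : ℝ => Complex.exp (-(s * y * Complex.I)) * gHat g s) (-(2 * π))
  have h2 : |(-(2 * π))⁻¹| = (2 * π)⁻¹ := by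
    rw [abs_inv, abs_neg, abs_of_pos (by positivity)]
  rw [h2, Complex.real_smul] at h
  rw [gInv, ← h, Real.fourierInv_eq']
  refine integral_congr_ae (Eventually.of_forall fun w => ?_)
  simp only [gHat_eq_fourier, smul_eq_mul, neg_mul]
  congr 2
  simp only [RCLike.inner_apply, conj_trivial]
  push_cast
  ring

/-- The limiting density of the renewal measure along `n = v H(x)`. -/
def gammaFn (g : ℝ → ℝ) (α v : ℝ) : ℂ :=
  ((v ^ (-(1 / α)) : ℝ) : ℂ) * gInv g (v ^ (-(1 / α)))

namespace Setup

variable {F : Measure ℝ} [IsProbabilityMeasure F] {ℓ g : ℝ → ℝ} {α : ℝ}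

lemma gInv_ae_eq (S : Setup F ℓ g α) : ∀ᵐ y, (g y : ℂ) = gInv g y := by
  have h : Integrable (𝓕 fun y => (g y : ℂ)) := by
    have h1 := S.integrable_gHat.comp_mul_left' (R := -(2 * π)) (by
      have := Real.pi_pos
      linarith)
    refine h1.congr (Eventually.of_forall fun w => ?_)
    simp only [gHat_eq_fourier, neg_mul]
  filter_upwards [ae_eq_fourierInv_fourier (S.stable.integrable.ofReal (𝕜 := ℂ)) h] with y hy
  rw [gInv_eq_fourierInv]
  exact hy

lemma continuous_gInv (S : Setup F ℓ g α) : Continuous (gInv g) := by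
  refine continuous_const.mul (continuous_of_dominated (bound := fun s => ‖gHat g s‖)
    (fun y => ?_) (fun y => ?_) S.integrable_gHat.norm ?_)
  · exact ((by fun_prop : Continuous fun s : ℝ =>
      Complex.exp (-(s * y * Complex.I))).mul
      (continuous_gHat S.stable.integrable)).aestronglyMeasurable
  · refine Eventually.of_forall fun s => ?_
    rw [norm_mul, ← neg_mul, ← Complex.ofReal_mul, ← Complex.ofReal_neg,
      Complex.norm_exp_ofReal_mul_I, one_mul]
  · exact Eventually.of_forall fun s => by fun_prop

lemma _root_.SRT.exists_norm_gInv_le (g : ℝ → ℝ) : ∃ B ≥ 0, ∀ y, ‖gInv g y‖ ≤ B := by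
  refine ⟨(2 * π)⁻¹ * ∫ s, ‖gHat g s‖, by positivity, fun y => ?_⟩
  rw [gInv, norm_mul, Complex.norm_real, Real.norm_of_nonneg (by positivity)]
  gcongr
  refine (norm_integral_le_integral_norm _).trans (le_of_eq ?_)
  congr 1
  ext s
  rw [norm_mul, ← neg_mul, ← Complex.ofReal_mul, ← Complex.ofReal_neg,
    Complex.norm_exp_ofReal_mul_I, one_mul]

lemma integrable_gInv (S : Setup F ℓ g α) : Integrable (gInv g) :=
  (S.stable.integrable.ofReal (𝕜 := ℂ)).congr S.gInv_ae_eq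

lemma integrableOn_rpow_mul_gInv (S : Setup F ℓ g α) :
    IntegrableOn (fun t : ℝ => ((t ^ (-α) : ℝ) : ℂ) * gInv g t) (Ioi 0) := by
  obtain ⟨B, -, hB⟩ := exists_norm_gInv_le g
  rw [← Ioc_union_Ioi_eq_Ioi zero_le_one]
  refine IntegrableOn.union ?_ ?_
  · have h : IntegrableOn (fun t : ℝ => t ^ (-α)) (Ioc 0 1) :=
      (intervalIntegrable_iff_integrableOn_Ioc_of_le zero_le_one).1
        (intervalIntegral.intervalIntegrable_rpow' (by linarith [S.le_half]))
    have h2 : Integrable (fun t : ℝ => ((t ^ (-α) : ℝ) : ℂ)) (volume.restrict (Ioc 0 1)) :=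
      Integrable.ofReal (𝕜 := ℂ) h
    exact h2.mul_bdd (c := B) S.continuous_gInv.aestronglyMeasurable
      (Eventually.of_forall hB)
  · refine (S.integrable_gInv.integrableOn (s := Ioi 1)).bdd_mul (c := 1) ?_ ?_
    · exact (Complex.measurable_ofReal.comp (by fun_prop)).aestronglyMeasurable
    · rw [ae_restrict_iff' measurableSet_Ioi]
      refine Eventually.of_forall fun t ht => ?_
      have ht1 : (1:ℝ) < t := ht
      rw [Complex.norm_real, Real.norm_of_nonneg (Real.rpow_nonneg (by linarith) _)]
      exact Real.rpow_le_one_of_one_le_of_nonpos ht1.le (by linarith [S.pos])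

lemma gammaFn_comp {α t : ℝ} (hα : 0 < α) (ht : 0 < t) :
    (|-α| * t ^ (-α - 1)) • gammaFn g α (t ^ (-α)) = (α:ℂ) * (((t ^ (-α) : ℝ) : ℂ) * gInv g t) := by
  have h : (t ^ (-α)) ^ (-(1 / α)) = t := by
    rw [← Real.rpow_mul ht.le]
    rw [show -α * -(1 / α) = 1 by field_simp, Real.rpow_one]
  rw [gammaFn, h, abs_neg, abs_of_pos hα, Complex.real_smul, Real.rpow_sub_one ht.ne']
  push_cast
  have : (t:ℂ) ≠ 0 := by exact_mod_cast ht.ne'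
  field_simp

lemma integrableOn_gammaFn (S : Setup F ℓ g α) : IntegrableOn (gammaFn g α) (Ioi 0) := by
  rw [← integrableOn_Ioi_comp_rpow_iff (gammaFn g α) (neg_ne_zero.2 S.pos.ne')]
  refine IntegrableOn.congr_fun (Integrable.const_mul S.integrableOn_rpow_mul_gInv (α:ℂ))
    (fun t ht => (gammaFn_comp S.pos ht).symm) measurableSet_Ioi

lemma integral_gammaFn (S : Setup F ℓ g α) :
    ∫ v in Ioi (0:ℝ), gammaFn g α v = ((α * ∫ t in Ioi (0:ℝ), t ^ (-α) * g t : ℝ) : ℂ) := by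
  rw [← integral_comp_rpow_Ioi (gammaFn g α) (neg_ne_zero.2 S.pos.ne'),
    setIntegral_congr_fun measurableSet_Ioi (fun t ht => gammaFn_comp S.pos ht),
    integral_const_mul, Complex.ofReal_mul, ← integral_complex_ofReal]
  congr 1
  refine integral_congr_ae (ae_restrict_of_ae ?_)
  filter_upwards [S.gInv_ae_eq] with t ht
  rw [← ht, Complex.ofReal_mul]

end Setup

end

section

/-! ### The triangular kernel and concentration bounds -/

/-- The triangular kernel. -/
def tri (R t : ℝ) : ℝ := max 0 (R - |t|)

/-- The Fourier transform of the triangular kernel. -/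
def rho (R s : ℝ) : ℝ := ∫ t, tri R t * Real.cos (t * s)

lemma tri_nonneg (R t : ℝ) : 0 ≤ tri R t := le_max_left _ _

lemma tri_le {R : ℝ} (hR : 0 < R) (t : ℝ) : tri R t ≤ R :=
  max_le hR.le (by linarith [abs_nonneg t])

lemma tri_eq_zero {R t : ℝ} (h : R ≤ |t|) : tri R t = 0 := max_eq_left (by linarith)

@[fun_prop]
lemma continuous_tri (R : ℝ) : Continuous (tri R) := by
  unfold tri
  fun_prop

lemma tri_neg (R t : ℝ) : tri R (-t) = tri R t := by simp [tri]

lemma hasCompactSupport_tri (R : ℝ) : HasCompactSupport (tri R) := by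
  refine HasCompactSupport.intro (isCompact_Icc (a := -R) (b := R)) fun t ht => ?_
  refine tri_eq_zero ?_
  by_contra h
  exact ht (abs_le.1 (not_le.1 h).le)

lemma integrable_tri (R : ℝ) : Integrable (tri R) :=
  (continuous_tri R).integrable_of_hasCompactSupport (hasCompactSupport_tri R)

lemma integrable_tri_mul_cos (R s : ℝ) : Integrable fun t => tri R t * Real.cos (t * s) :=
  (integrable_tri R).mul_bdd (c := 1) (by fun_prop)
    (Eventually.of_forall fun t => Real.abs_cos_le_one _)

lemma integral_tri_mul_exp (R s : ℝ) :
    ∫ t : ℝ, (tri R t : ℂ) * Complex.exp (t * s * Complex.I) = rho R s := by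
  have hsin : ∫ t : ℝ, tri R t * Real.sin (t * s) = 0 := by
    have h := integral_neg_eq_self (fun t : ℝ => tri R t * Real.sin (t * s)) volume
    simp only [tri_neg, neg_mul, Real.sin_neg, mul_neg] at h
    rw [integral_neg] at h
    linarith
  have hi : Integrable fun t => tri R t * Real.sin (t * s) :=
    (integrable_tri R).mul_bdd (c := 1) (by fun_prop)
      (Eventually.of_forall fun t => Real.abs_sin_le_one _)
  have h : ∀ t : ℝ, (tri R t : ℂ) * Complex.exp (t * s * Complex.I) =
      ((tri R t * Real.cos (t * s) : ℝ) : ℂ) + ((tri R t * Real.sin (t * s) : ℝ) : ℂ) *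
        Complex.I := by
    intro t
    rw [← Complex.ofReal_mul, Complex.exp_mul_I]
    push_cast
    ring
  simp_rw [h]
  rw [integral_add ((integrable_tri_mul_cos R s).ofReal) (hi.ofReal.mul_const _),
    integral_mul_const, integral_complex_ofReal, integral_complex_ofReal, hsin, rho]
  simp

lemma rho_eq {R : ℝ} (hR : 0 < R) (s : ℝ) :
    rho R s = 2 * ∫ t in (0:ℝ)..R, (R - t) * Real.cos (t * s) := by
  have h := integral_comp_abs (f := fun u => max 0 (R - u) * Real.cos (u * s))
  have h1 : ∀ t : ℝ, max 0 (R - |t|) * Real.cos (|t| * s) = tri R t * Real.cos (t * s) := by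
    intro t
    rcases abs_cases t with ⟨h, -⟩ | ⟨h, -⟩ <;> simp [tri, h]
  simp_rw [h1] at h
  rw [rho, h, intervalIntegral.integral_of_le hR.le]
  congr 1
  have h2 : ∫ t in Ioi (0:ℝ), max 0 (R - t) * Real.cos (t * s) =
      ∫ t in Ioc 0 R, max 0 (R - t) * Real.cos (t * s) := by
    refine setIntegral_eq_of_subset_of_forall_sdiff_eq_zero measurableSet_Ioi Ioc_subset_Ioi_self ?_
    rintro t ⟨ht, ht'⟩
    have : R < t := by
      by_contra hh
      exact ht' ⟨ht, not_lt.1 hh⟩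
    rw [max_eq_left (by linarith), zero_mul]
  rw [h2]
  refine setIntegral_congr_fun measurableSet_Ioc fun t ht => ?_
  rw [max_eq_right (by linarith [ht.2])]

lemma rho_of_ne_zero {R : ℝ} (hR : 0 < R) {s : ℝ} (hs : s ≠ 0) :
    rho R s = 2 * ((1 - Real.cos (R * s)) / s ^ 2) := by
  have hd : ∀ t ∈ uIcc 0 R, HasDerivAt
      (fun t => (R - t) * Real.sin (t * s) / s - Real.cos (t * s) / s ^ 2)
      ((R - t) * Real.cos (t * s)) t := by
    intro t _
    have h1 : HasDerivAt (fun t : ℝ => t * s) s t := by simpa using (hasDerivAt_id t).mul_const s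
    have h2 := (((hasDerivAt_id t).const_sub R).mul h1.sin).div_const s
    have h3 := h1.cos.div_const (s ^ 2)
    refine (h2.sub h3).congr_deriv ?_
    simp only [id]
    field_simp
    ring
  rw [rho_eq hR, intervalIntegral.integral_eq_sub_of_hasDerivAt hd
    (by apply Continuous.intervalIntegrable; fun_prop)]
  simp only [sub_self, zero_mul, zero_div, sub_zero, Real.sin_zero, mul_zero, Real.cos_zero]
  ring

lemma rho_nonneg {R : ℝ} (hR : 0 < R) (s : ℝ) : 0 ≤ rho R s := by
  rcases eq_or_ne s 0 with rfl | hs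
  · rw [rho_eq hR]
    simp only [mul_zero, Real.cos_zero, mul_one]
    refine mul_nonneg two_pos.le (intervalIntegral.integral_nonneg hR.le fun t ht => ?_)
    linarith [ht.2]
  · rw [rho_of_ne_zero hR hs]
    have : 0 ≤ 1 - Real.cos (R * s) := by linarith [Real.cos_le_one (R * s)]
    positivity

lemma integral_sub_id (R : ℝ) : ∫ t in (0:ℝ)..R, (R - t) = R ^ 2 / 2 := by
  rw [intervalIntegral.integral_sub (by simp) (by simp)]
  simp
  ring

lemma rho_ge {R : ℝ} (hR : 0 < R) {s : ℝ} (hs : |s| ≤ 1 / R) : R ^ 2 / 2 ≤ rho R s := by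
  rw [rho_eq hR]
  have h : ∫ t in (0:ℝ)..R, (R - t) * (1 / 2) ≤ ∫ t in (0:ℝ)..R, (R - t) * Real.cos (t * s) := by
    refine intervalIntegral.integral_mono_on hR.le (by apply Continuous.intervalIntegrable; fun_prop)
      (by apply Continuous.intervalIntegrable; fun_prop) fun t ht => ?_
    have h1 : |t * s| ≤ 1 := by
      rw [abs_mul, abs_of_nonneg ht.1]
      calc t * |s| ≤ R * (1 / R) := mul_le_mul ht.2 hs (abs_nonneg _) hR.le
        _ = 1 := mul_one_div_cancel hR.ne'
    have h2 : 1 / 2 ≤ Real.cos (t * s) := by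
      have := Real.one_sub_sq_div_two_le_cos (x := t * s)
      have h3 : (t * s) ^ 2 ≤ 1 := (sq_le_one_iff_abs_le_one _).2 h1
      linarith
    exact mul_le_mul_of_nonneg_left h2 (by linarith [ht.2])
  rw [intervalIntegral.integral_mul_const, integral_sub_id] at h
  linarith

lemma rho_le {R : ℝ} (hR : 0 < R) (s : ℝ) : rho R s ≤ R ^ 2 := by
  rw [rho_eq hR]
  have h : ∫ t in (0:ℝ)..R, (R - t) * Real.cos (t * s) ≤ ∫ t in (0:ℝ)..R, (R - t) := by
    refine intervalIntegral.integral_mono_on hR.le (by apply Continuous.intervalIntegrable; fun_prop)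
      (by apply Continuous.intervalIntegrable; fun_prop) fun t ht => ?_
    exact mul_le_of_le_one_right (by linarith [ht.2]) (Real.cos_le_one _)
  rw [integral_sub_id] at h
  linarith

@[fun_prop]
lemma continuous_rho (R : ℝ) : Continuous (rho R) := by
  refine continuous_of_dominated (bound := tri R) (fun s => ?_) (fun s => ?_) (integrable_tri R) ?_
  · exact (integrable_tri_mul_cos R s).aestronglyMeasurable
  · refine Eventually.of_forall fun t => ?_
    rw [norm_mul, Real.norm_of_nonneg (tri_nonneg R t)]
    exact mul_le_of_le_one_right (tri_nonneg R t) (Real.abs_cos_le_one _)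
  · exact Eventually.of_forall fun t => by fun_prop

/-- Fubini for characteristic functions. -/
lemma integral_mul_charFun (μ : Measure ℝ) [IsFiniteMeasure μ] {K : ℝ → ℂ} (hK : Integrable K) :
    ∫ t, K t * charFun μ t = ∫ x : ℝ, (∫ t : ℝ, K t * Complex.exp (t * x * Complex.I)) ∂μ := by
  simp_rw [charFun_apply_real, ← integral_const_mul]
  rw [integral_integral_swap]
  have h1 : Integrable (fun p : ℝ × ℝ => K p.1) (volume.prod μ) := hK.comp_fst μ
  refine h1.mul_bdd (f := fun p : ℝ × ℝ => K p.1)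
    (g := fun p : ℝ × ℝ => Complex.exp (p.1 * p.2 * Complex.I)) (c := 1) (by fun_prop)
    (Eventually.of_forall fun p => ?_)
  rw [← Complex.ofReal_mul, Complex.norm_exp_ofReal_mul_I]

lemma integral_tri_sub_mul_exp (R θ z x : ℝ) :
    ∫ t : ℝ, ((tri R (t - θ) : ℂ) * Complex.exp (-(t * z * Complex.I))) *
      Complex.exp (t * x * Complex.I) =
      Complex.exp (θ * (x - z) * Complex.I) * rho R (x - z) := by
  rw [← integral_tri_mul_exp, ← integral_const_mul,
    ← integral_sub_right_eq_self (fun t : ℝ => Complex.exp (θ * (x - z) * Complex.I) *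
      ((tri R t : ℂ) * Complex.exp (t * (x - z : ℝ) * Complex.I))) θ]
  refine integral_congr_ae (Eventually.of_forall fun t => ?_)
  simp only
  rw [mul_assoc, ← Complex.exp_add, mul_left_comm, ← Complex.exp_add]
  congr 2
  push_cast
  ring

lemma integrable_tri_sub_mul_exp (R θ z : ℝ) : Integrable fun t : ℝ =>
    (tri R (t - θ) : ℂ) * Complex.exp (-(t * z * Complex.I)) := by
  refine Integrable.mul_bdd (c := 1) (((integrable_tri R).comp_sub_right θ).ofReal) (by fun_prop)
    (Eventually.of_forall fun t => ?_)
  rw [← neg_mul, ← Complex.ofReal_mul, ← Complex.ofReal_neg, Complex.norm_exp_ofReal_mul_I]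

lemma integral_tri_sub_mul_charFun (μ : Measure ℝ) [IsFiniteMeasure μ] (R θ z : ℝ) :
    ∫ t : ℝ, ((tri R (t - θ) : ℂ) * Complex.exp (-(t * z * Complex.I))) * charFun μ t =
      ∫ x : ℝ, Complex.exp (θ * (x - z) * Complex.I) * rho R (x - z) ∂μ := by
  rw [integral_mul_charFun μ (integrable_tri_sub_mul_exp R θ z)]
  exact integral_congr_ae (Eventually.of_forall fun x => integral_tri_sub_mul_exp R θ z x)

lemma measure_Icc_le (μ : Measure ℝ) [IsFiniteMeasure μ] {R : ℝ} (hR : 0 < R) (z : ℝ) :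
    μ.real (Icc (z - 1 / R) (z + 1 / R)) ≤ 2 / R * ∫ t in -R..R, ‖charFun μ t‖ := by
  have h := integral_tri_sub_mul_charFun μ R 0 z
  simp only [sub_zero, Complex.ofReal_zero, zero_mul, Complex.exp_zero, one_mul] at h
  rw [integral_complex_ofReal] at h
  have hint : Integrable (fun x => rho R (x - z)) μ :=
    (integrable_const (R ^ 2)).mono' (by fun_prop) (Eventually.of_forall fun x => by
      rw [Real.norm_of_nonneg (rho_nonneg hR _)]; exact rho_le hR _)
  have h1 : R ^ 2 / 2 * μ.real (Icc (z - 1 / R) (z + 1 / R)) ≤ ∫ x, rho R (x - z) ∂μ := by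
    rw [mul_comm, ← smul_eq_mul, ← integral_indicator_const _ measurableSet_Icc]
    refine integral_mono ((integrable_const _).indicator measurableSet_Icc) hint fun x => ?_
    by_cases hx : x ∈ Icc (z - 1 / R) (z + 1 / R)
    · rw [indicator_of_mem hx]
      exact rho_ge hR (abs_le.2 ⟨by linarith [hx.1], by linarith [hx.2]⟩)
    · rw [indicator_of_notMem hx]
      exact rho_nonneg hR _
  have h2 : ∫ x, rho R (x - z) ∂μ ≤ R * ∫ t in -R..R, ‖charFun μ t‖ := by
    have h3 := congrArg norm h
    rw [Complex.norm_real, Real.norm_of_nonneg (integral_nonneg fun x => rho_nonneg hR _)] at h3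
    rw [← h3, intervalIntegral.integral_of_le (by linarith), ← integral_const_mul,
      ← integral_indicator measurableSet_Ioc]
    refine norm_integral_le_of_norm_le ?_ (Eventually.of_forall fun t => ?_)
    · rw [integrable_indicator_iff measurableSet_Ioc]
      exact (Continuous.integrableOn_Ioc (by fun_prop))
    · rw [norm_mul, norm_mul, ← neg_mul, ← Complex.ofReal_mul, ← Complex.ofReal_neg,
        Complex.norm_exp_ofReal_mul_I, mul_one, Complex.norm_real,
        Real.norm_of_nonneg (tri_nonneg R t)]
      by_cases ht : t ∈ Ioc (-R) R
      · rw [indicator_of_mem ht]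
        exact mul_le_mul_of_nonneg_right (tri_le hR t) (norm_nonneg _)
      · rw [indicator_of_notMem ht, tri_eq_zero, zero_mul]
        by_contra hcon
        have := abs_lt.1 (not_le.1 hcon)
        exact ht ⟨this.1, this.2.le⟩
  have h4 : R ^ 2 / 2 * μ.real (Icc (z - 1 / R) (z + 1 / R)) ≤
      R ^ 2 / 2 * (2 / R * ∫ t in -R..R, ‖charFun μ t‖) := by
    refine (h1.trans h2).trans (le_of_eq ?_)
    field_simp
  exact le_of_mul_le_mul_left h4 (by positivity)

/-- A nonnegative characteristic function has the largest local mass at the origin. -/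
lemma integral_tri_sub_le (μ : Measure ℝ) [IsFiniteMeasure μ] {R : ℝ} (hR : 0 < R) (θ : ℝ)
    {f : ℝ → ℝ} (hf : ∀ t, charFun μ t = f t) :
    ∫ t, tri R (t - θ) * f t ≤ ∫ t, tri R t * f t := by
  have h := integral_tri_sub_mul_charFun μ R θ 0
  have h0 := integral_tri_sub_mul_charFun μ R 0 0
  simp only [Complex.ofReal_zero, mul_zero, zero_mul, neg_zero, Complex.exp_zero, mul_one, sub_zero,
    one_mul, hf, ← Complex.ofReal_mul, integral_complex_ofReal] at h h0
  have h1 := Complex.ofReal_injective h0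
  rw [h1]
  have h2 := congrArg norm h
  rw [Complex.norm_real] at h2
  refine (le_abs_self _).trans (h2.le.trans ?_)
  have hint : Integrable (fun x => rho R x) μ :=
    (integrable_const (R ^ 2)).mono' (by fun_prop) (Eventually.of_forall fun x => by
      rw [Real.norm_of_nonneg (rho_nonneg hR _)]; exact rho_le hR _)
  refine norm_integral_le_of_norm_le hint (Eventually.of_forall fun x => ?_)
  rw [norm_mul, Complex.norm_exp_ofReal_mul_I, one_mul, Complex.norm_real,
    Real.norm_of_nonneg (rho_nonneg hR _)]

namespace Setup

variable {F : Measure ℝ} [IsProbabilityMeasure F] {ℓ g : ℝ → ℝ} {α : ℝ}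

lemma exists_integral_charFun_pow_local_le (S : Setup F ℓ g α) :
    ∃ r > 0, ∃ C > 0, ∀ (n : ℕ) (θ : ℝ), ∫ t in θ..(θ + r), ‖charFun F t‖ ^ n ≤ C / linv ℓ n := by
  obtain ⟨C, hC, c, hc, r, hr, h⟩ := S.exists_norm_charFun_pow_le
  obtain ⟨D, hD, hDb⟩ := S.inv.exists_le_of_le_two_mul_add_one S.rv S.pos
  set J := ∫ s : ℝ, Real.exp (-(c * |s| ^ (α / 2)))
  have hJ : 0 < J := integral_exp_pos (integrable_exp_neg_mul_abs_rpow hc (by linarith [S.pos]))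
  have heven : ∀ (m : ℕ) (θ : ℝ),
      ∫ t in θ..(θ + r / 2), ‖charFun F t‖ ^ (2 * m) ≤ 2 * C * J / linv ℓ (2 * m : ℕ) := by
    intro m θ
    have hb : 0 < linv ℓ (2 * m : ℕ) := by linarith [S.inv.one_le (2 * m : ℕ)]
    have hf : ∀ t, charFun (symmetrization (convPow F m)) t = ((‖charFun F t‖ ^ (2 * m) : ℝ) : ℂ) := by
      intro t
      rw [charFun_symmetrization, charFun_convPow, norm_pow, ← pow_mul, mul_comm m 2]
    have hsh := integral_tri_sub_le (symmetrization (convPow F m)) hr θ hf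
    have hle1 : ∀ t, ‖charFun F t‖ ^ (2 * m) ≤ 1 := fun t =>
      pow_le_one₀ (norm_nonneg _) (norm_charFun_le_one t)
    have hlow : r / 2 * ∫ t in θ..(θ + r / 2), ‖charFun F t‖ ^ (2 * m) ≤
        ∫ t, tri r (t - θ) * ‖charFun F t‖ ^ (2 * m) := by
      rw [intervalIntegral.integral_of_le (by linarith), ← integral_const_mul,
        ← integral_indicator measurableSet_Ioc]
      refine integral_mono ?_ ?_ fun t => ?_
      · rw [integrable_indicator_iff measurableSet_Ioc]
        exact Continuous.integrableOn_Ioc (by fun_prop)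
      · refine ((integrable_tri r).comp_sub_right θ).mul_bdd (c := 1) (by fun_prop)
          (Eventually.of_forall fun t => ?_)
        rw [Real.norm_of_nonneg (by positivity)]
        exact hle1 t
      · by_cases ht : t ∈ Ioc θ (θ + r / 2)
        · rw [indicator_of_mem ht]
          have : r / 2 ≤ tri r (t - θ) := by
            refine le_max_of_le_right ?_
            rw [abs_of_nonneg (by linarith [ht.1])]
            linarith [ht.2]
          gcongr
        · rw [indicator_of_notMem ht]
          have := tri_nonneg r (t - θ)
          positivity
    have hupp : ∫ t, tri r t * ‖charFun F t‖ ^ (2 * m) ≤ r * C * (J / linv ℓ (2 * m : ℕ)) := by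
      have hJ' : J / linv ℓ (2 * m : ℕ) =
          ∫ t : ℝ, Real.exp (-(c * |linv ℓ (2 * m : ℕ) * t| ^ (α / 2))) := by
        rw [Measure.integral_comp_mul_left
          (fun s : ℝ => Real.exp (-(c * |s| ^ (α / 2)))) (linv ℓ (2 * m : ℕ)),
          abs_of_pos (by positivity), smul_eq_mul, div_eq_inv_mul]
      rw [hJ', ← integral_const_mul]
      refine integral_mono ?_ ?_ fun t => ?_
      · refine (integrable_tri r).mul_bdd (c := 1) (by fun_prop) (Eventually.of_forall fun t => ?_)
        rw [Real.norm_of_nonneg (by positivity)]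
        exact hle1 t
      · exact ((integrable_exp_neg_mul_abs_rpow hc (by linarith [S.pos])).comp_mul_left'
          hb.ne').const_mul _
      · rcases le_total |t| r with ht | ht
        · simp only
          rw [mul_assoc]
          exact mul_le_mul (tri_le hr t) (h _ t ht) (by positivity) hr.le
        · simp only
          rw [tri_eq_zero ht, zero_mul]
          positivity
    have : r / 2 * ∫ t in θ..(θ + r / 2), ‖charFun F t‖ ^ (2 * m) ≤
        r / 2 * (2 * C * J / linv ℓ (2 * m : ℕ)) :=
      (hlow.trans (hsh.trans hupp)).trans (le_of_eq (by ring))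
    exact le_of_mul_le_mul_left this (by positivity)
  refine ⟨r / 2, by positivity, 2 * C * J * max D 1, by positivity, fun n θ => ?_⟩
  have hbn : 0 < linv ℓ n := by linarith [S.inv.one_le n]
  rcases Nat.even_or_odd' n with ⟨m, rfl | rfl⟩
  · refine (heven m θ).trans ?_
    refine div_le_div_of_nonneg_right ?_ hbn.le
    exact le_mul_of_one_le_right (by positivity) (le_max_right _ _)
  · have hb : 0 < linv ℓ (2 * m : ℕ) := by linarith [S.inv.one_le (2 * m : ℕ)]
    have h1 : ∫ t in θ..(θ + r / 2), ‖charFun F t‖ ^ (2 * m + 1) ≤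
        ∫ t in θ..(θ + r / 2), ‖charFun F t‖ ^ (2 * m) := by
      refine intervalIntegral.integral_mono_on (by linarith)
        (Continuous.intervalIntegrable (by fun_prop) _ _)
        (Continuous.intervalIntegrable (by fun_prop) _ _) fun t _ => ?_
      exact pow_le_pow_of_le_one (norm_nonneg _) (norm_charFun_le_one t) (by lia)
    refine h1.trans ((heven m θ).trans ?_)
    rw [div_le_div_iff₀ hb hbn, mul_assoc (2 * C * J)]
    have h2 := hDb (2 * m) (2 * m + 1) (by lia)
    have h3 : D * linv ℓ (2 * m : ℕ) ≤ max D 1 * linv ℓ (2 * m : ℕ) := by gcongr; exact le_max_left _ _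
    gcongr
    exact h2.trans h3

lemma exists_integral_charFun_pow_le (S : Setup F ℓ g α) (R : ℝ) :
    ∃ C > 0, ∀ n : ℕ, ∫ t in -R..R, ‖charFun F t‖ ^ n ≤ C / linv ℓ n := by
  obtain ⟨r, hr, C, hC, h⟩ := S.exists_integral_charFun_pow_local_le
  have hii : ∀ (n : ℕ) (a b : ℝ), IntervalIntegrable (fun t => ‖charFun F t‖ ^ n) volume a b :=
    fun n a b => Continuous.intervalIntegrable (by fun_prop) _ _
  have hN : ∀ (N n : ℕ), ∫ t in -R..(-R + N * r), ‖charFun F t‖ ^ n ≤ N * (C / linv ℓ n) := by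
    intro N n
    induction N with
    | zero => simp
    | succ N ih =>
      rw [← intervalIntegral.integral_add_adjacent_intervals (hii n _ (-R + N * r)) (hii n _ _)]
      have := h n (-R + N * r)
      push_cast
      rw [show -R + (N + 1) * r = -R + N * r + r by ring]
      linarith
  obtain ⟨N, hNR⟩ := exists_nat_ge (2 * |R| / r)
  refine ⟨(N + 1) * C, by positivity, fun n => ?_⟩
  have hb : 0 < linv ℓ n := by linarith [S.inv.one_le n]
  rw [div_le_iff₀ hr] at hNR
  have hnn : ∀ t, 0 ≤ ‖charFun F t‖ ^ n := fun t => by positivity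
  have h1 : ∫ t in -R..R, ‖charFun F t‖ ^ n ≤ ∫ t in -R..(-R + N * r), ‖charFun F t‖ ^ n := by
    rw [← intervalIntegral.integral_add_adjacent_intervals (hii n (-R) R) (hii n R (-R + N * r))]
    have : 0 ≤ ∫ t in R..(-R + N * r), ‖charFun F t‖ ^ n :=
      intervalIntegral.integral_nonneg (by linarith [le_abs_self R]) fun t _ => hnn t
    linarith
  refine (h1.trans (hN N n)).trans ?_
  rw [← mul_div_assoc]
  gcongr
  linarith

/-- Concentration bound for the convolution powers. -/
lemma exists_convPow_Ioc_le (S : Setup F ℓ g α) (h : ℝ) :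
    ∃ C > 0, ∀ (n : ℕ) (z : ℝ), (convPow F n).real (Ioc z (z + h)) ≤ C / linv ℓ n := by
  set k := |h| + 1
  have hk : 0 < k := by positivity
  obtain ⟨C, hC, hCn⟩ := S.exists_integral_charFun_pow_le (1 / k)
  refine ⟨2 * k * C, by positivity, fun n z => ?_⟩
  have h1 := measure_Icc_le (convPow F n) (R := 1 / k) (by positivity) z
  simp only [charFun_convPow, norm_pow, div_div_eq_mul_div, div_one] at h1
  rw [mul_div_assoc]
  refine (measureReal_mono ?_).trans (h1.trans ?_)
  · exact fun x hx => ⟨by linarith [hx.1], by linarith [hx.2, le_abs_self h]⟩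
  · have := hCn n
    gcongr

end Setup

end

section

/-! ### The contribution of intermediate numbers of steps -/

lemma sum_Ico_eq_integral_floor (f : ℕ → ℂ) {M N : ℕ} (h : M ≤ N) :
    ∑ n ∈ Finset.Ico M N, f n = ∫ y in (M:ℝ)..N, f ⌊y⌋₊ := by
  have hpt : ∀ k : ℕ, ∀ y ∈ Ico (k:ℝ) (k + 1 : ℕ), f k = f ⌊y⌋₊ := by
    intro k y hy
    rw [(Nat.floor_eq_iff ((Nat.cast_nonneg k).trans hy.1)).2 ⟨hy.1, by exact_mod_cast hy.2⟩]
  have hle : ∀ k : ℕ, (k:ℝ) ≤ (k + 1 : ℕ) := fun k => by push_cast; linarith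
  have hint : ∀ k : ℕ, IntervalIntegrable (fun y : ℝ => f ⌊y⌋₊) volume k (k + 1 : ℕ) := by
    intro k
    rw [intervalIntegrable_iff_integrableOn_Ico_of_le (hle k)]
    exact IntegrableOn.congr_fun (f := fun _ => f k) (by simp) (hpt k) measurableSet_Ico
  rw [← intervalIntegral.sum_integral_adjacent_intervals_Ico (a := fun k : ℕ => (k:ℝ)) h
    fun k _ => hint k]
  refine Finset.sum_congr rfl fun k _ => ?_
  rw [intervalIntegral.integral_of_le (hle k), ← integral_Ico_eq_integral_Ioc,
    ← setIntegral_congr_fun measurableSet_Ico (hpt k)]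
  simp

lemma norm_exp_neg_mul_I (t z : ℝ) : ‖Complex.exp (-(t * z * Complex.I))‖ = 1 := by
  rw [← neg_mul, ← Complex.ofReal_mul, ← Complex.ofReal_neg, Complex.norm_exp_ofReal_mul_I]

lemma norm_sum_Ico_pow_le {w : ℂ} (hw : ‖w‖ ≤ 1) {c : ℝ} (hc : ‖(1 - w)⁻¹‖ ≤ c) (hw1 : w ≠ 1)
    (M N : ℕ) : ‖∑ n ∈ Finset.Ico M N, w ^ n‖ ≤ 2 * c * ‖w‖ ^ M := by
  rcases le_total M N with h | h
  · rw [geom_sum_Ico hw1 h, norm_div, ← neg_sub 1 w, norm_neg, div_eq_mul_inv, ← norm_inv]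
    have h1 : ‖w ^ N - w ^ M‖ ≤ 2 * ‖w‖ ^ M := by
      refine (norm_sub_le _ _).trans ?_
      rw [norm_pow, norm_pow]
      have := pow_le_pow_of_le_one (norm_nonneg w) hw h
      linarith
    calc ‖w ^ N - w ^ M‖ * ‖(1 - w)⁻¹‖ ≤ 2 * ‖w‖ ^ M * c := by gcongr
      _ = _ := by ring
  · rw [Finset.Ico_eq_empty (by lia), Finset.sum_empty, norm_zero]
    have : 0 ≤ c := (norm_nonneg _).trans hc
    positivity

namespace Setup

variable {F : Measure ℝ} [IsProbabilityMeasure F] {ℓ g : ℝ → ℝ} {α : ℝ}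

lemma tendsto_invTail (S : Setup F ℓ g α) : Tendsto (invTail F) atTop atTop :=
  S.rv.tendsto_atTop S.pos

lemma tendsto_linv_div (S : Setup F ℓ g α) {v : ℝ} (hv : 0 < v) {y : ℝ → ℝ}
    (hy : Tendsto (fun x => y x / invTail F x) atTop (𝓝 v)) :
    Tendsto (fun x => linv ℓ (y x) / x) atTop (𝓝 (v ^ (1 / α))) :=
  SRT.tendsto_linv_div S.rv S.pos S.tendsto_ratio S.tendsto_linv hv hy

lemma eventually_linv_ge (S : Setup F ℓ g α) {δ : ℝ} (hδ : 0 < δ) :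
    ∃ c > 0, ∀ᶠ x in atTop, ∀ y, δ * invTail F x ≤ y → c * x ≤ linv ℓ y := by
  have h := S.tendsto_linv_div (y := fun x => δ * invTail F x) hδ (by
    refine tendsto_const_nhds.congr fun x => ?_
    rw [mul_div_cancel_right₀ _ (S.rv.pos x).ne'])
  have hp : 0 < δ ^ (1 / α) := Real.rpow_pos_of_pos hδ _
  refine ⟨δ ^ (1 / α) / 2, by positivity, ?_⟩
  filter_upwards [h.eventually (lt_mem_nhds (half_lt_self hp)), eventually_gt_atTop 0]
    with x hx hx0 y hy
  rw [lt_div_iff₀ hx0] at hx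
  exact hx.le.trans (S.inv.mono hy)

section Kernel

variable {K : ℝ → ℂ} {B : ℝ}

/-- The Fourier integral near the origin. -/
def innerInt (F : Measure ℝ) (K : ℝ → ℂ) (r : ℝ) (n : ℕ) (z : ℝ) : ℂ :=
  ∫ t : ℝ in Icc (-r) r, K t * (charFun F t ^ n * Complex.exp (-(t * z * Complex.I)))

lemma norm_innerInt_le (hB : ∀ t, ‖K t‖ ≤ B) {r : ℝ} (hr : 0 < r) (n : ℕ) (z : ℝ) :
    ‖innerInt F K r n z‖ ≤ B * ∫ t in -r..r, ‖charFun F t‖ ^ n := by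
  rw [intervalIntegral.integral_of_le (by linarith), ← integral_Icc_eq_integral_Ioc,
    ← integral_const_mul]
  refine norm_integral_le_of_norm_le (Continuous.integrableOn_Icc (by fun_prop))
    (Eventually.of_forall fun t => ?_)
  rw [norm_mul, norm_mul, norm_exp_neg_mul_I, mul_one, norm_pow]
  exact mul_le_mul_of_nonneg_right (hB t) (by positivity)

lemma tendsto_innerInt (S : Setup F ℓ g α) (hKm : Measurable K) (hB : ∀ t, ‖K t‖ ≤ B)
    (hK0 : ContinuousAt K 0) {C c r : ℝ} (hC : 0 < C) (hc : 0 < c) (hr : 0 < r)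
    (hφ : ∀ (n : ℕ) (t : ℝ), |t| ≤ r →
      ‖charFun F t‖ ^ n ≤ C * Real.exp (-(c * |linv ℓ n * t| ^ (α / 2))))
    {z : ℝ → ℝ} (hz : Tendsto (fun x => z x / x) atTop (𝓝 1)) {v : ℝ} (hv : 0 < v)
    {n : ℝ → ℕ} (hn : Tendsto (fun x => (n x : ℝ) / invTail F x) atTop (𝓝 v)) :
    Tendsto (fun x : ℝ => (x:ℂ) * innerInt F K r (n x) (z x)) atTop
      (𝓝 (K 0 * (2 * π) * gammaFn g α v)) := by
  have hκ : 0 < α / 2 := by linarith [S.pos]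
  have hB0 : 0 ≤ B := (norm_nonneg _).trans (hB 0)
  have hbx := S.tendsto_linv_div hv hn
  have hp : 0 < v ^ (1 / α) := Real.rpow_pos_of_pos hv _
  set p := v ^ (1 / α)
  have hntop : Tendsto n atTop atTop := by
    rw [← tendsto_natCast_atTop_iff (R := ℝ)]
    refine (S.tendsto_invTail.atTop_mul_pos hv hn).congr fun x => ?_
    rw [mul_div_cancel₀ _ (S.rv.pos x).ne']
  set f : ℝ → ℝ → ℂ := fun x s => (Icc (-r) r).indicator
    (fun t : ℝ => K t * (charFun F t ^ n x * Complex.exp (-(t * z x * Complex.I)))) (s / x)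
  have hlim : Tendsto (fun x => ∫ s, f x s) atTop
      (𝓝 (∫ s : ℝ, K 0 * (gHat g (p * s) * Complex.exp (-(s * Complex.I))))) := by
    refine tendsto_integral_filter_of_dominated_convergence
      (fun s => B * (C * Real.exp (-(c * |p / 2 * s| ^ (α / 2))))) ?_ ?_ ?_ ?_
    · refine Eventually.of_forall fun x => ?_
      refine Measurable.aestronglyMeasurable ?_
      refine Measurable.comp (Measurable.indicator ?_ measurableSet_Icc) (by fun_prop)
      exact hKm.mul (by fun_prop)
    · filter_upwards [hbx.eventually (lt_mem_nhds (half_lt_self hp)), eventually_gt_atTop 0]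
        with x hx hx0
      refine Eventually.of_forall fun s => ?_
      by_cases hs : s / x ∈ Icc (-r) r
      · simp only [f]
        rw [indicator_of_mem hs, norm_mul, norm_mul, norm_exp_neg_mul_I, mul_one, norm_pow]
        refine mul_le_mul (hB _) ((hφ _ _ (abs_le.2 hs)).trans ?_) (by positivity) hB0
        have habs : |p / 2 * s| ≤ |linv ℓ (n x) * (s / x)| := by
          rw [abs_mul, abs_of_pos (by positivity : 0 < p / 2), abs_mul, abs_div s, abs_of_pos hx0,
            abs_of_pos (S.inv.pos _), mul_div_assoc', mul_div_right_comm]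
          gcongr
        exact mul_le_mul_of_nonneg_left (Real.exp_le_exp.2 (neg_le_neg
          (mul_le_mul_of_nonneg_left (Real.rpow_le_rpow (abs_nonneg _) habs hκ.le) hc.le))) hC.le
      · simp only [f]
        rw [indicator_of_notMem hs, norm_zero]
        positivity
    · exact (((integrable_exp_neg_mul_abs_rpow hc hκ).comp_mul_left'
        (by positivity : p / 2 ≠ 0)).const_mul C).const_mul B
    · refine Eventually.of_forall fun s => ?_
      have hsx : Tendsto (fun x : ℝ => s / x) atTop (𝓝 0) := tendsto_const_nhds.div_atTop tendsto_id
      have h1 : Tendsto (fun x => K (s / x)) atTop (𝓝 (K 0)) := hK0.tendsto.comp hsx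
      have h2 : Tendsto (fun x => charFun F (s / x) ^ n x) atTop (𝓝 (gHat g (p * s))) := by
        have := S.stable.tendsto_charFun_of_tendsto hntop (hbx.mul_const s)
        refine this.congr fun x => ?_
        rw [charFun_scaledLaw]
        congr 2
        have := (S.inv.pos (n x)).ne'
        field_simp
      have h3 : Tendsto (fun x => Complex.exp (-((s / x : ℝ) * z x * Complex.I))) atTop
          (𝓝 (Complex.exp (-(s * Complex.I)))) := by
        have h4 : Tendsto (fun x => Complex.exp (-((s * (z x / x) : ℝ) * Complex.I))) atTop
            (𝓝 (Complex.exp (-((s * 1 : ℝ) * Complex.I)))) :=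
          ((by fun_prop : Continuous fun y : ℝ =>
            Complex.exp (-((s * y : ℝ) * Complex.I))).tendsto 1).comp hz
        rw [mul_one] at h4
        refine h4.congr fun x => ?_
        congr 2
        push_cast
        ring
      refine (h1.mul (h2.mul h3)).congr' ?_
      have hev : ∀ᶠ x in atTop, s / x ∈ Icc (-r) r :=
        hsx.eventually (Icc_mem_nhds (by linarith) hr)
      filter_upwards [hev] with x hx
      simp only [f]
      rw [indicator_of_mem hx]
  have hval : ∫ s : ℝ, K 0 * (gHat g (p * s) * Complex.exp (-(s * Complex.I))) =
      K 0 * (2 * π) * gammaFn g α v := by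
    rw [integral_const_mul, mul_assoc]
    congr 1
    have h1 := Measure.integral_comp_mul_left
      (fun s : ℝ => gHat g s * Complex.exp (-((s * p⁻¹ : ℝ) * Complex.I))) p
    have h2 : ∀ s : ℝ, p * s * p⁻¹ = s := fun s => by field_simp
    simp only [h2] at h1
    rw [h1, abs_of_pos (by positivity), gammaFn, gInv, Real.rpow_neg hv.le, Complex.real_smul]
    have hπ : ((2 * π : ℝ) : ℂ) ≠ 0 := by
      have := Real.pi_pos
      exact_mod_cast (by positivity : (2 * π : ℝ) ≠ 0)
    have h3 : ∫ s : ℝ, gHat g s * Complex.exp (-((s * p⁻¹ : ℝ) * Complex.I)) =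
        ∫ s : ℝ, Complex.exp (-(s * (p⁻¹ : ℝ) * Complex.I)) * gHat g s := by
      refine integral_congr_ae (Eventually.of_forall fun s => ?_)
      simp only
      rw [mul_comm, Complex.ofReal_mul]
    rw [h3]
    change _ = 2 * (π:ℂ) * (((p⁻¹ : ℝ) : ℂ) * (((2 * π)⁻¹ : ℝ) *
      ∫ s : ℝ, Complex.exp (-(s * (p⁻¹ : ℝ) * Complex.I)) * gHat g s))
    generalize ∫ s : ℝ, Complex.exp (-(s * (p⁻¹ : ℝ) * Complex.I)) * gHat g s = J
    have hpc : (p : ℂ) ≠ 0 := by exact_mod_cast hp.ne'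
    push_cast at hπ ⊢
    field_simp
  rw [hval] at hlim
  refine hlim.congr' ?_
  filter_upwards [eventually_gt_atTop 0] with x hx
  simp only [f]
  rw [Measure.integral_comp_div (fun t => (Icc (-r) r).indicator
    (fun t : ℝ => K t * (charFun F t ^ n x * Complex.exp (-(t * z x * Complex.I)))) t) x,
    abs_of_pos hx, integral_indicator measurableSet_Icc, Complex.real_smul]
  rfl

lemma tendsto_floor_div (S : Setup F ℓ g α) {v : ℝ} (hv : 0 < v) :
    Tendsto (fun x => (⌊v * invTail F x⌋₊ : ℝ) / invTail F x) atTop (𝓝 v) :=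
  (tendsto_nat_floor_mul_div_atTop hv.le).comp S.tendsto_invTail

lemma tendsto_ceil_div (S : Setup F ℓ g α) {v : ℝ} (hv : 0 < v) :
    Tendsto (fun x => (⌈v * invTail F x⌉₊ : ℝ) / invTail F x) atTop (𝓝 v) :=
  (tendsto_nat_ceil_mul_div_atTop hv.le).comp S.tendsto_invTail

lemma tendsto_sum_innerInt (S : Setup F ℓ g α) (hKm : Measurable K) (hB : ∀ t, ‖K t‖ ≤ B)
    (hK0 : ContinuousAt K 0) {C c r : ℝ} (hC : 0 < C) (hc : 0 < c) (hr : 0 < r)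
    (hφ : ∀ (n : ℕ) (t : ℝ), |t| ≤ r →
      ‖charFun F t‖ ^ n ≤ C * Real.exp (-(c * |linv ℓ n * t| ^ (α / 2))))
    {z : ℝ → ℝ} (hz : Tendsto (fun x => z x / x) atTop (𝓝 1)) {δ Δ : ℝ} (hδ : 0 < δ)
    (hδΔ : δ < Δ) :
    Tendsto (fun x : ℝ => ((x / invTail F x : ℝ) : ℂ) *
      ∑ n ∈ Finset.Ico ⌈δ * invTail F x⌉₊ ⌈Δ * invTail F x⌉₊, innerInt F K r n (z x)) atTop
      (𝓝 (K 0 * (2 * π) * ∫ v in δ..Δ, gammaFn g α v)) := by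
  have hB0 : 0 ≤ B := (norm_nonneg _).trans (hB 0)
  obtain ⟨D, hD, hDn⟩ := S.exists_integral_charFun_pow_le r
  obtain ⟨c1, hc1, hlow⟩ := S.eventually_linv_ge (half_pos hδ)
  set N1 : ℝ → ℕ := fun x => ⌈δ * invTail F x⌉₊
  set N2 : ℝ → ℕ := fun x => ⌈Δ * invTail F x⌉₊
  set J : ℝ → ℕ → ℂ := fun x n => (x:ℂ) * innerInt F K r n (z x)
  have hrew : ∀ x, ((x / invTail F x : ℝ) : ℂ) *
      ∑ n ∈ Finset.Ico (N1 x) (N2 x), innerInt F K r n (z x) =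
      ∫ v, (Ioc (N1 x / invTail F x) (N2 x / invTail F x)).indicator
        (fun v => J x ⌊v * invTail F x⌋₊) v := by
    intro x
    have hH := S.rv.pos x
    have hle : N1 x ≤ N2 x := Nat.ceil_mono (by gcongr)
    have hle' : (N1 x : ℝ) / invTail F x ≤ N2 x / invTail F x := by gcongr
    rw [integral_indicator measurableSet_Ioc, ← intervalIntegral.integral_of_le hle',
      intervalIntegral.integral_comp_mul_right (fun y => J x ⌊y⌋₊) hH.ne',
      div_mul_cancel₀ _ hH.ne', div_mul_cancel₀ _ hH.ne', ← sum_Ico_eq_integral_floor _ hle,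
      ← Finset.mul_sum, Complex.real_smul]
    push_cast
    ring
  have hlimval : K 0 * (2 * π) * ∫ v in δ..Δ, gammaFn g α v =
      ∫ v, (Ioc δ Δ).indicator (fun v => K 0 * (2 * π) * gammaFn g α v) v := by
    rw [integral_indicator measurableSet_Ioc, intervalIntegral.integral_of_le hδΔ.le,
      integral_const_mul]
  rw [hlimval]
  simp only [N1, N2] at hrew
  simp_rw [hrew]
  refine tendsto_integral_filter_of_dominated_convergence
    ((Ioc δ (Δ + 1)).indicator fun _ => B * D / c1) ?_ ?_ ?_ ?_
  · refine Eventually.of_forall fun x => Measurable.aestronglyMeasurable ?_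
    refine Measurable.indicator ?_ measurableSet_Ioc
    exact (measurable_from_nat (f := J x)).comp (Nat.measurable_floor.comp (by fun_prop))
  · filter_upwards [hlow, eventually_gt_atTop 0, S.tendsto_invTail.eventually_ge_atTop (2 / δ)]
      with x hx hx0 hxH
    refine Eventually.of_forall fun v => ?_
    have hH := S.rv.pos x
    have hH1 := S.rv.one_le x
    by_cases hv : v ∈ Ioc ((⌈δ * invTail F x⌉₊ : ℝ) / invTail F x) (⌈Δ * invTail F x⌉₊ / invTail F x)
    · have hv1 : δ < v := by
        refine lt_of_le_of_lt ?_ hv.1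
        rw [le_div_iff₀ hH]
        exact Nat.le_ceil _
      have hv2 : v ≤ Δ + 1 := by
        refine hv.2.trans ?_
        rw [div_le_iff₀ hH]
        have hΔ : 0 < Δ := hδ.trans hδΔ
        have := (Nat.ceil_lt_add_one (by positivity : 0 ≤ Δ * invTail F x)).le
        nlinarith
      rw [indicator_of_mem hv, indicator_of_mem (show v ∈ Ioc δ (Δ + 1) from ⟨hv1, hv2⟩)]
      simp only [J]
      rw [norm_mul, Complex.norm_real, Real.norm_of_nonneg hx0.le]
      have hfl : δ / 2 * invTail F x ≤ ⌊v * invTail F x⌋₊ := by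
        have h1 := (Nat.sub_one_lt_floor (v * invTail F x)).le
        rw [div_le_iff₀ hδ] at hxH
        nlinarith
      have hb := hx _ hfl
      have hbpos := S.inv.pos (⌊v * invTail F x⌋₊ : ℝ)
      calc x * ‖innerInt F K r ⌊v * invTail F x⌋₊ (z x)‖
          ≤ x * (B * (D / linv ℓ (⌊v * invTail F x⌋₊ : ℝ))) := by
            refine mul_le_mul_of_nonneg_left ((norm_innerInt_le hB hr _ _).trans ?_) hx0.le
            exact mul_le_mul_of_nonneg_left (hDn _) hB0
        _ ≤ x * (B * (D / (c1 * x))) := by gcongr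
        _ = B * D / c1 := by field_simp
    · rw [indicator_of_notMem hv, norm_zero]
      refine indicator_nonneg (fun _ _ => by positivity) v
  · exact (integrable_indicator_iff measurableSet_Ioc).2 (by simp)
  · have hne : ∀ᵐ v : ℝ, v ≠ δ ∧ v ≠ Δ := by
      have h1 : ∀ a : ℝ, ∀ᵐ v : ℝ, v ≠ a := fun a => by simp [ae_iff]
      exact (h1 δ).and (h1 Δ)
    filter_upwards [hne] with v hv
    have hl1 := S.tendsto_ceil_div hδ
    have hl2 := S.tendsto_ceil_div (hδ.trans hδΔ)
    by_cases hvm : v ∈ Ioc δ Δ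
    · rw [indicator_of_mem hvm]
      have hv0 : 0 < v := hδ.trans hvm.1
      refine (S.tendsto_innerInt hKm hB hK0 hC hc hr hφ hz hv0 (S.tendsto_floor_div hv0)).congr' ?_
      filter_upwards [hl1.eventually (gt_mem_nhds hvm.1),
        hl2.eventually (lt_mem_nhds (lt_of_le_of_ne hvm.2 hv.2))] with x hx1 hx2
      rw [indicator_of_mem (show v ∈ Ioc ((⌈δ * invTail F x⌉₊ : ℝ) / invTail F x)
        (⌈Δ * invTail F x⌉₊ / invTail F x) from ⟨hx1, hx2.le⟩)]
    · rw [indicator_of_notMem hvm]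
      refine tendsto_const_nhds.congr' ?_
      rcases lt_or_gt_of_ne hv.1 with h | h
      · filter_upwards [hl1.eventually (lt_mem_nhds h)] with x hx
        rw [indicator_of_notMem fun hm => absurd hm.1 (not_lt.2 hx.le)]
      · have h2 : Δ < v := by
          by_contra hcon
          exact hvm ⟨h, not_lt.1 hcon⟩
        filter_upwards [hl2.eventually (gt_mem_nhds h2)] with x hx
        rw [indicator_of_notMem fun hm => absurd hm.2 (not_le.2 hx)]

/-- The asymptotics of the Fourier integrals summed over `δ H(x) ≤ n < Δ H(x)`. -/
lemma tendsto_sum_fourier (S : Setup F ℓ g α) (hKm : Measurable K) (hB : ∀ t, ‖K t‖ ≤ B)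
    (hK0 : ContinuousAt K 0) {R : ℝ} (hKR : ∀ t, R < |t| → K t = 0)
    (hR : ∀ t, t ≠ 0 → |t| ≤ R → charFun F t ≠ 1)
    {z : ℝ → ℝ} (hz : Tendsto (fun x => z x / x) atTop (𝓝 1)) {δ Δ : ℝ} (hδ : 0 < δ)
    (hδΔ : δ < Δ) :
    Tendsto (fun x : ℝ => ((x / invTail F x : ℝ) : ℂ) *
      ∑ n ∈ Finset.Ico ⌈δ * invTail F x⌉₊ ⌈Δ * invTail F x⌉₊,
        ∫ t : ℝ, K t * (charFun F t ^ n * Complex.exp (-(t * z x * Complex.I)))) atTop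
      (𝓝 (K 0 * (2 * π) * ∫ v in δ..Δ, gammaFn g α v)) := by
  have hB0 : 0 ≤ B := (norm_nonneg _).trans (hB 0)
  obtain ⟨C, hC, c, hc, r, hr, hφ⟩ := S.exists_norm_charFun_pow_le
  have hin := S.tendsto_sum_innerInt hKm hB hK0 hC hc hr hφ hz hδ hδΔ
  obtain ⟨D, hD, hDn⟩ := S.exists_integral_charFun_pow_le |R|
  obtain ⟨c1, hc1, hlow⟩ := S.eventually_linv_ge hδ
  have hcpt : IsCompact {t : ℝ | t ∈ Icc (-R) R ∧ r ≤ |t|} :=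
    isCompact_Icc.inter_right (isClosed_le continuous_const continuous_abs)
  have hne1 : ∀ t ∈ {t : ℝ | t ∈ Icc (-R) R ∧ r ≤ |t|}, charFun F t ≠ 1 := fun t ht =>
    hR t (abs_pos.1 (hr.trans_le ht.2)) (abs_le.2 ht.1)
  obtain ⟨c0, hc0⟩ := hcpt.exists_bound_of_continuousOn (f := fun t => (1 - charFun F t)⁻¹)
    (ContinuousOn.inv₀ (by fun_prop) fun t ht => sub_ne_zero.2 (hne1 t ht).symm)
  have hint : ∀ (n : ℕ) (w : ℝ), Integrable fun t : ℝ =>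
      K t * (charFun F t ^ n * Complex.exp (-(t * w * Complex.I))) := by
    intro n w
    have h1 : Integrable ((Icc (-R) R).indicator fun _ : ℝ => B) :=
      (integrable_indicator_iff measurableSet_Icc).2 (by simp)
    refine h1.mono' (hKm.mul (by fun_prop)).aestronglyMeasurable (Eventually.of_forall fun t => ?_)
    by_cases ht : t ∈ Icc (-R) R
    · rw [indicator_of_mem ht, norm_mul, norm_mul, norm_exp_neg_mul_I, mul_one, norm_pow]
      exact (mul_le_of_le_one_right (norm_nonneg _)
        (pow_le_one₀ (norm_nonneg _) (norm_charFun_le_one t))).trans (hB t)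
    · rw [indicator_of_notMem ht, hKR t (not_le.1 fun h => ht (abs_le.1 h)), zero_mul, norm_zero]
  have hout : Tendsto (fun x : ℝ => ((x / invTail F x : ℝ) : ℂ) *
      ∑ n ∈ Finset.Ico ⌈δ * invTail F x⌉₊ ⌈Δ * invTail F x⌉₊,
        ∫ t : ℝ in (Icc (-r) r)ᶜ, K t * (charFun F t ^ n * Complex.exp (-(t * z x * Complex.I))))
      atTop (𝓝 0) := by
    have hlim : Tendsto (fun x => B * (2 * |c0|) * D / c1 * (invTail F x)⁻¹) atTop (𝓝 0) := by
      simpa using (tendsto_inv_atTop_zero.comp S.tendsto_invTail).const_mul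
        (B * (2 * |c0|) * D / c1)
    refine squeeze_zero_norm' ?_ hlim
    filter_upwards [hlow, eventually_gt_atTop 0] with x hx hx0
    have hH := S.rv.pos x
    set N1 := ⌈δ * invTail F x⌉₊
    set N2 := ⌈Δ * invTail F x⌉₊
    have hb := hx N1 (Nat.le_ceil _)
    have hbpos := S.inv.pos (N1:ℝ)
    rw [norm_mul, Complex.norm_real, Real.norm_of_nonneg (by positivity),
      ← integral_finsetSum _ fun n _ => (hint n (z x)).integrableOn]
    have hmain : ‖∫ t : ℝ in (Icc (-r) r)ᶜ, ∑ n ∈ Finset.Ico N1 N2,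
        K t * (charFun F t ^ n * Complex.exp (-(t * z x * Complex.I)))‖ ≤
        B * (2 * |c0|) * ∫ t in -|R|..|R|, ‖charFun F t‖ ^ N1 := by
      rw [intervalIntegral.integral_of_le (by linarith [abs_nonneg R]),
        ← integral_Icc_eq_integral_Ioc, ← integral_const_mul,
        ← integral_indicator measurableSet_Icc, ← integral_indicator measurableSet_Icc.compl]
      refine norm_integral_le_of_norm_le ((integrable_indicator_iff measurableSet_Icc).2
        (Continuous.integrableOn_Icc (by fun_prop))) (Eventually.of_forall fun t => ?_)
      by_cases ht : t ∈ (Icc (-r) r)ᶜ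
      · rw [indicator_of_mem ht]
        by_cases htR : |t| ≤ R
        · have hR0 : |R| = R := abs_of_nonneg ((abs_nonneg t).trans htR)
          have htm : t ∈ Icc (-R) R := abs_le.1 htR
          rw [hR0, indicator_of_mem htm, ← Finset.mul_sum, ← Finset.sum_mul, norm_mul, norm_mul,
            norm_exp_neg_mul_I, mul_one, mul_assoc]
          have htr : t ∈ {t : ℝ | t ∈ Icc (-R) R ∧ r ≤ |t|} :=
            ⟨htm, (not_le.1 fun h => ht (abs_le.1 h)).le⟩
          exact mul_le_mul (hB t) (norm_sum_Ico_pow_le (norm_charFun_le_one t)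
            ((hc0 t htr).trans (le_abs_self c0)) (hne1 t htr) _ _) (norm_nonneg _) hB0
        · simp only [hKR t (not_le.1 htR), zero_mul, Finset.sum_const_zero, norm_zero]
          exact indicator_nonneg (fun _ _ => by positivity) t
      · rw [indicator_of_notMem ht, norm_zero]
        exact indicator_nonneg (fun _ _ => by positivity) t
    calc x / invTail F x * ‖∫ t : ℝ in (Icc (-r) r)ᶜ, ∑ n ∈ Finset.Ico N1 N2,
        K t * (charFun F t ^ n * Complex.exp (-(t * z x * Complex.I)))‖
        ≤ x / invTail F x * (B * (2 * |c0|) * (D / (c1 * x))) := by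
          refine mul_le_mul_of_nonneg_left (hmain.trans ?_) (by positivity)
          refine mul_le_mul_of_nonneg_left ((hDn N1).trans ?_) (by positivity)
          gcongr
      _ = B * (2 * |c0|) * D / c1 * (invTail F x)⁻¹ := by field_simp
  have hsum := hin.add hout
  rw [add_zero] at hsum
  refine hsum.congr fun x => ?_
  rw [← mul_add, ← Finset.sum_add_distrib]
  congr 1
  refine Finset.sum_congr rfl fun n _ => ?_
  exact integral_add_compl measurableSet_Icc (hint n (z x))

end Kernel

end Setup

end

section

open scoped Topology ENNReal FourierTransform

/-! ### Arithmetic laws and characteristic functions -/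

lemma concOn_of_charFun_eq_one {F : Measure ℝ} [IsProbabilityMeasure F] {t : ℝ} (ht : t ≠ 0)
    (h : charFun F t = 1) : ConcOn F (2 * π / |t|) := by
  have hi : Integrable (fun x : ℝ => Complex.exp (t * x * Complex.I)) F := integrable_exp_mul_I F t
  have hcos : ∀ x : ℝ, (Complex.exp (t * x * Complex.I)).re = Real.cos (t * x) := fun x => by
    rw [← Complex.ofReal_mul, Complex.exp_ofReal_mul_I_re]
  have h1 : ∫ x, Real.cos (t * x) ∂F = 1 := by
    have := congrArg Complex.re h
    rw [charFun_apply_real] at this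
    have h2 := integral_re hi
    simp only [RCLike.re_to_complex, hcos] at h2
    rw [h2, this, Complex.one_re]
  have hci : Integrable (fun x => Real.cos (t * x)) F := by
    have := hi.re
    simpa only [RCLike.re_to_complex, hcos] using this
  have h2 : ∫ x, (1 - Real.cos (t * x)) ∂F = 0 := by
    rw [integral_sub (integrable_const _) hci, h1]
    simp
  have h3 : ∀ᵐ x ∂F, 1 - Real.cos (t * x) = 0 := by
    have := (integral_eq_zero_iff_of_nonneg (fun x => by
      simpa using Real.cos_le_one (t * x)) ((integrable_const (1:ℝ)).sub hci)).1 h2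
    exact this
  have h4 : {x : ℝ | ∃ k : ℤ, x = k * (2 * π / |t|)} =ᵐ[F] univ := by
    refine eventuallyEq_univ.2 ?_
    filter_upwards [h3] with x hx
    obtain ⟨k, hk⟩ := (Real.cos_eq_one_iff (|t| * x)).1 (by
      rcases abs_cases t with ⟨h, -⟩ | ⟨h, -⟩ <;> simp only [h, neg_mul, Real.cos_neg] <;> linarith)
    refine ⟨k, ?_⟩
    have := abs_pos.2 ht
    field_simp
    linarith
  rw [ConcOn, measure_congr h4, measure_univ]

/-! ### The transform of the triangular kernel -/

lemma integrable_rho {R : ℝ} (hR : 0 < R) : Integrable (rho R) := by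
  refine (integrable_inv_one_add_sq.const_mul (R ^ 2 + 4)).mono'
    (continuous_rho R).aestronglyMeasurable (Eventually.of_forall fun s => ?_)
  rw [Real.norm_of_nonneg (rho_nonneg hR s), ← div_eq_mul_inv, le_div_iff₀ (by positivity)]
  have h1 := rho_le hR s
  have h2 : rho R s * s ^ 2 ≤ 4 := by
    rcases eq_or_ne s 0 with rfl | hs
    · simp
    · rw [rho_of_ne_zero hR hs, mul_assoc, div_mul_cancel₀ _ (by positivity)]
      linarith [Real.neg_one_le_cos (R * s)]
  linarith

lemma fourier_tri (R w : ℝ) : 𝓕 (fun t => (tri R t : ℂ)) w = rho R (2 * π * w) := by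
  have h : rho R (2 * π * w) = rho R (-(2 * π * w)) := by simp [rho]
  rw [Real.fourier_real_eq_integral_exp_smul, h, ← integral_tri_mul_exp]
  congr 1
  ext y
  rw [smul_eq_mul, mul_comm]
  congr 2
  push_cast
  ring

lemma integral_exp_mul_rho {R : ℝ} (hR : 0 < R) (θ : ℝ) :
    ∫ s : ℝ, Complex.exp (θ * s * Complex.I) * rho R s = 2 * π * tri R θ := by
  have hpi := Real.pi_pos
  have hF : 𝓕 (fun t => (tri R t : ℂ)) = fun w => ((rho R (2 * π * w) : ℝ) : ℂ) :=
    funext fun w => fourier_tri R w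
  have hFi : Integrable (𝓕 (fun t => (tri R t : ℂ))) := by
    rw [hF]
    exact ((integrable_rho hR).comp_mul_left' (by positivity)).ofReal
  have h := congrFun (Continuous.fourierInv_fourier_eq (by fun_prop) (integrable_tri R).ofReal hFi) θ
  rw [Real.fourierInv_eq_fourier_neg, Real.fourier_real_eq_integral_exp_smul, hF] at h
  have h2 := Measure.integral_comp_mul_left
    (fun s : ℝ => Complex.exp (θ * s * Complex.I) * rho R s) (2 * π)
  rw [abs_of_pos (by positivity), Complex.real_smul] at h2
  rw [← h]
  have h3 : ∀ v : ℝ, Complex.exp (((-2 * π * v * -θ : ℝ) : ℂ) * Complex.I) • ((rho R (2 * π * v) : ℝ) : ℂ)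
      = Complex.exp (θ * (2 * π * v : ℝ) * Complex.I) * rho R (2 * π * v) := by
    intro v
    rw [smul_eq_mul]
    congr 2
    push_cast
    ring
  simp_rw [h3, h2]
  generalize ∫ s : ℝ, Complex.exp (θ * s * Complex.I) * rho R s = J
  have : (π : ℂ) ≠ 0 := by exact_mod_cast hpi.ne'
  push_cast
  field_simp


/-- The probability measure with density proportional to `rho R` with respect to `μ`. -/
def rhoLaw (R : ℝ) (μ : Measure ℝ) : Measure ℝ :=
  ENNReal.ofReal (∫ s, rho R s ∂μ)⁻¹ • μ.withDensity fun s => ENNReal.ofReal (rho R s)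

lemma isProbabilityMeasure_rhoLaw {R : ℝ} (hR : 0 < R) {μ : Measure ℝ} (hi : Integrable (rho R) μ)
    (hpos : 0 < ∫ s, rho R s ∂μ) : IsProbabilityMeasure (rhoLaw R μ) := by
  refine ⟨?_⟩
  rw [rhoLaw, Measure.smul_apply, withDensity_apply _ MeasurableSet.univ, setLIntegral_univ,
    ← ofReal_integral_eq_lintegral_ofReal hi (Eventually.of_forall (rho_nonneg hR)), smul_eq_mul,
    ← ENNReal.ofReal_mul (by positivity), inv_mul_cancel₀ hpos.ne', ENNReal.ofReal_one]

lemma integral_rhoLaw {R : ℝ} (hR : 0 < R) {μ : Measure ℝ} (hpos : 0 < ∫ s, rho R s ∂μ)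
    {E : Type*} [NormedAddCommGroup E] [NormedSpace ℝ E] (f : ℝ → E) :
    ∫ s, f s ∂rhoLaw R μ = (∫ s, rho R s ∂μ)⁻¹ • ∫ s, rho R s • f s ∂μ := by
  rw [rhoLaw, integral_smul_measure, ENNReal.toReal_ofReal (by positivity),
    integral_withDensity_eq_integral_toReal_smul (by fun_prop) (by simp)]
  simp only [ENNReal.toReal_ofReal (rho_nonneg hR _)]

lemma integral_rho {R : ℝ} (hR : 0 < R) : ∫ s, rho R s = 2 * π * R := by
  have h := integral_exp_mul_rho hR 0
  simp only [Complex.ofReal_zero, zero_mul, Complex.exp_zero, one_mul] at h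
  rw [integral_complex_ofReal] at h
  have h2 : tri R 0 = R := by simp [tri, hR.le]
  rw [h2] at h
  exact_mod_cast h

lemma integrable_rho_of_isFiniteMeasure {R : ℝ} (hR : 0 < R) (μ : Measure ℝ) [IsFiniteMeasure μ] :
    Integrable (rho R) μ :=
  Integrable.of_bound (continuous_rho R).aestronglyMeasurable (R ^ 2)
    (Eventually.of_forall fun s => by
      rw [Real.norm_of_nonneg (rho_nonneg hR s)]; exact rho_le hR s)

section Vague

variable {R : ℝ} {ν : ℕ → Measure ℝ} {c : ℂ}

lemma tendsto_integral_rho (hR : 0 < R)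
    (H : ∀ θ : ℝ, Tendsto (fun k => ∫ s : ℝ, Complex.exp (θ * s * Complex.I) * rho R s ∂ν k) atTop
      (𝓝 (2 * π * c * tri R θ))) :
    Tendsto (fun k => ∫ s, rho R s ∂ν k) atTop (𝓝 (2 * π * R * c.re)) ∧ c = c.re := by
  have h := H 0
  have h2 : tri R 0 = R := by simp [tri, hR.le]
  simp only [Complex.ofReal_zero, zero_mul, Complex.exp_zero, one_mul, h2,
    integral_complex_ofReal] at h
  have hpi := Real.pi_pos
  have hre := (Complex.continuous_re.tendsto _).comp h
  have him := (Complex.continuous_im.tendsto _).comp h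
  have heq : (2 * π * c * R : ℂ) = ((2 * π * R : ℝ) : ℂ) * c := by push_cast; ring
  rw [heq] at hre him
  simp only [Function.comp_def, Complex.ofReal_re, Complex.ofReal_im, Complex.re_ofReal_mul,
    Complex.im_ofReal_mul] at hre him
  refine ⟨hre, ?_⟩
  have h0 := tendsto_nhds_unique him tendsto_const_nhds
  have : c.im = 0 := by
    rcases mul_eq_zero.1 h0 with h | h
    · have : 0 < 2 * π * R := by positivity
      exact absurd h this.ne'
    · exact h
  exact Complex.ext rfl (by simpa using this)

lemma tendsto_integral_of_tendsto_rho [∀ k, IsFiniteMeasure (ν k)] (hR : 0 < R)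
    (H : ∀ θ : ℝ, Tendsto (fun k => ∫ s : ℝ, Complex.exp (θ * s * Complex.I) * rho R s ∂ν k) atTop
      (𝓝 (2 * π * c * tri R θ)))
    {f : ℝ → ℝ} (hf : Continuous f) {M : ℝ} (hM : ∀ s, |f s| ≤ M)
    (hf0 : ∀ s, 1 / R < |s| → f s = 0) :
    Tendsto (fun k => ∫ s, f s ∂ν k) atTop (𝓝 (c.re * ∫ s, f s)) := by
  have hpi := Real.pi_pos
  obtain ⟨hm, hc⟩ := tendsto_integral_rho hR H
  have hM0 : 0 ≤ M := (abs_nonneg _).trans (hM 0)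
  set q : ℝ → ℝ := fun s => f s / max (rho R s) (R ^ 2 / 2)
  have hmax : ∀ s, 0 < max (rho R s) (R ^ 2 / 2) := fun s => lt_max_of_lt_right (by positivity)
  have hqc : Continuous q := hf.div (by fun_prop) fun s => (hmax s).ne'
  have hfq : ∀ s, f s = rho R s * q s := by
    intro s
    rcases lt_or_ge (1 / R) |s| with hs | hs
    · simp [q, hf0 s hs]
    · have h1 := rho_ge hR hs
      have h2 : 0 < rho R s := by nlinarith
      simp only [q]
      rw [max_eq_left h1]
      field_simp
  have hqb : ∀ s, ‖q s‖ ≤ M / (R ^ 2 / 2) := by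
    intro s
    rw [Real.norm_eq_abs, abs_div, abs_of_pos (hmax s)]
    exact div_le_div₀ hM0 (hM s) (by positivity) (le_max_right _ _)
  have hmass : ∀ k, 0 ≤ ∫ s, rho R s ∂ν k := fun k => integral_nonneg (rho_nonneg hR)
  have hc0 : 0 ≤ c.re := by
    have := ge_of_tendsto' hm hmass
    by_contra hneg
    push Not at hneg
    have : 2 * π * R * c.re < 0 := mul_neg_of_pos_of_neg (by positivity) hneg
    linarith
  rcases hc0.eq_or_lt with h0 | hpos
  · rw [← h0] at hm ⊢
    rw [zero_mul]
    refine squeeze_zero_norm (a := fun k => M / (R ^ 2 / 2) * ∫ s, rho R s ∂ν k) (fun k => ?_)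
      (by simpa using hm.const_mul (M / (R ^ 2 / 2)))
    rw [← integral_const_mul]
    refine norm_integral_le_of_norm_le ((integrable_rho_of_isFiniteMeasure hR _).const_mul _)
      (Eventually.of_forall fun s => ?_)
    rw [hfq, norm_mul, Real.norm_of_nonneg (rho_nonneg hR s), mul_comm]
    exact mul_le_mul_of_nonneg_right (hqb s) (rho_nonneg hR s)
  · have hlim0 : 0 < 2 * π * R * c.re := by positivity
    have hvol : 0 < ∫ s, rho R s := by rw [integral_rho hR]; positivity
    have hinst : IsProbabilityMeasure (rhoLaw R volume) :=
      isProbabilityMeasure_rhoLaw hR (integrable_rho hR) hvol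
    set P : ℕ → ProbabilityMeasure ℝ := fun k => if hk : 0 < ∫ s, rho R s ∂ν k then
      ⟨rhoLaw R (ν k), isProbabilityMeasure_rhoLaw hR (integrable_rho_of_isFiniteMeasure hR _) hk⟩
      else ⟨Measure.dirac 0, inferInstance⟩
    have hP : ∀ᶠ k in atTop, 0 < ∫ s, rho R s ∂ν k ∧ (P k : Measure ℝ) = rhoLaw R (ν k) := by
      filter_upwards [hm.eventually (lt_mem_nhds hlim0)] with k hk
      refine ⟨hk, ?_⟩
      have : P k = ⟨rhoLaw R (ν k),
        isProbabilityMeasure_rhoLaw hR (integrable_rho_of_isFiniteMeasure hR _) hk⟩ := dif_pos hk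
      rw [this]
      rfl
    have hweak : Tendsto P atTop (𝓝 ⟨rhoLaw R volume, hinst⟩) := by
      refine ProbabilityMeasure.tendsto_of_tendsto_charFun fun θ => ?_
      have hl : charFun (rhoLaw R volume) θ = ((2 * π * R * c.re : ℝ) : ℂ)⁻¹ *
          (2 * π * c * tri R θ) := by
        rw [charFun_apply_real, integral_rhoLaw hR hvol, integral_rho hR]
        simp_rw [Complex.real_smul, mul_comm ((rho R _ : ℝ) : ℂ)]
        rw [integral_exp_mul_rho hR, hc]
        simp only [Complex.ofReal_re]
        have h1 : (c.re : ℂ) ≠ 0 := by exact_mod_cast hpos.ne'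
        have h2 : (R : ℂ) ≠ 0 := by exact_mod_cast hR.ne'
        have h3 : (π : ℂ) ≠ 0 := by exact_mod_cast hpi.ne'
        push_cast
        field_simp
      change Tendsto _ _ (𝓝 (charFun (rhoLaw R volume) θ))
      rw [hl]
      have h1 : Tendsto (fun k => ((∫ s, rho R s ∂ν k : ℝ) : ℂ)) atTop
          (𝓝 ((2 * π * R * c.re : ℝ) : ℂ)) := (Complex.continuous_ofReal.tendsto _).comp hm
      refine ((h1.inv₀ (by exact_mod_cast hlim0.ne')).mul (H θ)).congr' ?_
      filter_upwards [hP] with k hk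
      rw [hk.2, charFun_apply_real, integral_rhoLaw hR hk.1]
      simp_rw [Complex.real_smul, mul_comm ((rho R _ : ℝ) : ℂ)]
      push_cast
      rfl
    have hq := (ProbabilityMeasure.tendsto_iff_forall_integral_tendsto.1 hweak)
      (BoundedContinuousFunction.ofNormedAddCommGroup q hqc _ hqb)
    have hval : ∫ s, q s ∂rhoLaw R volume = (2 * π * R)⁻¹ * ∫ s, f s := by
      rw [integral_rhoLaw hR hvol, integral_rho hR]
      simp_rw [smul_eq_mul, ← hfq]
    change Tendsto (fun k => ∫ s, q s ∂(P k : Measure ℝ)) atTop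
      (𝓝 (∫ s, q s ∂rhoLaw R volume)) at hq
    rw [hval] at hq
    have hfin := hm.mul hq
    have hcalc : 2 * π * R * c.re * ((2 * π * R)⁻¹ * ∫ s, f s) = c.re * ∫ s, f s := by
      field_simp
    rw [hcalc] at hfin
    refine hfin.congr' ?_
    filter_upwards [hP] with k hk
    rw [hk.2, integral_rhoLaw hR hk.1]
    simp_rw [smul_eq_mul, ← hfq]
    have := hk.1.ne'
    field_simp

/-- The trapezoidal function supported by `[a, b]` with slopes of width `ε`. -/
def trap (a b ε s : ℝ) : ℝ := max 0 (min 1 (min ((s - a) / ε) ((b - s) / ε)))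

lemma continuous_trap (a b ε : ℝ) : Continuous (trap a b ε) := by
  unfold trap
  fun_prop

lemma trap_nonneg (a b ε s : ℝ) : 0 ≤ trap a b ε s := le_max_left _ _

lemma trap_le_one (a b ε s : ℝ) : trap a b ε s ≤ 1 := max_le zero_le_one (min_le_left _ _)

lemma trap_eq_zero {a b ε s : ℝ} (hε : 0 < ε) (hs : s ∉ Ioo a b) : trap a b ε s = 0 := by
  refine max_eq_left ((min_le_right _ _).trans ?_)
  rcases le_or_gt s a with h | h
  · exact (min_le_left _ _).trans (div_nonpos_of_nonpos_of_nonneg (by linarith) hε.le)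
  · have : b ≤ s := by
      by_contra hcon
      exact hs ⟨h, not_le.1 hcon⟩
    exact (min_le_right _ _).trans (div_nonpos_of_nonpos_of_nonneg (by linarith) hε.le)

lemma trap_eq_one {a b ε s : ℝ} (hε : 0 < ε) (hs : s ∈ Icc (a + ε) (b - ε)) :
    trap a b ε s = 1 := by
  have h1 : 1 ≤ (s - a) / ε := by rw [le_div_iff₀ hε]; linarith [hs.1]
  have h2 : 1 ≤ (b - s) / ε := by rw [le_div_iff₀ hε]; linarith [hs.2]
  rw [trap, min_eq_left (le_min h1 h2), max_eq_right zero_le_one]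

lemma integrable_trap (a b : ℝ) {ε : ℝ} (hε : 0 < ε) : Integrable (trap a b ε) :=
  (continuous_trap a b ε).integrable_of_hasCompactSupport <|
    HasCompactSupport.intro (isCompact_Icc (a := a) (b := b)) fun _ hs =>
      trap_eq_zero hε fun h => hs (Ioo_subset_Icc_self h)

lemma integral_trap_le {a b ε : ℝ} (hab : a ≤ b) (hε : 0 < ε) : ∫ s, trap a b ε s ≤ b - a := by
  have h : ∫ s, (Ioc a b).indicator (fun _ => (1:ℝ)) s = b - a := by
    rw [integral_indicator_const _ measurableSet_Ioc]
    simp [Measure.real, hab]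
  rw [← h]
  refine integral_mono (integrable_trap a b hε)
    ((integrable_indicator_iff measurableSet_Ioc).2 (by simp)) fun s => ?_
  by_cases hs : s ∈ Ioc a b
  · rw [indicator_of_mem hs]; exact trap_le_one _ _ _ _
  · rw [indicator_of_notMem hs, trap_eq_zero hε fun h => hs (Ioo_subset_Ioc_self h)]

lemma le_integral_trap {a b ε : ℝ} (hε : 0 < ε) (hab : a + ε ≤ b - ε) :
    b - a - 2 * ε ≤ ∫ s, trap a b ε s := by
  have h : ∫ s, (Icc (a + ε) (b - ε)).indicator (fun _ => (1:ℝ)) s = b - a - 2 * ε := by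
    rw [integral_indicator_const _ measurableSet_Icc]
    simp only [Measure.real, Real.volume_Icc, smul_eq_mul, mul_one]
    rw [ENNReal.toReal_ofReal (by linarith)]
    ring
  rw [← h]
  refine integral_mono ((integrable_indicator_iff measurableSet_Icc).2 (by simp))
    (integrable_trap a b hε) fun s => ?_
  by_cases hs : s ∈ Icc (a + ε) (b - ε)
  · rw [indicator_of_mem hs, trap_eq_one hε hs]
  · rw [indicator_of_notMem hs]; exact trap_nonneg _ _ _ _

lemma tendsto_measureReal_Ioc_of_tendsto_rho [∀ k, IsFiniteMeasure (ν k)] (hR : 0 < R) {h : ℝ}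
    (hh : 0 < h) (hhR : 2 * h ≤ 1 / R)
    (H : ∀ θ : ℝ, Tendsto (fun k => ∫ s : ℝ, Complex.exp (θ * s * Complex.I) * rho R s ∂ν k) atTop
      (𝓝 (2 * π * c * tri R θ))) :
    Tendsto (fun k => (ν k).real (Ioc 0 h)) atTop (𝓝 (h * c.re)) := by
  have hc0 : 0 ≤ c.re := by
    have hm := (tendsto_integral_rho hR H).1
    have := ge_of_tendsto' hm fun k => integral_nonneg (rho_nonneg hR)
    have hpi := Real.pi_pos
    by_contra hneg
    push Not at hneg
    have : 2 * π * R * c.re < 0 := mul_neg_of_pos_of_neg (by positivity) hneg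
    linarith
  have hbd : ∀ a b ε s, |trap a b ε s| ≤ 1 := fun a b ε s => by
    rw [abs_of_nonneg (trap_nonneg _ _ _ _)]; exact trap_le_one _ _ _ _
  have hind : ∀ k, (ν k).real (Ioc 0 h) = ∫ s, (Ioc 0 h).indicator (fun _ => (1:ℝ)) s ∂ν k := by
    intro k
    rw [integral_indicator_const _ measurableSet_Ioc]
    simp
  have hiT : ∀ k a b ε, Integrable (trap a b ε) (ν k) := fun k a b ε =>
    Integrable.of_bound (continuous_trap a b ε).aestronglyMeasurable 1
      (Eventually.of_forall (hbd a b ε))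
  have hiI : ∀ k, Integrable ((Ioc 0 h).indicator fun _ => (1:ℝ)) (ν k) := fun k =>
    (integrable_const (1:ℝ)).indicator measurableSet_Ioc
  have hlim : ∀ (a b ε : ℝ), 0 < ε → -h ≤ a → b ≤ 2 * h →
      Tendsto (fun k => ∫ s, trap a b ε s ∂ν k) atTop (𝓝 (c.re * ∫ s, trap a b ε s)) := by
    intro a b ε hε ha hb
    refine tendsto_integral_of_tendsto_rho hR H (continuous_trap a b ε) (hbd a b ε) fun s hs => ?_
    refine trap_eq_zero hε fun hsm => ?_
    have : |s| ≤ 2 * h := abs_le.2 ⟨by linarith [hsm.1], by linarith [hsm.2]⟩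
    linarith
  refine tendsto_order.2 ⟨fun a ha => ?_, fun a ha => ?_⟩
  · have hex : ∃ ε > 0, ε ≤ h / 2 ∧ a < c.re * (h - 2 * ε) := by
      have hcont : Tendsto (fun ε : ℝ => c.re * (h - 2 * ε)) (𝓝[>] 0) (𝓝 (c.re * (h - 2 * 0))) :=
        ((by fun_prop : Continuous fun ε : ℝ => c.re * (h - 2 * ε)).tendsto 0).mono_left
          nhdsWithin_le_nhds
      obtain ⟨ε, h1, h2, h3⟩ := ((hcont.eventually (lt_mem_nhds (by linarith))).and
        ((eventually_mem_nhdsWithin).and (nhdsWithin_le_nhds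
          (Iic_mem_nhds (half_pos hh))))).exists
      exact ⟨ε, h2, h3, h1⟩
    obtain ⟨ε, hε, hεh, hlt⟩ := hex
    have h1 : a < c.re * ∫ s, trap 0 h ε s := by
      refine hlt.trans_le (mul_le_mul_of_nonneg_left ?_ hc0)
      have := le_integral_trap (a := 0) (b := h) hε (by linarith)
      linarith
    filter_upwards [(hlim 0 h ε hε (by linarith) (by linarith)).eventually (lt_mem_nhds h1)]
      with k hk
    refine hk.trans_le ?_
    rw [hind]
    refine integral_mono (hiT _ _ _ _) (hiI k) fun s => ?_
    by_cases hs : s ∈ Ioc 0 h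
    · rw [indicator_of_mem hs]; exact trap_le_one _ _ _ _
    · rw [indicator_of_notMem hs, trap_eq_zero hε fun h => hs (Ioo_subset_Ioc_self h)]
  · have hex : ∃ ε > 0, ε ≤ h / 2 ∧ c.re * (h + 2 * ε) < a := by
      have hcont : Tendsto (fun ε : ℝ => c.re * (h + 2 * ε)) (𝓝[>] 0) (𝓝 (c.re * (h + 2 * 0))) :=
        ((by fun_prop : Continuous fun ε : ℝ => c.re * (h + 2 * ε)).tendsto 0).mono_left
          nhdsWithin_le_nhds
      obtain ⟨ε, h1, h2, h3⟩ := ((hcont.eventually (gt_mem_nhds (by linarith))).and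
        ((eventually_mem_nhdsWithin).and (nhdsWithin_le_nhds
          (Iic_mem_nhds (half_pos hh))))).exists
      exact ⟨ε, h2, h3, h1⟩
    obtain ⟨ε, hε, hεh, hlt⟩ := hex
    have h1 : c.re * ∫ s, trap (-ε) (h + ε) ε s < a := by
      refine (mul_le_mul_of_nonneg_left ?_ hc0).trans_lt hlt
      have := integral_trap_le (a := -ε) (b := h + ε) (by linarith) hε
      linarith
    filter_upwards [(hlim (-ε) (h + ε) ε hε (by linarith) (by linarith)).eventually
      (gt_mem_nhds h1)] with k hk
    refine lt_of_le_of_lt ?_ hk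
    rw [hind]
    refine integral_mono (hiI k) (hiT _ _ _ _) fun s => ?_
    by_cases hs : s ∈ Ioc 0 h
    · rw [indicator_of_mem hs, trap_eq_one hε ⟨by linarith [hs.1], by linarith [hs.2]⟩]
    · rw [indicator_of_notMem hs]; exact trap_nonneg _ _ _ _

end Vague

end

section

/-! ### The middle range of summation -/

variable {F : Measure ℝ} [IsProbabilityMeasure F] {ℓ g : ℝ → ℝ} {α : ℝ}

/-- The centred and rescaled contribution of `δ H(x) ≤ n < Δ H(x)` to the renewal measure. -/
def midMeasure (F : Measure ℝ) (δ Δ x : ℝ) : Measure ℝ :=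
  ENNReal.ofReal (x / invTail F x) • ∑ n ∈ Finset.Ico ⌈δ * invTail F x⌉₊ ⌈Δ * invTail F x⌉₊,
    (convPow F n).map fun s => s - x

instance (δ Δ x : ℝ) : IsFiniteMeasure (midMeasure F δ Δ x) := by
  refine ⟨?_⟩
  rw [midMeasure, Measure.smul_apply, smul_eq_mul, Measure.finsetSum_apply]
  exact ENNReal.mul_lt_top ENNReal.ofReal_lt_top
    (ENNReal.sum_lt_top.2 fun n _ => measure_lt_top _ _)

lemma integral_midMeasure {δ Δ x : ℝ} (hx : 0 ≤ x / invTail F x) {f : ℝ → ℂ} (hf : Continuous f)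
    {M : ℝ} (hM : ∀ s, ‖f s‖ ≤ M) :
    ∫ s, f s ∂midMeasure F δ Δ x = ((x / invTail F x : ℝ) : ℂ) *
      ∑ n ∈ Finset.Ico ⌈δ * invTail F x⌉₊ ⌈Δ * invTail F x⌉₊,
        ∫ s, f (s - x) ∂convPow F n := by
  rw [midMeasure, integral_smul_measure, integral_finsetSum_measure, ENNReal.toReal_ofReal hx,
    Complex.real_smul]
  · congr 1
    refine Finset.sum_congr rfl fun n _ => ?_
    exact integral_map (by fun_prop) hf.aestronglyMeasurable
  · intro n _
    exact Integrable.of_bound hf.aestronglyMeasurable M (Eventually.of_forall hM)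

lemma measureReal_midMeasure {δ Δ x h : ℝ} (hx : 0 ≤ x / invTail F x) :
    (midMeasure F δ Δ x).real (Ioc 0 h) = x / invTail F x *
      ∑ n ∈ Finset.Ico ⌈δ * invTail F x⌉₊ ⌈Δ * invTail F x⌉₊,
        (convPow F n).real (Ioc x (x + h)) := by
  rw [midMeasure, Measure.real, Measure.smul_apply, smul_eq_mul, Measure.finsetSum_apply,
    ENNReal.toReal_mul, ENNReal.toReal_ofReal hx,
    ENNReal.toReal_sum fun n _ => measure_ne_top _ _]
  congr 1
  refine Finset.sum_congr rfl fun n _ => ?_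
  rw [Measure.map_apply (by fun_prop) measurableSet_Ioc, Measure.real]
  congr 2
  ext s
  simp only [mem_preimage, mem_Ioc]
  constructor <;> rintro ⟨h1, h2⟩ <;> constructor <;> linarith

lemma Setup.tendsto_mid_of_not_arith (S : Setup F ℓ g α) (hF : ¬ Arith F) {h : ℝ} (hh : 0 < h)
    {δ Δ : ℝ} (hδ : 0 < δ) (hδΔ : δ < Δ) :
    Tendsto (fun x => x / invTail F x *
      ∑ n ∈ Finset.Ico ⌈δ * invTail F x⌉₊ ⌈Δ * invTail F x⌉₊,
        (convPow F n).real (Ioc x (x + h))) atTop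
      (𝓝 (h * (∫ v in δ..Δ, gammaFn g α v).re)) := by
  rw [tendsto_iff_seq_tendsto]
  intro u hu
  have hpos : ∀ᶠ x in atTop, 0 ≤ x / invTail F x := by
    filter_upwards [eventually_ge_atTop 0] with x hx
    exact div_nonneg hx (S.rv.pos x).le
  set R : ℝ := 1 / (2 * h)
  have hR : 0 < R := by positivity
  have hmain := tendsto_measureReal_Ioc_of_tendsto_rho (ν := fun k => midMeasure F δ Δ (u k))
    (c := ∫ v in δ..Δ, gammaFn g α v) hR hh (by simp [R]) (fun θ => ?_)
  · refine hmain.congr' ?_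
    filter_upwards [hu.eventually hpos] with k hk
    exact measureReal_midMeasure hk
  · have hKB : ∀ t : ℝ, ‖(tri R (t - θ) : ℂ)‖ ≤ R := fun t => by
      rw [Complex.norm_real, Real.norm_of_nonneg (tri_nonneg _ _)]
      exact tri_le hR _
    have hlim := S.tendsto_sum_fourier (K := fun t => (tri R (t - θ) : ℂ)) (B := R)
      (by fun_prop) hKB (by fun_prop) (R := R + |θ|)
      (fun t ht => by
        have : R ≤ |t - θ| := by linarith [abs_sub_abs_le_abs_sub t θ]
        simp [tri_eq_zero this])
      (fun t ht _ h1 => hF ⟨_, by have := abs_pos.2 ht; have := Real.pi_pos; positivity,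
        concOn_of_charFun_eq_one ht h1⟩)
      (z := fun x => x) (tendsto_const_nhds.congr' (by
        filter_upwards [eventually_ne_atTop 0] with x hx
        rw [div_self hx])) hδ hδΔ
    have h0 : tri R (0 - θ) = tri R θ := by rw [zero_sub, tri_neg]
    rw [h0] at hlim
    have heq : (tri R θ : ℂ) * (2 * π) * (∫ v in δ..Δ, gammaFn g α v) =
        2 * π * (∫ v in δ..Δ, gammaFn g α v) * tri R θ := by ring
    rw [heq] at hlim
    refine (hlim.comp hu).congr' ?_
    filter_upwards [hu.eventually hpos] with k hk
    rw [integral_midMeasure hk (by fun_prop) (M := R ^ 2)]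
    · simp only [Function.comp_apply]
      congr 1
      refine Finset.sum_congr rfl fun n _ => ?_
      have := integral_tri_sub_mul_charFun (convPow F n) R θ (u k)
      simp only [Complex.ofReal_sub]
      rw [← this]
      refine integral_congr_ae (Eventually.of_forall fun t => ?_)
      simp only
      rw [charFun_convPow]
      ring
    · intro s
      rw [norm_mul, ← Complex.ofReal_mul, Complex.norm_exp_ofReal_mul_I, one_mul,
        Complex.norm_real, Real.norm_of_nonneg (rho_nonneg hR s)]
      exact rho_le hR s

lemma ae_convPow_of_concOn {h : ℝ} (hF : ConcOn F h) (n : ℕ) :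
    ∀ᵐ x ∂convPow F n, ∃ k : ℤ, x = k * h := by
  have hm : MeasurableSet {x : ℝ | ∃ k : ℤ, x = k * h} := by
    have : {x : ℝ | ∃ k : ℤ, x = k * h} = range fun k : ℤ => (k:ℝ) * h := by
      ext x; simp [eq_comm]
    rw [this]
    exact (countable_range _).measurableSet
  have h1 : ∀ᵐ x ∂F, ∃ k : ℤ, x = k * h := (mem_ae_iff_prob_eq_one hm).2 hF
  induction n with
  | zero =>
    rw [convPow, ae_dirac_iff hm]
    exact ⟨0, by simp⟩
  | succ n ih =>
    rw [ae_iff] at *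
    change mconv (convPow F n) F {x : ℝ | ∃ k : ℤ, x = k * h}ᶜ = 0
    rw [← lintegral_indicator_one hm.compl, lintegral_mconv (measurable_one.indicator hm.compl)]
    refine lintegral_eq_zero_of_ae_eq_zero ?_
    filter_upwards [ae_iff.2 ih] with x hx
    refine lintegral_eq_zero_of_ae_eq_zero ?_
    filter_upwards [ae_iff.2 h1] with y hy
    obtain ⟨i, hi⟩ := hx
    obtain ⟨j, hj⟩ := hy
    rw [indicator_of_notMem]
    · rfl
    · simp only [mem_compl_iff, not_not, mem_ofPred_eq]
      exact ⟨i + j, by rw [hi, hj]; push_cast; ring⟩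

/-- The mass of an atom of a law on `hℤ` through its characteristic function. -/
lemma integral_indicator_mul_charFun {h : ℝ} (hh : 0 < h) (μ : Measure ℝ) [IsFiniteMeasure μ]
    (hμ : ∀ᵐ x ∂μ, ∃ k : ℤ, x = k * h) (j : ℤ) :
    ∫ t : ℝ, (Icc (-(π / h)) (π / h)).indicator (fun _ => (1:ℂ)) t *
      (charFun μ t * Complex.exp (-(t * (j * h : ℝ) * Complex.I))) =
      ((2 * π / h * μ.real {(j * h : ℝ)} : ℝ) : ℂ) := by
  have hpi := Real.pi_pos
  have hr : 0 < π / h := by positivity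
  have hK : Integrable fun t : ℝ => (Icc (-(π / h)) (π / h)).indicator (fun _ => (1:ℂ)) t *
      Complex.exp (-(t * (j * h : ℝ) * Complex.I)) := by
    refine Integrable.mul_bdd (c := 1) ((integrable_indicator_iff measurableSet_Icc).2 (by simp))
      (by fun_prop) (Eventually.of_forall fun t => ?_)
    rw [norm_exp_neg_mul_I]
  have h1 := integral_mul_charFun μ hK
  have h2 : ∀ t : ℝ, (Icc (-(π / h)) (π / h)).indicator (fun _ => (1:ℂ)) t *
      (charFun μ t * Complex.exp (-(t * (j * h : ℝ) * Complex.I))) =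
      (Icc (-(π / h)) (π / h)).indicator (fun _ => (1:ℂ)) t *
      Complex.exp (-(t * (j * h : ℝ) * Complex.I)) * charFun μ t := fun t => by ring
  simp_rw [h2]
  rw [h1]
  have h3 : ∀ᵐ x : ℝ ∂μ, (∫ t : ℝ, (Icc (-(π / h)) (π / h)).indicator (fun _ => (1:ℂ)) t *
      Complex.exp (-(t * (j * h : ℝ) * Complex.I)) * Complex.exp (t * x * Complex.I)) =
      ({(j * h : ℝ)} : Set ℝ).indicator (fun _ => ((2 * π / h : ℝ) : ℂ)) x := by
    filter_upwards [hμ] with x ⟨k, hk⟩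
    have h4 : ∀ t : ℝ, (Icc (-(π / h)) (π / h)).indicator (fun _ => (1:ℂ)) t *
        Complex.exp (-(t * (j * h : ℝ) * Complex.I)) * Complex.exp (t * x * Complex.I) =
        (Icc (-(π / h)) (π / h)).indicator
          (fun t => Complex.exp (((k - j : ℤ) : ℂ) * h * Complex.I * t)) t := by
      intro t
      by_cases ht : t ∈ Icc (-(π / h)) (π / h)
      · rw [indicator_of_mem ht, indicator_of_mem ht, one_mul, ← Complex.exp_add, hk]
        congr 1
        push_cast
        ring
      · rw [indicator_of_notMem ht, indicator_of_notMem ht, zero_mul, zero_mul]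
    simp_rw [h4]
    rw [integral_indicator measurableSet_Icc, integral_Icc_eq_integral_Ioc,
      ← intervalIntegral.integral_of_le (by linarith)]
    by_cases hkj : k = j
    · subst hkj
      rw [indicator_of_mem (by rw [hk]; rfl)]
      simp
      ring
    · have hx : x ∉ ({(j * h : ℝ)} : Set ℝ) := by
        rw [hk, mem_singleton_iff, mul_left_inj' hh.ne']
        exact_mod_cast hkj
      rw [indicator_of_notMem hx]
      have hc : (((k - j : ℤ) : ℂ) * h * Complex.I) ≠ 0 := by
        refine mul_ne_zero (mul_ne_zero ?_ (by exact_mod_cast hh.ne')) Complex.I_ne_zero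
        exact_mod_cast sub_ne_zero.2 hkj
      rw [integral_exp_mul_complex hc, div_eq_zero_iff, sub_eq_zero]
      left
      have hhc : (h : ℂ) ≠ 0 := by exact_mod_cast hh.ne'
      rw [Complex.exp_eq_exp_iff_exists_int]
      refine ⟨k - j, ?_⟩
      push_cast
      field_simp
      ring
  rw [integral_congr_ae h3, integral_indicator_const _ (measurableSet_singleton _),
    Complex.real_smul]
  push_cast
  ring

lemma Setup.tendsto_mid_of_arith (S : Setup F ℓ g α) {h : ℝ} (hh : 0 < h) (hF : ConcOn F h)
    (hmax : ∀ d > 0, ConcOn F d → d ≤ h) {δ Δ : ℝ} (hδ : 0 < δ) (hδΔ : δ < Δ) :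
    Tendsto (fun x => x / invTail F x *
      ∑ n ∈ Finset.Ico ⌈δ * invTail F x⌉₊ ⌈Δ * invTail F x⌉₊,
        (convPow F n).real (Ioc x (x + h))) atTop
      (𝓝 (h * (∫ v in δ..Δ, gammaFn g α v).re)) := by
  have hpi := Real.pi_pos
  have hr : 0 < π / h := by positivity
  set K : ℝ → ℂ := (Icc (-(π / h)) (π / h)).indicator fun _ => (1:ℂ)
  set j : ℝ → ℤ := fun x => ⌊x / h⌋ + 1
  have hK0 : K 0 = 1 := indicator_of_mem (by constructor <;> linarith) _
  have hj : ∀ x, x < j x * h ∧ j x * h ≤ x + h := by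
    intro x
    have h1 := Int.lt_floor_add_one (x / h)
    have h2 := Int.floor_le (x / h)
    rw [div_lt_iff₀ hh] at h1
    rw [le_div_iff₀ hh] at h2
    simp only [j]
    push_cast
    exact ⟨h1, by linarith⟩
  have hz : Tendsto (fun x : ℝ => (j x * h : ℝ) / x) atTop (𝓝 1) := by
    have h1 : Tendsto (fun x : ℝ => 1 + h / x) atTop (𝓝 (1 + 0)) :=
      tendsto_const_nhds.add (tendsto_const_nhds.div_atTop tendsto_id)
    rw [add_zero] at h1
    refine tendsto_of_tendsto_of_tendsto_of_le_of_le' tendsto_const_nhds h1 ?_ ?_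
    · filter_upwards [eventually_gt_atTop 0] with x hx
      rw [le_div_iff₀ hx, one_mul]
      exact (hj x).1.le
    · filter_upwards [eventually_gt_atTop 0] with x hx
      rw [div_le_iff₀ hx, add_mul, one_mul, div_mul_cancel₀ _ hx.ne']
      exact (hj x).2
  have hlim := S.tendsto_sum_fourier (K := K) (B := 1)
    (measurable_const.indicator measurableSet_Icc)
    (fun t => by
      by_cases ht : t ∈ Icc (-(π / h)) (π / h)
      · simp [K, indicator_of_mem ht]
      · simp [K, indicator_of_notMem ht])
    (by
      refine ContinuousAt.congr continuousAt_const (f := fun _ => (1:ℂ)) ?_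
      filter_upwards [Icc_mem_nhds (by linarith : -(π / h) < 0) hr] with t ht
      simp [K, indicator_of_mem ht])
    (R := π / h) (fun t ht => indicator_of_notMem
      (fun hm : t ∈ Icc (-(π / h)) (π / h) => absurd (abs_le.2 hm) (not_le.2 ht)) _)
    (fun t ht hle h1 => by
      have hta := abs_pos.2 ht
      have := hmax _ (by positivity) (concOn_of_charFun_eq_one ht h1)
      rw [div_le_iff₀ hta] at this
      rw [le_div_iff₀ hh] at hle
      nlinarith)
    hz hδ hδΔ
  rw [hK0, one_mul] at hlim
  have h2 := ((Complex.continuous_re.tendsto _).comp hlim).const_mul (h / (2 * π))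
  have hval : h / (2 * π) * (2 * (π:ℂ) * ∫ v in δ..Δ, gammaFn g α v).re =
      h * (∫ v in δ..Δ, gammaFn g α v).re := by
    have : (2 * (π:ℂ) * ∫ v in δ..Δ, gammaFn g α v) =
      ((2 * π : ℝ) : ℂ) * ∫ v in δ..Δ, gammaFn g α v := by push_cast; ring
    rw [this, Complex.re_ofReal_mul]
    field_simp
  rw [hval] at h2
  refine h2.congr fun x => ?_
  have hatom : ∀ n, (convPow F n).real (Ioc x (x + h)) = (convPow F n).real {(j x * h : ℝ)} := by
    intro n
    refine measureReal_congr ?_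
    filter_upwards [ae_convPow_of_concOn hF n] with s ⟨k, hk⟩
    have : s ∈ Ioc x (x + h) ↔ s ∈ ({(j x * h : ℝ)} : Set ℝ) := by
      rw [mem_singleton_iff]
      constructor
      · intro hs
        have h3 : (k:ℝ) < j x + 1 := by
          refine lt_of_mul_lt_mul_right ?_ hh.le
          linarith [hs.2, (hj x).1]
        have h4 : (j x:ℝ) < k + 1 := by
          refine lt_of_mul_lt_mul_right ?_ hh.le
          linarith [hs.1, (hj x).2]
        have : k = j x := by
          have h3' : k < j x + 1 := by exact_mod_cast h3
          have h4' : j x < k + 1 := by exact_mod_cast h4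
          omega
        rw [hk, this]
      · intro hs
        rw [hs]
        exact hj x
    exact propext this
  simp only [Function.comp_apply]
  have hterm : ∀ n, ∫ t : ℝ, K t * (charFun F t ^ n *
      Complex.exp (-(t * (j x * h : ℝ) * Complex.I))) =
      ((2 * π / h * (convPow F n).real {(j x * h : ℝ)} : ℝ) : ℂ) := by
    intro n
    rw [← integral_indicator_mul_charFun hh (convPow F n) (ae_convPow_of_concOn hF n) (j x)]
    simp only [charFun_convPow, K]
  simp only [hterm, hatom]
  rw [← Complex.ofReal_sum, ← Complex.ofReal_mul, Complex.ofReal_re, ← Finset.mul_sum]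
  field_simp

lemma Setup.tendsto_mid (S : Setup F ℓ g α) {h : ℝ} (hspan : SpanOK F h)
    {δ Δ : ℝ} (hδ : 0 < δ) (hδΔ : δ < Δ) :
    Tendsto (fun x => x / invTail F x *
      ∑ n ∈ Finset.Ico ⌈δ * invTail F x⌉₊ ⌈Δ * invTail F x⌉₊,
        (convPow F n).real (Ioc x (x + h))) atTop
      (𝓝 (h * (∫ v in δ..Δ, gammaFn g α v).re)) := by
  obtain ⟨hh, hF | ⟨hF, hmax⟩⟩ := hspan
  · exact S.tendsto_mid_of_not_arith hF hh hδ hδΔ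
  · exact S.tendsto_mid_of_arith hh hF hmax hδ hδΔ

end

section

/-! ### The range of large indices -/

namespace Setup

variable {F : Measure ℝ} [IsProbabilityMeasure F] {ℓ g : ℝ → ℝ} {α : ℝ}

lemma exists_large_le (S : Setup F ℓ g α) (h : ℝ) :
    ∃ C ≥ 0, ∀ Δ ≥ 1, ∀ x ≥ 1, ∀ M : ℕ, x / invTail F x *
      ∑ n ∈ Finset.Ico ⌈Δ * invTail F x⌉₊ M, (convPow F n).real (Ioc x (x + h)) ≤
        C * Δ ^ (-(1 / 2) : ℝ) := by
  obtain ⟨A, hA, hA'⟩ := S.exists_convPow_Ioc_le h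
  obtain ⟨B, hB, hB'⟩ := S.inv.le_div_of_le S.rv S.pos (q := 2 / 3) (by linarith [S.le_half])
  obtain ⟨D, hD, hD'⟩ := sum_Ico_rpow_neg_le (p := 3 / 2) (by norm_num)
  have hB0 : 0 < B := by linarith
  refine ⟨A * B ^ (3 / 2 : ℝ) * D, by positivity, fun Δ hΔ x hx M => ?_⟩
  have hH := S.rv.pos x
  have hH1 := S.rv.one_le x
  set H := invTail F x
  have hx0 : 0 < x := by linarith
  have hΔ0 : 0 < Δ := by linarith
  have hterm : ∀ n ∈ Finset.Ico ⌈Δ * H⌉₊ M, (convPow F n).real (Ioc x (x + h)) ≤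
      A * B ^ (3 / 2 : ℝ) * H ^ (3 / 2 : ℝ) / x * (n : ℝ) ^ (-(3 / 2) : ℝ) := by
    intro n hn
    have hn1 : Δ * H ≤ n := (Nat.le_ceil _).trans (by exact_mod_cast (Finset.mem_Ico.1 hn).1)
    have hnH : H ≤ n := by nlinarith
    have hn0 : (0:ℝ) < n := hH.trans_le hnH
    have hb := S.inv.pos (n:ℝ)
    have h1 := hB' x n hx hnH
    have h2 : x / linv ℓ n ≤ (B * (H / n)) ^ (3 / 2 : ℝ) := by
      have h3 : (x / linv ℓ n) ^ (2 / 3 : ℝ) ≤ B * (H / n) := by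
        have h4 : (x / linv ℓ n) ^ (2 / 3 : ℝ) = ((linv ℓ n / x) ^ (2 / 3 : ℝ))⁻¹ := by
          rw [← Real.inv_rpow (by positivity), inv_div]
        rw [h4, inv_le_comm₀ (by positivity) (by positivity), mul_inv, inv_div]
        rw [inv_mul_le_iff₀ hB0]
        exact h1
      have h5 := Real.rpow_le_rpow (by positivity) h3 (by norm_num : (0:ℝ) ≤ 3 / 2)
      rwa [← Real.rpow_mul (by positivity), show (2 / 3 : ℝ) * (3 / 2) = 1 by norm_num,
        Real.rpow_one] at h5
    rw [Real.mul_rpow (by positivity) (by positivity), Real.div_rpow hH.le hn0.le] at h2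
    calc (convPow F n).real (Ioc x (x + h)) ≤ A / linv ℓ n := hA' n x
      _ = A / x * (x / linv ℓ n) := by field_simp
      _ ≤ A / x * (B ^ (3 / 2 : ℝ) * (H ^ (3 / 2 : ℝ) / (n:ℝ) ^ (3 / 2 : ℝ))) := by gcongr
      _ = _ := by rw [Real.rpow_neg hn0.le]; ring
  have hX : 1 ≤ Δ * H := by nlinarith
  calc x / H * ∑ n ∈ Finset.Ico ⌈Δ * H⌉₊ M, (convPow F n).real (Ioc x (x + h))
      ≤ x / H * ∑ n ∈ Finset.Ico ⌈Δ * H⌉₊ M,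
        A * B ^ (3 / 2 : ℝ) * H ^ (3 / 2 : ℝ) / x * (n : ℝ) ^ (-(3 / 2) : ℝ) := by
        gcongr with n hn
        exact hterm n hn
    _ ≤ x / H * (A * B ^ (3 / 2 : ℝ) * H ^ (3 / 2 : ℝ) / x *
        (D * (Δ * H) ^ (1 - 3 / 2 : ℝ))) := by
        rw [← Finset.mul_sum]
        gcongr
        exact hD' _ _ hX
    _ = A * B ^ (3 / 2 : ℝ) * D * Δ ^ (-(1 / 2) : ℝ) := by
        rw [show (1 - 3 / 2 : ℝ) = -(1 / 2) by norm_num, Real.mul_rpow hΔ0.le hH.le,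
          show (3 / 2 : ℝ) = 1 + 1 / 2 by norm_num, Real.rpow_add hH, Real.rpow_one,
          Real.rpow_neg hH.le]
        have := Real.rpow_pos_of_pos hH (1 / 2)
        field_simp

lemma summable_convPow (S : Setup F ℓ g α) (h : ℝ) {x : ℝ} (hx : 1 ≤ x) :
    Summable fun n => (convPow F n).real (Ioc x (x + h)) := by
  obtain ⟨C, hC, hC'⟩ := S.exists_large_le h
  have hH := S.rv.pos x
  refine (summable_nat_add_iff ⌈1 * invTail F x⌉₊).1 ?_
  refine summable_of_sum_range_le (c := C * 1 ^ (-(1 / 2) : ℝ) / (x / invTail F x))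
    (fun n => measureReal_nonneg) fun n => ?_
  have := hC' 1 le_rfl x hx (⌈1 * invTail F x⌉₊ + n)
  rw [le_div_iff₀ (by positivity), mul_comm]
  rw [Finset.sum_Ico_eq_sum_range, Nat.add_sub_cancel_left] at this
  simpa only [add_comm] using this

end Setup

lemma renewal_toReal {F : Measure ℝ} [IsProbabilityMeasure F] (x y : ℝ) :
    (renewal F (Ioc x y)).toReal = ∑' n, (convPow F n).real (Ioc x y) := by
  rw [renewal, Measure.sum_apply _ measurableSet_Ioc,
    ENNReal.tsum_toReal_eq fun n => measure_ne_top _ _]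
  rfl

end

section

/-! ### Tails of sums of truncated variables -/

lemma lintegral_exp_convPow (μ : Measure ℝ) [IsFiniteMeasure μ] (θ : ℝ) (m : ℕ) :
    ∫⁻ z, ENNReal.ofReal (exp (θ * z)) ∂(convPow μ m) =
      (∫⁻ u, ENNReal.ofReal (exp (θ * u)) ∂μ) ^ m := by
  induction m with
  | zero => simp [convPow]
  | succ m ih =>
    rw [convPow, lintegral_mconv (by fun_prop), pow_succ, ← ih,
      ← lintegral_mul_const _ (by fun_prop)]
    refine lintegral_congr fun x => ?_
    rw [← lintegral_const_mul _ (by fun_prop)]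
    refine lintegral_congr fun y => ?_
    rw [mul_add, Real.exp_add, ENNReal.ofReal_mul (exp_pos _).le]

lemma measure_Ioi_le_exp (μ : Measure ℝ) {θ : ℝ} (hθ : 0 ≤ θ) (z : ℝ) :
    μ (Ioi z) ≤ ENNReal.ofReal (exp (-(θ * z))) * ∫⁻ u, ENNReal.ofReal (exp (θ * u)) ∂μ := by
  rw [← lintegral_const_mul _ (by fun_prop), ← lintegral_indicator_one measurableSet_Ioi]
  refine lintegral_mono fun u => ?_
  by_cases hu : u ∈ Ioi z
  · rw [indicator_of_mem hu, ← ENNReal.ofReal_mul (exp_pos _).le, ← Real.exp_add]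
    refine (ENNReal.one_le_ofReal).2 (Real.one_le_exp ?_)
    have := mul_le_mul_of_nonneg_left (le_of_lt (mem_Ioi.1 hu)) hθ
    linarith
  · simp [indicator_of_notMem hu]

lemma exp_mul_le_one_add {θ y u : ℝ} (hθ : 0 ≤ θ) (hy : 0 < y) (hu : u ≤ y) :
    exp (θ * u) ≤ 1 + exp (θ * y) / y * max u 0 := by
  rcases le_or_gt u 0 with h | h
  · rw [max_eq_right h, mul_zero, add_zero]
    exact Real.exp_le_one_iff.2 (mul_nonpos_of_nonneg_of_nonpos hθ h)
  · rw [max_eq_left h.le]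
    have hc := convexOn_exp.2 (mem_univ 0) (mem_univ (θ * y))
      (by rw [sub_nonneg, div_le_one hy]; exact hu : 0 ≤ 1 - u / y)
      (by positivity : 0 ≤ u / y) (by ring)
    have h1 : (1 - u / y) • (0:ℝ) + (u / y) • (θ * y) = θ * u := by
      simp only [smul_eq_mul]; field_simp; ring
    rw [h1, Real.exp_zero, smul_eq_mul, smul_eq_mul, mul_one] at hc
    have : 0 ≤ u / y := by positivity
    calc exp (θ * u) ≤ 1 - u / y + u / y * exp (θ * y) := hc
      _ ≤ 1 + u / y * exp (θ * y) := by linarith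
      _ = _ := by ring

namespace Setup

variable {F : Measure ℝ} [IsProbabilityMeasure F] {ℓ g : ℝ → ℝ} {α : ℝ}

lemma exists_rtail_le (S : Setup F ℓ g α) {q : ℝ} (hq : α < q) :
    ∃ C ≥ 1, ∀ t y : ℝ, 0 < t → t ≤ y → 1 ≤ y → rtail F t ≤ C * (y / t) ^ q * rtail F y := by
  have hq0 : 0 < q := S.pos.trans hq
  obtain ⟨C, hC, hP⟩ := S.rv.potter_upper hq hq0.le
  have hH1 := S.rv.one_le 1
  have hr : ∀ z, 0 < rtail F z := rtail_pos S.rightTail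
  refine ⟨C * invTail F 1, one_le_mul_of_one_le_of_one_le hC hH1, fun t y ht hty hy => ?_⟩
  have hCp : 0 < C := by linarith
  have key : ∀ s, 1 ≤ s → s ≤ y → rtail F s ≤ C * (y / s) ^ q * rtail F y := fun s hs hsy => by
    have := hP s y hs hsy
    simp only [invTail] at this
    rwa [inv_le_iff_one_le_mul₀ (hr y), mul_comm _ (rtail F y), ← mul_assoc, ← div_eq_mul_inv,
      one_le_div (hr s), mul_comm (rtail F y)] at this
  have hyt : 0 ≤ (y / t) ^ q * rtail F y := mul_nonneg (by positivity) (hr y).le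
  rcases le_or_gt 1 t with h | h
  · refine (key t h hty).trans ?_
    nlinarith [mul_le_mul_of_nonneg_left hH1 (mul_nonneg hCp.le hyt)]
  · have h1 := key 1 le_rfl hy
    have h2 : (1:ℝ) ≤ C * invTail F 1 * (y / 1) ^ q * rtail F y := by
      rw [invTail, show C * (rtail F 1)⁻¹ * (y / 1) ^ q * rtail F y
        = (C * (y / 1) ^ q * rtail F y) / rtail F 1 by ring, one_le_div (hr 1)]
      exact h1
    refine (rtail_le_one F t).trans (h2.trans ?_)
    have := (hr y).le
    gcongr

lemma exists_lintegral_truncated_le (S : Setup F ℓ g α) :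
    ∃ C > 0, ∀ y ≥ 1, ∫⁻ u in Iic y, ENNReal.ofReal (max u 0) ∂F ≤
      ENNReal.ofReal (C * y * rtail F y) := by
  obtain ⟨C, hC, hr⟩ := S.exists_rtail_le (q := 2 / 3) (by linarith [S.le_half])
  refine ⟨3 * C, by linarith, fun y hy => ?_⟩
  have hy0 : 0 < y := by linarith
  have hint : IntegrableOn (fun t : ℝ => t ^ (-(2 / 3) : ℝ)) (Ioc 0 y) := by
    rw [← intervalIntegrable_iff_integrableOn_Ioc_of_le hy0.le]
    exact intervalIntegral.intervalIntegrable_rpow' (by norm_num)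
  rw [lintegral_eq_lintegral_meas_lt (f := fun u : ℝ => max u 0) _ (Eventually.of_forall fun u => le_max_right _ _)
    (by fun_prop)]
  calc ∫⁻ t in Ioi (0:ℝ), (F.restrict (Iic y)) {a | t < max a 0}
      ≤ ∫⁻ t in Ioi (0:ℝ), (Ioc 0 y).indicator (fun t => ENNReal.ofReal
          (C * y ^ (2 / 3 : ℝ) * rtail F y * t ^ (-(2 / 3) : ℝ))) t := by
        refine setLIntegral_mono' measurableSet_Ioi fun t ht => ?_
        have ht0 : 0 < t := ht
        by_cases hty : t ≤ y
        · rw [indicator_of_mem (show t ∈ Ioc 0 y from ⟨ht0, hty⟩)]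
          refine (Measure.restrict_apply_le _ _).trans ?_
          have h1 : {a : ℝ | t < max a 0} = Ioi t := by
            ext a; simp [ht0.not_gt]
          rw [h1, ← ENNReal.ofReal_toReal (measure_ne_top F (Ioi t))]
          refine ENNReal.ofReal_le_ofReal ?_
          refine (hr t y ht0 hty hy).trans (le_of_eq ?_)
          rw [Real.div_rpow hy0.le ht0.le, Real.rpow_neg ht0.le]
          ring
        · rw [Measure.restrict_apply (measurableSet_lt measurable_const (by fun_prop))]
          have : {a : ℝ | t < max a 0} ∩ Iic y = ∅ := by
            ext a
            simp only [mem_inter_iff, mem_ofPred_eq, mem_Iic, mem_empty_iff_false, iff_false, not_and]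
            intro h1 h2
            rcases lt_max_iff.1 h1 with h | h <;> linarith
          rw [this]; simp
    _ = ∫⁻ t in Ioc (0:ℝ) y, ENNReal.ofReal
          (C * y ^ (2 / 3 : ℝ) * rtail F y * t ^ (-(2 / 3) : ℝ)) := by
        rw [setLIntegral_indicator measurableSet_Ioc,
          inter_eq_left.2 (Ioc_subset_Ioi_self)]
    _ = ENNReal.ofReal (C * y ^ (2 / 3 : ℝ) * rtail F y *
          ∫ t in Ioc (0:ℝ) y, t ^ (-(2 / 3) : ℝ)) := by
        rw [← integral_const_mul, ofReal_integral_eq_lintegral_ofReal (hint.const_mul _)]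
        refine (ae_restrict_iff' measurableSet_Ioc).2 (Eventually.of_forall fun t ht => ?_)
        have := ht.1
        have := (rtail_pos S.rightTail y).le
        have : 0 ≤ C := by linarith
        positivity
    _ = ENNReal.ofReal (3 * C * y * rtail F y) := by
        rw [← intervalIntegral.integral_of_le hy0.le, integral_rpow (Or.inl (by norm_num))]
        congr 1
        rw [Real.zero_rpow (by norm_num)]
        have h2 : y ^ (2 / 3 : ℝ) * y ^ (-(2 / 3) + 1 : ℝ) = y := by
          rw [← Real.rpow_add hy0]; norm_num
        calc _ = 3 * C * (y ^ (2 / 3 : ℝ) * y ^ (-(2 / 3) + 1 : ℝ)) * rtail F y := by ring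
          _ = _ := by rw [h2]

/-- A Fuk–Nagaev type bound for sums of variables truncated at `y`. -/
lemma exists_convPow_truncated_Ioi_le (S : Setup F ℓ g α) :
    ∃ C > 0, ∀ y ≥ 1, ∀ n m K : ℕ, 1 ≤ n → m ≤ n → n * rtail F y ≤ 1 →
      convPow (F.restrict (Iic y)) m (Ioi (K * y)) ≤
        ENNReal.ofReal (C * (n * rtail F y) ^ K) := by
  obtain ⟨C, hC, hT⟩ := S.exists_lintegral_truncated_le
  refine ⟨exp C, exp_pos C, fun y hy n m K hn hmn hny => ?_⟩
  have hy0 : 0 < y := by linarith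
  have hry : 0 < rtail F y := rtail_pos S.rightTail y
  have hn0 : (0:ℝ) < n := by exact_mod_cast hn
  set p := n * rtail F y with hp
  have hp0 : 0 < p := by positivity
  set θ := -log p / y with hθ
  have hθ0 : 0 ≤ θ := div_nonneg (neg_nonneg.2 (Real.log_nonpos hp0.le hny)) hy0.le
  have hθy : exp (θ * y) = p⁻¹ := by
    rw [hθ, div_mul_cancel₀ _ hy0.ne', Real.exp_neg, Real.exp_log hp0]
  have h1 : ∫⁻ u in Iic y, ENNReal.ofReal (exp (θ * u)) ∂F ≤ ENNReal.ofReal (exp (C / n)) := by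
    calc ∫⁻ u in Iic y, ENNReal.ofReal (exp (θ * u)) ∂F
        ≤ ∫⁻ u in Iic y, (1 + ENNReal.ofReal (p⁻¹ / y) * ENNReal.ofReal (max u 0)) ∂F := by
          refine setLIntegral_mono' measurableSet_Iic fun u hu => ?_
          rw [← ENNReal.ofReal_mul (by positivity), ← ENNReal.ofReal_one,
            ← ENNReal.ofReal_add zero_le_one (by positivity)]
          refine ENNReal.ofReal_le_ofReal ?_
          rw [← hθy]
          exact exp_mul_le_one_add hθ0 hy0 hu
      _ ≤ 1 + ENNReal.ofReal (p⁻¹ / y) * ENNReal.ofReal (C * y * rtail F y) := by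
          rw [lintegral_add_left measurable_const, lintegral_const_mul _ (by fun_prop)]
          gcongr
          · rw [lintegral_one]
            exact (Measure.restrict_apply_le _ _).trans prob_le_one
          · exact hT y hy
      _ = ENNReal.ofReal (1 + C / n) := by
          rw [← ENNReal.ofReal_mul (by positivity), ← ENNReal.ofReal_one,
            ← ENNReal.ofReal_add zero_le_one (by positivity)]
          congr 2
          rw [hp]
          field_simp
      _ ≤ _ := by
          refine ENNReal.ofReal_le_ofReal ?_
          linarith [Real.add_one_le_exp (C / n)]
  refine (measure_Ioi_le_exp _ hθ0 _).trans ?_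
  rw [lintegral_exp_convPow]
  calc _ ≤ ENNReal.ofReal (exp (-(θ * (K * y)))) * ENNReal.ofReal (exp (C / n)) ^ m := by gcongr
    _ = ENNReal.ofReal (exp (-(θ * (K * y))) * exp (C / n) ^ m) := by
        rw [ENNReal.ofReal_mul (exp_pos _).le, ENNReal.ofReal_pow (exp_pos _).le]
    _ ≤ _ := by
        refine ENNReal.ofReal_le_ofReal ?_
        have h2 : exp (-(θ * (K * y))) = p ^ K := by
          rw [show -(θ * (K * y)) = K * -(θ * y) by ring, Real.exp_nat_mul, Real.exp_neg, hθy, inv_inv]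
        have h3 : exp (C / n) ^ m ≤ exp C := by
          rw [← Real.exp_nat_mul]
          refine Real.exp_le_exp.2 ?_
          have : (m:ℝ) ≤ n := by exact_mod_cast hmn
          calc (m:ℝ) * (C / n) ≤ n * (C / n) := by gcongr
            _ = C := by field_simp
        rw [h2, mul_comm]
        gcongr

end Setup

end

section

/-! ### Local bounds for small indices -/

lemma measure_Ioc_sub (σ : Measure ℝ) (x h u : ℝ) : σ (Ioc (x - u) (x - u + h)) =
    ∫⁻ v, (Ioc x (x + h)).indicator (1 : ℝ → ℝ≥0∞) (u + v) ∂σ := by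
  rw [← lintegral_indicator_one measurableSet_Ioc]
  refine lintegral_congr fun v => ?_
  have : u + v ∈ Ioc x (x + h) ↔ v ∈ Ioc (x - u) (x - u + h) := by
    simp only [mem_Ioc]
    constructor <;> rintro ⟨h1, h2⟩ <;> constructor <;> linarith
  by_cases hv : v ∈ Ioc (x - u) (x - u + h)
  · rw [indicator_of_mem hv, indicator_of_mem (this.2 hv)]; rfl
  · rw [indicator_of_notMem hv, indicator_of_notMem (fun h => hv (this.1 h))]

lemma mconv_apply {μ ν : Measure ℝ} [IsFiniteMeasure ν] (x h : ℝ) :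
    mconv μ ν (Ioc x (x + h)) = ∫⁻ u, ν (Ioc (x - u) (x - u + h)) ∂μ := by
  rw [← lintegral_indicator_one measurableSet_Ioc,
    lintegral_mconv (measurable_one.indicator measurableSet_Ioc)]
  exact lintegral_congr fun u => (measure_Ioc_sub ν x h u).symm

/-- One of the two summands exceeds half of the sum. -/
lemma mconv_Ioc_le_half {μ ν : Measure ℝ} [IsFiniteMeasure μ] [IsFiniteMeasure ν] {A B : ℝ≥0∞}
    {x h : ℝ} (hν : ∀ z, ν (Ioc z (z + h)) ≤ A) (hμ : ∀ z, μ (Ioc z (z + h)) ≤ B) :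
    mconv μ ν (Ioc x (x + h)) ≤ μ (Ioi (x / 2)) * A + ν (Ioi (x / 2)) * B := by
  have key : ∀ (ρ σ : Measure ℝ) [IsFiniteMeasure ρ] [IsFiniteMeasure σ] (D : ℝ≥0∞),
      (∀ z, σ (Ioc z (z + h)) ≤ D) →
      ∫⁻ u in Ioi (x / 2), σ (Ioc (x - u) (x - u + h)) ∂ρ ≤ ρ (Ioi (x / 2)) * D := by
    intro ρ σ _ _ D hD
    calc _ ≤ ∫⁻ u in Ioi (x / 2), D ∂ρ := lintegral_mono fun u => hD _
      _ = _ := by rw [setLIntegral_const, mul_comm]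
  have hsplit : mconv μ ν (Ioc x (x + h)) ≤
      ∫⁻ u in Ioi (x / 2), ν (Ioc (x - u) (x - u + h)) ∂μ +
      ∫⁻ v in Ioi (x / 2), μ (Ioc (x - v) (x - v + h)) ∂ν := by
    have hmeas : Measurable fun z : ℝ × ℝ => (Ioc x (x + h)).indicator (1 : ℝ → ℝ≥0∞) (z.1 + z.2) :=
      (measurable_one.indicator measurableSet_Ioc).comp (by fun_prop)
    rw [mconv_apply, ← lintegral_add_compl _ (measurableSet_Ioi (a := x / 2))]
    gcongr 1
    simp_rw [measure_Ioc_sub _ x h]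
    calc ∫⁻ u in (Ioi (x / 2))ᶜ, ∫⁻ v, (Ioc x (x + h)).indicator 1 (u + v) ∂ν ∂μ
        ≤ ∫⁻ u in (Ioi (x / 2))ᶜ, ∫⁻ v in Ioi (x / 2), (Ioc x (x + h)).indicator 1 (u + v) ∂ν ∂μ := by
          refine setLIntegral_mono' measurableSet_Ioi.compl fun u hu => ?_
          rw [← lintegral_indicator measurableSet_Ioi]
          refine lintegral_mono fun v => ?_
          by_cases hv : v ∈ Ioi (x / 2)
          · rw [indicator_of_mem hv]
          · rw [indicator_of_notMem hv, indicator_of_notMem]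
            simp only [mem_compl_iff, mem_Ioi, not_lt] at hu hv
            exact fun hc => by linarith [hc.1]
      _ ≤ ∫⁻ u, ∫⁻ v in Ioi (x / 2), (Ioc x (x + h)).indicator 1 (u + v) ∂ν ∂μ :=
          setLIntegral_le_lintegral _ _
      _ = ∫⁻ v in Ioi (x / 2), ∫⁻ u, (Ioc x (x + h)).indicator 1 (v + u) ∂μ ∂ν := by
          rw [lintegral_lintegral_swap hmeas.aemeasurable]
          simp_rw [add_comm]
  exact hsplit.trans (add_le_add (key μ ν A hν) (key ν μ B hμ))

lemma measurable_measure_Ioc (μ : Measure ℝ) [IsFiniteMeasure μ] {a b : ℝ → ℝ} (ha : Measurable a)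
    (hb : Measurable b) : Measurable fun w => μ (Ioc (a w) (b w)) := by
  have hs : MeasurableSet {p : ℝ × ℝ | a p.1 < p.2 ∧ p.2 ≤ b p.1} :=
    (measurableSet_lt (ha.comp measurable_fst) measurable_snd).inter
      (measurableSet_le measurable_snd (hb.comp measurable_fst))
  exact measurable_measure_prodMk_left hs

/-- Smoothing of the large summand. -/
lemma mconv_restrict_Ioi_Ioc_le {F ν : Measure ℝ} [IsFiniteMeasure F] [IsFiniteMeasure ν] {h : ℝ}
    (hh : 0 < h) (x y : ℝ) :
    mconv (F.restrict (Ioi y)) ν (Ioc x (x + h)) ≤ ENNReal.ofReal h⁻¹ *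
      ∫⁻ w in Ioi (y - h), F (Ioc w (w + h)) * ν (Ioc (x - w - h) (x - w - h + 2 * h)) := by
  have hmν : Measurable fun w => ν (Ioc (x - w - h) (x - w - h + 2 * h)) :=
    measurable_measure_Ioc ν (by fun_prop) (by fun_prop)
  have hms : MeasurableSet {p : ℝ × ℝ | p.2 < p.1 ∧ p.1 ≤ p.2 + h} :=
    (measurableSet_lt measurable_snd measurable_fst).inter
      (measurableSet_le measurable_fst (by fun_prop))
  have hpt : ∀ u, ENNReal.ofReal h * ν (Ioc (x - u) (x - u + h)) ≤
      ∫⁻ w, {p : ℝ × ℝ | p.2 < p.1 ∧ p.1 ≤ p.2 + h}.indicator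
        (fun p => ν (Ioc (x - p.2 - h) (x - p.2 - h + 2 * h))) (u, w) := by
    intro u
    calc ENNReal.ofReal h * ν (Ioc (x - u) (x - u + h))
        = ∫⁻ w in Ico (u - h) u, ν (Ioc (x - u) (x - u + h)) := by
          rw [setLIntegral_const, Real.volume_Ico, mul_comm]; congr 2; ring
      _ ≤ _ := by
          rw [← lintegral_indicator measurableSet_Ico]
          refine lintegral_mono fun w => ?_
          by_cases hw : w ∈ Ico (u - h) u
          · have : (u, w) ∈ {p : ℝ × ℝ | p.2 < p.1 ∧ p.1 ≤ p.2 + h} :=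
              ⟨hw.2, by linarith [hw.1]⟩
            rw [indicator_of_mem hw, indicator_of_mem this]
            refine measure_mono (Ioc_subset_Ioc ?_ ?_) <;> linarith [hw.1, hw.2]
          · rw [indicator_of_notMem hw]; exact zero_le
  have hfull : ENNReal.ofReal h * mconv (F.restrict (Ioi y)) ν (Ioc x (x + h)) ≤
      ∫⁻ w in Ioi (y - h), F (Ioc w (w + h)) * ν (Ioc (x - w - h) (x - w - h + 2 * h)) := by
    rw [mconv_apply, ← lintegral_const_mul _ (measurable_measure_Ioc ν (by fun_prop) (by fun_prop))]
    refine (lintegral_mono hpt).trans ?_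
    have hΦ : Measurable (Function.uncurry fun u w : ℝ =>
        {p : ℝ × ℝ | p.2 < p.1 ∧ p.1 ≤ p.2 + h}.indicator
          (fun p => ν (Ioc (x - p.2 - h) (x - p.2 - h + 2 * h))) (u, w)) :=
      (hmν.comp measurable_snd).indicator hms
    rw [lintegral_lintegral_swap hΦ.aemeasurable,
      ← lintegral_indicator measurableSet_Ioi]
    refine lintegral_mono fun w => ?_
    have h1 : ∀ u, {p : ℝ × ℝ | p.2 < p.1 ∧ p.1 ≤ p.2 + h}.indicator
        (fun p => ν (Ioc (x - p.2 - h) (x - p.2 - h + 2 * h))) (u, w) =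
        (Ioc w (w + h)).indicator (fun _ => ν (Ioc (x - w - h) (x - w - h + 2 * h))) u := by
      intro u
      by_cases hu : u ∈ Ioc w (w + h)
      · rw [indicator_of_mem hu, indicator_of_mem (show (u, w) ∈ _ from hu)]
      · rw [indicator_of_notMem hu, indicator_of_notMem (show (u, w) ∉ _ from hu)]
    simp_rw [h1]
    rw [lintegral_indicator_const measurableSet_Ioc, mul_comm]
    by_cases hw : w ∈ Ioi (y - h)
    · rw [indicator_of_mem hw]
      gcongr
      exact Measure.restrict_le_self
    · rw [indicator_of_notMem hw, Measure.restrict_apply measurableSet_Ioc]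
      have : Ioc w (w + h) ∩ Ioi y = ∅ := by
        ext a
        simp only [mem_inter_iff, mem_Ioc, mem_Ioi, mem_empty_iff_false, iff_false, not_and, not_lt]
        simp only [mem_Ioi, not_lt] at hw
        intro h2; linarith [h2.2]
      rw [this]; simp
  rw [ENNReal.ofReal_inv_of_pos hh, ← ENNReal.div_eq_inv_mul,
    ENNReal.le_div_iff_mul_le (Or.inl (by simpa using hh)) (Or.inl ENNReal.ofReal_ne_top), mul_comm]
  exact hfull

lemma lintegral_measure_Ioc_le (ν : Measure ℝ) [IsFiniteMeasure ν] (x h : ℝ) :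
    ∫⁻ w, ν (Ioc (x - w - h) (x - w - h + 2 * h)) ≤ ENNReal.ofReal (2 * h) * ν univ := by
  have hms : MeasurableSet {p : ℝ × ℝ | x - p.1 - h < p.2 ∧ p.2 ≤ x - p.1 - h + 2 * h} :=
    (measurableSet_lt (by fun_prop) measurable_snd).inter
      (measurableSet_le measurable_snd (by fun_prop))
  have h1 := Measure.prod_apply (μ := volume) (ν := ν) hms
  have h2 := Measure.prod_apply_symm (μ := volume) (ν := ν) hms
  have h3 : ∫⁻ w, ν (Ioc (x - w - h) (x - w - h + 2 * h)) = (volume.prod ν)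
      {p : ℝ × ℝ | x - p.1 - h < p.2 ∧ p.2 ≤ x - p.1 - h + 2 * h} := h1.symm
  rw [h3, h2, ← lintegral_const]
  refine lintegral_mono fun v => ?_
  have : (fun w : ℝ => (w, v)) ⁻¹' {p : ℝ × ℝ | x - p.1 - h < p.2 ∧ p.2 ≤ x - p.1 - h + 2 * h} ⊆
      Icc (x - h - v) (x - v + h) := by
    intro w hw
    obtain ⟨ha, hb⟩ : x - w - h < v ∧ v ≤ x - w - h + 2 * h := hw
    constructor <;> linarith
  refine (measure_mono this).trans ?_
  rw [Real.volume_Icc]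
  exact ENNReal.ofReal_le_ofReal (by linarith)

end

section

/-- The integral of the excess `(ω - T)⁺` weighted by `F̄(w) / w`. -/
def excess (F : Measure ℝ) (h T y : ℝ) : ℝ≥0∞ :=
  ∫⁻ w in Ioi y, ENNReal.ofReal (max (omegaFn F h w - T) 0 * (rtail F w / w))

lemma measurable_rtail (F : Measure ℝ) [IsFiniteMeasure F] : Measurable (rtail F) :=
  (rtail_antitone F).measurable

lemma measurable_omegaFn (F : Measure ℝ) [IsFiniteMeasure F] (h : ℝ) :
    Measurable (omegaFn F h) :=
  (measurable_id.mul (measurable_measure_Ioc F measurable_id (by fun_prop)).ennreal_toReal).div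
    (measurable_rtail F)

namespace Setup

variable {F : Measure ℝ} [IsProbabilityMeasure F] {ℓ g : ℝ → ℝ} {α : ℝ}

lemma measure_Ioc_le_excess (S : Setup F ℓ g α) (h : ℝ) {T w : ℝ} (hT : 0 ≤ T) (hw : 0 < w) :
    F (Ioc w (w + h)) ≤ ENNReal.ofReal (T * (rtail F w / w)) +
      ENNReal.ofReal (max (omegaFn F h w - T) 0 * (rtail F w / w)) := by
  have hr := rtail_pos S.rightTail w
  rw [← ENNReal.ofReal_add (by positivity) (by positivity),
    ← ENNReal.ofReal_toReal (measure_ne_top F (Ioc w (w + h)))]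
  refine ENNReal.ofReal_le_ofReal ?_
  have h1 : (F (Ioc w (w + h))).toReal = omegaFn F h w * (rtail F w / w) := by
    rw [omegaFn]; field_simp
  rw [h1, ← add_mul]
  gcongr
  linarith [le_max_left (omegaFn F h w - T) 0]

lemma exists_mconv_restrict_Ioi_le (S : Setup F ℓ g α) {h T : ℝ} (hh : 0 < h) (hT : 0 ≤ T) :
    ∃ C > 0, ∀ (n : ℕ) (x y : ℝ), 0 < y → 2 * h ≤ y →
      mconv (F.restrict (Ioi y)) (convPow F n) (Ioc x (x + h)) ≤
        ENNReal.ofReal (C * (rtail F (y / 2) / (y / 2))) +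
        ENNReal.ofReal (C / linv ℓ n) * excess F h T (y / 2) := by
  obtain ⟨A, hA, hA'⟩ := S.exists_convPow_Ioc_le (2 * h)
  refine ⟨max (2 * T) (h⁻¹ * A), lt_max_of_lt_right (by positivity), fun n x y hy hhy => ?_⟩
  have hy2 : 0 < y / 2 := by linarith
  have hr := rtail_pos S.rightTail (y / 2)
  have hb := S.inv.pos (n:ℝ)
  set ν := convPow F n
  have hmν : Measurable fun w => ν (Ioc (x - w - h) (x - w - h + 2 * h)) :=
    measurable_measure_Ioc ν (by fun_prop) (by fun_prop)
  have hme : Measurable fun w => ENNReal.ofReal (max (omegaFn F h w - T) 0 * (rtail F w / w)) :=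
    ((((measurable_omegaFn F h).sub_const T).max measurable_const).mul
      ((measurable_rtail F).div measurable_id)).ennreal_ofReal
  have hνle : ∀ w, ν (Ioc (x - w - h) (x - w - h + 2 * h)) ≤ ENNReal.ofReal (A / linv ℓ n) := by
    intro w
    rw [← ENNReal.ofReal_toReal (measure_ne_top ν _)]
    exact ENNReal.ofReal_le_ofReal (hA' n _)
  calc mconv (F.restrict (Ioi y)) ν (Ioc x (x + h))
      ≤ ENNReal.ofReal h⁻¹ * ∫⁻ w in Ioi (y - h),
        F (Ioc w (w + h)) * ν (Ioc (x - w - h) (x - w - h + 2 * h)) :=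
        mconv_restrict_Ioi_Ioc_le hh x y
    _ ≤ ENNReal.ofReal h⁻¹ * ∫⁻ w in Ioi (y / 2),
        F (Ioc w (w + h)) * ν (Ioc (x - w - h) (x - w - h + 2 * h)) := by
        gcongr
        linarith
    _ ≤ ENNReal.ofReal h⁻¹ * ∫⁻ w in Ioi (y / 2),
        (ENNReal.ofReal (T * (rtail F (y / 2) / (y / 2))) *
            ν (Ioc (x - w - h) (x - w - h + 2 * h)) +
          ENNReal.ofReal (A / linv ℓ n) *
            ENNReal.ofReal (max (omegaFn F h w - T) 0 * (rtail F w / w))) := by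
        gcongr 1
        refine setLIntegral_mono' measurableSet_Ioi fun w hw => ?_
        have hw' : y / 2 < w := hw
        refine (mul_le_mul_left (S.measure_Ioc_le_excess h hT (hy2.trans hw')) _).trans ?_
        rw [add_mul, mul_comm (ENNReal.ofReal (A / linv ℓ n))]
        gcongr
        · exact rtail_antitone F hw'.le
        · exact hνle w
    _ ≤ ENNReal.ofReal h⁻¹ * (ENNReal.ofReal (T * (rtail F (y / 2) / (y / 2))) *
          ENNReal.ofReal (2 * h) + ENNReal.ofReal (A / linv ℓ n) * excess F h T (y / 2)) := by
        gcongr 1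
        rw [lintegral_add_left (hmν.const_mul _), lintegral_const_mul _ hmν,
          lintegral_const_mul _ hme]
        gcongr
        · refine (setLIntegral_le_lintegral _ _).trans ((lintegral_measure_Ioc_le ν x h).trans ?_)
          rw [measure_univ, mul_one]
        · exact le_rfl
    _ = ENNReal.ofReal ((2 * T) * (rtail F (y / 2) / (y / 2))) +
        ENNReal.ofReal ((h⁻¹ * A) / linv ℓ n) * excess F h T (y / 2) := by
        rw [mul_add, ← mul_assoc (ENNReal.ofReal h⁻¹) (ENNReal.ofReal (A / _)),
          ← ENNReal.ofReal_mul (by positivity), ← ENNReal.ofReal_mul (by positivity),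
          ← ENNReal.ofReal_mul (by positivity), mul_div_assoc]
        congr 2
        field_simp
    _ ≤ _ := by
        gcongr
        · exact le_max_left _ _
        · exact le_max_right _ _

lemma exists_convPow_truncated_Ioc_le (S : Setup F ℓ g α) (h : ℝ) {K : ℕ} (hK : 1 ≤ K) :
    ∃ C > 0, ∃ δ > 0, ∀ x ≥ 2 * (K:ℝ), ∀ n : ℕ, 1 ≤ n → n ≤ δ * invTail F x →
      convPow (F.restrict (Iic (x / (2 * K)))) n (Ioc x (x + h)) ≤
        ENNReal.ofReal (C * ((n / invTail F x) ^ K / linv ℓ n)) := by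
  obtain ⟨A, hA, hA'⟩ := S.exists_convPow_Ioc_le h
  obtain ⟨B, hB, hB'⟩ := S.exists_convPow_truncated_Ioi_le
  obtain ⟨D, hD, hD'⟩ := S.exists_rtail_le (q := 2 / 3) (by linarith [S.le_half])
  obtain ⟨E, hE, hE'⟩ := S.inv.exists_le_of_le_two_mul_add_one S.rv S.pos
  have hK0 : (1:ℝ) ≤ K := by exact_mod_cast hK
  set D' := D * (2 * K) ^ (2 / 3 : ℝ) with hD'def
  have hD0 : 0 < D' := by
    have : 0 < D := by linarith
    positivity
  refine ⟨2 * B * D' ^ K * (A * E), by positivity, D'⁻¹, by positivity, fun x hx n hn hnx => ?_⟩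
  have hy : 1 ≤ x / (2 * K) := by rw [le_div_iff₀ (by positivity)]; linarith
  have hx0 : 0 < x := by linarith
  set y := x / (2 * K) with hydef
  have hH := S.rv.pos x
  have hb := S.inv.pos (n:ℝ)
  have hry : rtail F y ≤ D' / invTail F x := by
    have := hD' y x (by linarith) (by rw [hydef]; exact div_le_self hx0.le (by linarith)) (by linarith)
    rw [show x / y = 2 * K by rw [hydef]; field_simp] at this
    rw [invTail, div_inv_eq_mul]
    exact this
  have hn0 : (0:ℝ) < n := by exact_mod_cast hn
  have hnr : n * rtail F y ≤ D' * (n / invTail F x) := by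
    calc n * rtail F y ≤ n * (D' / invTail F x) := by gcongr
      _ = _ := by ring
  have hnr1 : n * rtail F y ≤ 1 := by
    refine hnr.trans ?_
    rw [← mul_div_assoc, div_le_one hH]
    calc D' * n ≤ D' * (D'⁻¹ * invTail F x) := by gcongr
      _ = _ := by field_simp
  have htail : ∀ m ≤ n, convPow (F.restrict (Iic y)) m (Ioi (x / 2)) ≤
      ENNReal.ofReal (B * D' ^ K * (n / invTail F x) ^ K) := by
    intro m hm
    have := hB' y hy n m K hn hm hnr1
    rw [show (K:ℝ) * y = x / 2 by rw [hydef]; field_simp] at this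
    refine this.trans (ENNReal.ofReal_le_ofReal ?_)
    rw [mul_assoc, ← mul_pow]
    have := (rtail_pos S.rightTail y).le
    gcongr
  have hloc : ∀ m : ℕ, n ≤ 2 * m + 1 → ∀ z, convPow (F.restrict (Iic y)) m (Ioc z (z + h)) ≤
      ENNReal.ofReal (A * E / linv ℓ n) := by
    intro m hm z
    refine (convPow_mono Measure.restrict_le_self m _).trans ?_
    rw [← ENNReal.ofReal_toReal (measure_ne_top (convPow F m) _)]
    refine ENNReal.ofReal_le_ofReal ((hA' m z).trans ?_)
    have hbm := S.inv.pos (m:ℝ)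
    have h1 := hE' m n hm
    rw [div_le_div_iff₀ hbm hb]
    nlinarith
  have hnn : n = n / 2 + (n - n / 2) := by omega
  conv_lhs => rw [hnn]
  rw [convPow_add]
  refine (mconv_Ioc_le_half (hloc _ (by omega)) (hloc _ (by omega))).trans ?_
  calc _ ≤ ENNReal.ofReal (B * D' ^ K * (n / invTail F x) ^ K) * ENNReal.ofReal (A * E / linv ℓ n) +
        ENNReal.ofReal (B * D' ^ K * (n / invTail F x) ^ K) * ENNReal.ofReal (A * E / linv ℓ n) := by
        gcongr
        · exact htail _ (by omega)
        · exact htail _ (by omega)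
    _ = _ := by
        rw [← ENNReal.ofReal_mul (by positivity), ← ENNReal.ofReal_add (by positivity) (by positivity)]
        congr 1
        ring

/-- The local bound for indices of order smaller than `1 / F̄(x)`. -/
lemma exists_convPow_Ioc_le_small (S : Setup F ℓ g α) {h T : ℝ} (hh : 0 < h) (hT : 0 ≤ T)
    {K : ℕ} (hK : 1 ≤ K) :
    ∃ C > 0, ∃ δ > 0, ∃ x₀ ≥ 1, ∀ x ≥ x₀, ∀ n : ℕ, 1 ≤ n → n ≤ δ * invTail F x →
      convPow F n (Ioc x (x + h)) ≤
        ENNReal.ofReal (C * ((n / invTail F x) ^ K / linv ℓ n)) +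
        ENNReal.ofReal (C * (n / (x * invTail F x))) +
        ENNReal.ofReal (C * (n / linv ℓ n)) * excess F h T (x / (4 * K)) := by
  obtain ⟨A, hA, δ, hδ, hA'⟩ := S.exists_convPow_truncated_Ioc_le h hK
  obtain ⟨B, hB, hB'⟩ := S.exists_mconv_restrict_Ioi_le hh hT
  obtain ⟨D, hD, hD'⟩ := S.exists_rtail_le (q := 2 / 3) (by linarith [S.le_half])
  obtain ⟨E, hE, hE'⟩ := S.inv.exists_le_of_le_two_mul_add_one S.rv S.pos
  have hK0 : (1:ℝ) ≤ K := by exact_mod_cast hK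
  have hD0 : 0 < D := by linarith
  set D' := D * (4 * K) ^ (2 / 3 : ℝ) with hD'def
  set C := max A (max (B * D' * (4 * K)) (B * E))
  have hCA : A ≤ C := le_max_left _ _
  have hCD : B * D' * (4 * K) ≤ C := (le_max_left _ _).trans (le_max_right _ _)
  have hCE : B * E ≤ C := (le_max_right _ _).trans (le_max_right _ _)
  refine ⟨C, hA.trans_le hCA, δ, hδ, max (4 * K) (4 * K * h), ?_, fun x hx n hn hnx => ?_⟩
  · exact le_trans (by linarith) (le_max_left _ _)
  have hx1 := (le_max_left _ _).trans hx
  have hx2 := (le_max_right _ _).trans hx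
  have hx0 : 0 < x := by linarith
  obtain ⟨n, rfl⟩ : ∃ k, n = k + 1 := ⟨n - 1, by omega⟩
  set y := x / (2 * K) with hy
  have hyh : 2 * h ≤ y := by rw [hy, le_div_iff₀ (by positivity)]; linarith
  have hy2 : y / 2 = x / (4 * K) := by rw [hy]; field_simp; ring
  have hy0 : 0 < y := by positivity
  refine (convPow_succ_le F y n _).trans ?_
  rw [add_assoc]
  have hH := S.rv.pos x
  have hb := S.inv.pos ((n + 1 : ℕ) : ℝ)
  have hbn := S.inv.pos (n : ℝ)
  have hm := hB' n x y hy0 hyh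
  rw [hy2] at hm
  have hx4 : 1 ≤ x / (4 * K) := by rw [le_div_iff₀ (by positivity)]; linarith
  have hrt : rtail F (x / (4 * K)) ≤ D' / invTail F x := by
    have := hD' (x / (4 * K)) x (by linarith) (div_le_self hx0.le (by linarith)) (by linarith)
    rw [show x / (x / (4 * K)) = 4 * K by field_simp] at this
    rw [invTail, div_inv_eq_mul]
    exact this
  gcongr ?_ + ?_
  · refine (hA' x (by linarith) _ hn hnx).trans (ENNReal.ofReal_le_ofReal ?_)
    gcongr
  · refine (mul_le_mul_right hm _).trans ?_
    rw [mul_add, ← mul_assoc, ← ENNReal.ofReal_natCast, ← ENNReal.ofReal_mul (by positivity),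
      ← ENNReal.ofReal_mul (by positivity)]
    gcongr ENNReal.ofReal ?_ + ENNReal.ofReal ?_ * _
    · calc ((n + 1 : ℕ) : ℝ) * (B * (rtail F (x / (4 * K)) / (x / (4 * K))))
          ≤ ((n + 1 : ℕ) : ℝ) * (B * ((D' / invTail F x) / (x / (4 * K)))) := by gcongr
        _ = (B * D' * (4 * K)) * (((n + 1 : ℕ) : ℝ) / (x * invTail F x)) := by field_simp
        _ ≤ _ := by gcongr
    · have h1 := hE' n (n + 1) (by omega)
      calc ((n + 1 : ℕ) : ℝ) * (B / linv ℓ n)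
          ≤ ((n + 1 : ℕ) : ℝ) * (B * E / linv ℓ ((n + 1 : ℕ) : ℝ)) := by
            gcongr 1
            rw [div_le_div_iff₀ hbn hb]
            nlinarith
        _ = (B * E) * (((n + 1 : ℕ) : ℝ) / linv ℓ ((n + 1 : ℕ) : ℝ)) := by ring
        _ ≤ _ := by gcongr

end Setup

end

section

namespace Setup

variable {F : Measure ℝ} [IsProbabilityMeasure F] {ℓ g : ℝ → ℝ} {α : ℝ}

/-- Reduction of the sum over small indices to the excess integral. -/
lemma exists_sum_small_le (S : Setup F ℓ g α) {h T : ℝ} (hh : 0 < h) (hT : 0 ≤ T) :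
    ∃ c > 0, c ≤ 1 ∧ ∃ C > 0, ∃ δ₀ > 0, δ₀ ≤ 1 ∧ ∃ x₀ ≥ 1, ∀ δ > 0, δ ≤ δ₀ → ∀ x ≥ x₀, ∀ N : ℕ, 1 ≤ N →
      excess F h T (c * x) ≠ ⊤ →
      x / invTail F x * ∑ n ∈ Finset.Ico N ⌈δ * invTail F x⌉₊, (convPow F n).real (Ioc x (x + h)) ≤
        C * δ + C * (x / invTail F x * ∑ n ∈ Finset.Ico N ⌈δ * invTail F x⌉₊, n / linv ℓ n) *
          (excess F h T (c * x)).toReal := by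
  have hα := S.pos
  set K : ℕ := ⌈2 / α⌉₊ with hKdef
  have hK2 : 2 / α ≤ K := Nat.le_ceil _
  have hKpos : (0:ℝ) < K := lt_of_lt_of_le (by positivity) hK2
  have hK : 1 ≤ K := by exact_mod_cast hKpos
  have hK1 : (1:ℝ) ≤ K := by exact_mod_cast hK
  have hq : (K:ℝ)⁻¹ < α := by
    rw [inv_lt_comm₀ hKpos hα]
    refine lt_of_lt_of_le ?_ hK2
    rw [← one_div]
    gcongr
    norm_num
  obtain ⟨C, hC, δ₁, hδ₁, x₀, hx₀, hmain⟩ := S.exists_convPow_Ioc_le_small hh hT hK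
  obtain ⟨B, hB, hB'⟩ := S.inv.div_le_of_le S.rv hq (by positivity)
  have hB0 : 0 < B := by linarith
  refine ⟨(4 * K : ℝ)⁻¹, by positivity, inv_le_one_of_one_le₀ (by linarith), C * B ^ K + C,
    by positivity, min δ₁ 1, lt_min hδ₁ one_pos, min_le_right _ _, x₀, hx₀,
    fun δ hδ hδ' x hx N hN hfin => ?_⟩
  have hx1 : 1 ≤ x := le_trans hx₀ hx
  have hx0 : 0 < x := by linarith
  have hH := S.rv.pos x
  set H := invTail F x
  set E := (excess F h T ((4 * K : ℝ)⁻¹ * x)).toReal with hE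
  have hE0 : 0 ≤ E := ENNReal.toReal_nonneg
  have hδ1 : δ ≤ δ₁ := hδ'.trans (min_le_left _ _)
  have hδ2 : δ ≤ 1 := hδ'.trans (min_le_right _ _)
  have hterm : ∀ n ∈ Finset.Ico N ⌈δ * H⌉₊, x / H * (convPow F n).real (Ioc x (x + h)) ≤
      (C * B ^ K + C) / H + C * (x / H * (n / linv ℓ n)) * E := by
    intro n hn
    obtain ⟨hn1, hn2⟩ := Finset.mem_Ico.1 hn
    have hnδ : (n:ℝ) < δ * H := Nat.lt_ceil.1 hn2
    have hnn : 1 ≤ n := hN.trans hn1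
    have hn1' : (1:ℝ) ≤ n := by exact_mod_cast hnn
    have hb := S.inv.pos (n:ℝ)
    have hnH : (n:ℝ) ≤ H := by nlinarith
    have h1 := hmain x hx n hnn (hnδ.le.trans (by gcongr))
    have h2 : (convPow F n).real (Ioc x (x + h)) ≤ C * ((n / H) ^ K / linv ℓ n) +
        C * (n / (x * H)) + C * (n / linv ℓ n) * E := by
      have h3 : x / (4 * K) = (4 * K : ℝ)⁻¹ * x := by ring
      rw [h3, ← ENNReal.ofReal_toReal hfin, ← ENNReal.ofReal_mul (by positivity),
        ← ENNReal.ofReal_add (by positivity) (by positivity),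
        ← ENNReal.ofReal_add (by positivity) (by positivity)] at h1
      exact ENNReal.toReal_le_of_le_ofReal (by positivity) h1
    have h4 : x / linv ℓ n ≤ (B * (H / n)) ^ K := by
      have h5 := hB' x n hx1 hn1' hnH
      have h6 := pow_le_pow_left₀ (by positivity) h5 K
      rwa [← Real.rpow_natCast, ← Real.rpow_mul (by positivity), inv_mul_cancel₀ hKpos.ne',
        Real.rpow_one] at h6
    have h7 : (n / H) ^ K * (H / n) ^ K = 1 := by
      rw [← mul_pow]
      rw [show (n:ℝ) / H * (H / n) = 1 by field_simp, one_pow]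
    calc x / H * (convPow F n).real (Ioc x (x + h))
        ≤ x / H * (C * ((n / H) ^ K / linv ℓ n) +
        C * (n / (x * H)) + C * (n / linv ℓ n) * E) := by gcongr
      _ = C / H * ((n / H) ^ K * (x / linv ℓ n)) + C / H * (n / H) +
          C * (x / H * (n / linv ℓ n)) * E := by field_simp
      _ ≤ C / H * ((n / H) ^ K * (B * (H / n)) ^ K) + C / H * 1 +
          C * (x / H * (n / linv ℓ n)) * E := by
          gcongr
          rw [div_le_one hH]; exact hnH
      _ = _ := by
          rw [mul_pow, mul_left_comm (((n:ℝ) / H) ^ K) (B ^ K), h7]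
          ring
  have hcard : ((Finset.Ico N ⌈δ * H⌉₊).card : ℝ) ≤ δ * H := by
    rw [Nat.card_Ico]
    rcases Nat.eq_zero_or_pos (⌈δ * H⌉₊ - N) with h0 | h0
    · rw [h0, Nat.cast_zero]; positivity
    · refine (Nat.lt_ceil.1 ?_).le
      omega
  rw [Finset.mul_sum]
  refine (Finset.sum_le_sum hterm).trans ?_
  rw [Finset.sum_add_distrib, Finset.sum_const, nsmul_eq_mul, ← Finset.sum_mul, ← Finset.mul_sum,
    ← Finset.mul_sum]
  gcongr ?_ + ?_
  · calc _ ≤ δ * H * ((C * B ^ K + C) / H) := by gcongr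
      _ = _ := by field_simp
  · gcongr
    have := S.inv.pos
    · exact mul_nonneg (by positivity) (Finset.sum_nonneg fun n _ =>
        div_nonneg n.cast_nonneg (this _).le)
    · have : 0 < C * B ^ K := by positivity
      linarith

end Setup

end

section

/-! ### Bounds for the excess integral -/

namespace Setup

variable {F : Measure ℝ} [IsProbabilityMeasure F] {ℓ g : ℝ → ℝ} {α : ℝ}

lemma omegaFn_le (S : Setup F ℓ g α) (h : ℝ) {w z : ℝ} (hw : 0 ≤ w) (hwz : w ≤ z) :
    omegaFn F h w ≤ z * invTail F z := by
  have h1 : (F (Ioc w (w + h))).toReal ≤ 1 := measureReal_le_one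
  have hH := S.rv.pos w
  have h2 : omegaFn F h w = w * (F (Ioc w (w + h))).toReal * invTail F w := by
    rw [omegaFn, invTail, div_eq_mul_inv]
  rw [h2]
  calc w * (F (Ioc w (w + h))).toReal * invTail F w ≤ w * 1 * invTail F w := by gcongr
    _ ≤ z * invTail F z := by
      rw [mul_one]
      exact mul_le_mul hwz (S.rv.mono hwz) hH.le (hw.trans hwz)

lemma integrableOn_omega (S : Setup F ℓ g α) (h : ℝ) {T a z : ℝ} (hT : 0 ≤ T) (ha : 0 ≤ a) :
    IntegrableOn (fun w => max (omegaFn F h w - T) 0) (Ioc a z) := by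
  rcases lt_or_ge z a with hza | hza
  · rw [Ioc_eq_empty (by linarith)]; exact integrableOn_empty
  have hm : Measurable fun w => max (omegaFn F h w - T) 0 :=
    ((measurable_omegaFn F h).sub_const T).max measurable_const
  refine Measure.integrableOn_of_bounded (M := z * invTail F z) (by simp) hm.aestronglyMeasurable ?_
  refine (ae_restrict_iff' measurableSet_Ioc).2 (Eventually.of_forall fun w hw => ?_)
  have hw0 : 0 ≤ w := ha.trans hw.1.le
  rw [Real.norm_of_nonneg (le_max_right _ _)]
  have := S.rv.pos z
  refine max_le ?_ (mul_nonneg (ha.trans hza) this.le)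
  linarith [S.omegaFn_le h hw0 hw.2]

lemma setLIntegral_omega_le (S : Setup F ℓ g α) (h : ℝ) {T η a z : ℝ} (hT : 0 ≤ T) (hη : η ≤ 1)
    (ha : (1 - η) * z ≤ a) (hz : 0 ≤ z) (haz : a ≤ z) :
    ∫⁻ w in Ioc a z, ENNReal.ofReal (max (omegaFn F h w - T) 0) ≤
      ENNReal.ofReal (Iof F h η z T) := by
  have h0 : 0 ≤ (1 - η) * z := mul_nonneg (by linarith) hz
  rw [Iof, intervalIntegral.integral_of_le (ha.trans haz),
    ofReal_integral_eq_lintegral_ofReal (S.integrableOn_omega h hT h0)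
      (Eventually.of_forall fun w => le_max_right _ _)]
  exact lintegral_mono_set (Ioc_subset_Ioc_left ha)

/-- Decomposition of the excess integral over geometric windows. -/
lemma excess_le_tsum (S : Setup F ℓ g α) (h : ℝ) {T η r y : ℝ} (hT : 0 ≤ T) (hη1 : η ≤ 1)
    (hr : 1 < r) (hηr : (1 - η) * r ≤ 1) (hy : 0 < y) :
    excess F h T y ≤ ∑' j : ℕ, ENNReal.ofReal
      (rtail F (r ^ j * y) / (r ^ j * y) * Iof F h η (r ^ (j + 1) * y) T) := by
  have hr0 : 0 < r := by linarith
  have hcover : Ioi y ⊆ ⋃ j : ℕ, Ioc (r ^ j * y) (r ^ (j + 1) * y) := by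
    intro w hw
    have hw1 : 1 < w / y := by rw [lt_div_iff₀ hy]; simpa using hw
    obtain ⟨k, hk1, hk2⟩ := exists_mem_Ioc_zpow (one_pos.trans hw1) hr
    have hk : 0 ≤ k := by
      have := (one_lt_zpow_iff_right₀ hr).1 (hw1.trans_le hk2)
      omega
    lift k to ℕ using hk with j
    have hj1 : r ^ j < w / y := by simpa using hk1
    have hj2 : w / y ≤ r ^ (j + 1) := by exact_mod_cast hk2
    refine mem_iUnion.2 ⟨j, ?_, ?_⟩
    · rwa [lt_div_iff₀ hy] at hj1
    · rwa [div_le_iff₀ hy] at hj2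
  calc excess F h T y ≤ ∫⁻ w in ⋃ j : ℕ, Ioc (r ^ j * y) (r ^ (j + 1) * y),
        ENNReal.ofReal (max (omegaFn F h w - T) 0 * (rtail F w / w)) := lintegral_mono_set hcover
    _ ≤ ∑' j : ℕ, ∫⁻ w in Ioc (r ^ j * y) (r ^ (j + 1) * y),
        ENNReal.ofReal (max (omegaFn F h w - T) 0 * (rtail F w / w)) := lintegral_iUnion_le _ _
    _ ≤ _ := by
        refine ENNReal.tsum_le_tsum fun j => ?_
        have hz : 0 < r ^ j * y := by positivity
        have hrt := rtail_pos S.rightTail (r ^ j * y)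
        calc _ ≤ ∫⁻ w in Ioc (r ^ j * y) (r ^ (j + 1) * y),
              ENNReal.ofReal (rtail F (r ^ j * y) / (r ^ j * y)) *
                ENNReal.ofReal (max (omegaFn F h w - T) 0) := by
              refine setLIntegral_mono' measurableSet_Ioc fun w hw => ?_
              rw [mul_comm, ENNReal.ofReal_mul (div_nonneg (rtail_pos S.rightTail w).le
                (hz.trans hw.1).le)]
              gcongr
              · exact rtail_antitone F hw.1.le
              · exact hw.1.le
          _ ≤ _ := by
              rw [lintegral_const_mul _ (((measurable_omegaFn F h).sub_const T).max
                measurable_const).ennreal_ofReal, ENNReal.ofReal_mul (by positivity)]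
              gcongr
              refine S.setLIntegral_omega_le h hT hη1 ?_ (by positivity) ?_
              · rw [pow_succ]
                calc (1 - η) * (r ^ j * r * y) = (1 - η) * r * (r ^ j * y) := by ring
                  _ ≤ 1 * (r ^ j * y) := by gcongr
                  _ = _ := one_mul _
              · gcongr
                · exact hr.le
                · omega

lemma exists_excess_le (S : Setup F ℓ g α) (h : ℝ) {T η r q θ : ℝ} (hT : 0 ≤ T) (hη1 : η ≤ 1)
    (hr : 1 < r) (hηr : (1 - η) * r ≤ 1) (hq : α < q) (hqθ : q + θ < 1) :
    ∃ C > 0, ∀ A ≥ 0, ∀ y ≥ 1,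
      (∀ j : ℕ, Iof F h η (r ^ (j + 1) * y) T ≤
        A * (r ^ θ) ^ j * invTail F (r ^ (j + 1) * y) ^ 2) →
      excess F h T y ≤ ENNReal.ofReal (C * A * (invTail F y / y)) := by
  have hq0 : 0 < q := S.pos.trans hq
  have hr0 : 0 < r := by linarith
  obtain ⟨B, hB, hB'⟩ := S.rv.potter_upper hq hq0.le
  have hB0 : 0 < B := by linarith
  set ρ := r ^ (q + θ - 1) with hρ
  have hρ0 : 0 < ρ := Real.rpow_pos_of_pos hr0 _
  have hρ1 : ρ < 1 := Real.rpow_lt_one_of_one_lt_of_neg hr (by linarith)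
  have h1ρ : 0 < 1 - ρ := by linarith
  refine ⟨B * (B * r ^ q) ^ 2 * (1 - ρ)⁻¹, by positivity, fun A hA y hy hI => ?_⟩
  have hy0 : 0 < y := by linarith
  have hH := S.rv.pos
  have hterm : ∀ j : ℕ, rtail F (r ^ j * y) / (r ^ j * y) * Iof F h η (r ^ (j + 1) * y) T ≤
      B * (B * r ^ q) ^ 2 * A * (invTail F y / y) * ρ ^ j := by
    intro j
    have hpow : (1:ℝ) ≤ r ^ j := one_le_pow₀ hr.le
    set z := r ^ j * y with hz
    have hzy : y ≤ z := by nlinarith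
    have hz1 : 1 ≤ z := hy.trans hzy
    have hz0 : 0 < z := by linarith
    have hz' : r ^ (j + 1) * y = r * z := by rw [pow_succ, hz]; ring
    have h1 : invTail F (r * z) ≤ B * r ^ q * invTail F z := by
      have := hB' z (r * z) hz1 (by nlinarith)
      rwa [mul_div_cancel_right₀ _ hz0.ne'] at this
    have h2 : invTail F z ≤ B * (r ^ q) ^ j * invTail F y := by
      have := hB' y z hy hzy
      rwa [hz, mul_div_cancel_right₀ _ hy0.ne', ← Real.rpow_natCast r, ← Real.rpow_mul hr0.le,
        mul_comm (j:ℝ), Real.rpow_mul hr0.le, Real.rpow_natCast, Real.rpow_natCast] at this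
    have h3 := hI j
    rw [hz'] at h3 ⊢
    have hrt : rtail F z = (invTail F z)⁻¹ := by rw [invTail, inv_inv]
    have hHz := hH z
    have hHy := hH y
    have hHrz := hH (r * z)
    have hρj : ρ ^ j = (r ^ θ) ^ j * (r ^ q) ^ j / r ^ j := by
      rw [hρ, Real.rpow_sub_one hr0.ne', Real.rpow_add hr0, div_pow, mul_pow]
      ring
    rw [hrt, hρj]
    calc (invTail F z)⁻¹ / z * Iof F h η (r * z) T
        ≤ (invTail F z)⁻¹ / z * (A * (r ^ θ) ^ j * invTail F (r * z) ^ 2) := by gcongr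
      _ ≤ (invTail F z)⁻¹ / z * (A * (r ^ θ) ^ j * (B * r ^ q * invTail F z) ^ 2) := by gcongr
      _ = (B * r ^ q) ^ 2 * A * (r ^ θ) ^ j / z * invTail F z := by field_simp
      _ ≤ (B * r ^ q) ^ 2 * A * (r ^ θ) ^ j / z * (B * (r ^ q) ^ j * invTail F y) := by gcongr
      _ = _ := by rw [hz]; field_simp
  calc excess F h T y ≤ ∑' j : ℕ, ENNReal.ofReal
        (rtail F (r ^ j * y) / (r ^ j * y) * Iof F h η (r ^ (j + 1) * y) T) :=
        S.excess_le_tsum h hT hη1 hr hηr hy0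
    _ ≤ ∑' j : ℕ, ENNReal.ofReal (B * (B * r ^ q) ^ 2 * A * (invTail F y / y) * ρ ^ j) :=
        ENNReal.tsum_le_tsum fun j => ENNReal.ofReal_le_ofReal (hterm j)
    _ = ENNReal.ofReal (∑' j : ℕ, B * (B * r ^ q) ^ 2 * A * (invTail F y / y) * ρ ^ j) := by
        rw [ENNReal.ofReal_tsum_of_nonneg]
        · intro j
          have := hH y
          positivity
        · exact (summable_geometric_of_lt_one hρ0.le hρ1).mul_left _
    _ = _ := by
        rw [tsum_mul_left, tsum_geometric_of_lt_one hρ0.le hρ1]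
        congr 1
        ring

end Setup

end

section

/-! ### Exponents below one half -/

lemma RegVary.le_of_tendsto_div {L ℓ : ℝ → ℝ} {β α : ℝ} (hL : RegVary L β) (hℓ : RegVary ℓ α)
    (h : Tendsto (fun x => L x / ℓ x) atTop (𝓝 0)) : β ≤ α := by
  by_contra! hlt
  have h1 : Tendsto (fun x => (L (2 * x) / L x) / (ℓ (2 * x) / ℓ x)) atTop
      (𝓝 (2 ^ β / 2 ^ α)) := (hL.2 2 two_pos).div (hℓ.2 2 two_pos) (by positivity)
  have h2 : (1:ℝ) < 2 ^ β / 2 ^ α := by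
    rw [one_lt_div (by positivity)]
    exact Real.rpow_lt_rpow_of_exponent_lt one_lt_two hlt
  obtain ⟨x₀, hx₀⟩ := eventually_atTop.1 (h1.eventually (lt_mem_nhds h2))
  set x₁ := max x₀ 1
  have hx₁ : 0 < x₁ := one_pos.trans_le (le_max_right _ _)
  have hstep : ∀ x ≥ x₁, L x / ℓ x ≤ L (2 * x) / ℓ (2 * x) := by
    intro x hx
    have hx0 : 0 < x := hx₁.trans_le hx
    have := hx₀ x ((le_max_left _ _).trans hx)
    have a1 := hL.1 x hx0
    have a2 := hL.1 (2 * x) (by positivity)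
    have a3 := hℓ.1 x hx0
    have a4 := hℓ.1 (2 * x) (by positivity)
    rw [div_div_div_eq, one_lt_div (by positivity)] at this
    rw [div_le_div_iff₀ a3 a4]
    linarith
  have hiter : ∀ j : ℕ, L x₁ / ℓ x₁ ≤ L (2 ^ j * x₁) / ℓ (2 ^ j * x₁) := by
    intro j
    induction j with
    | zero => simp
    | succ j ih =>
      refine ih.trans ?_
      have := hstep (2 ^ j * x₁) (le_mul_of_one_le_left hx₁.le (one_le_pow₀ one_le_two))
      rwa [← mul_assoc, ← pow_succ'] at this
  have hlim : Tendsto (fun j : ℕ => L (2 ^ j * x₁) / ℓ (2 ^ j * x₁)) atTop (𝓝 0) :=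
    h.comp ((tendsto_pow_atTop_atTop_of_one_lt one_lt_two).atTop_mul_const hx₁)
  have := ge_of_tendsto' hlim hiter
  exact this.not_gt (div_pos (hL.1 _ hx₁) (hℓ.1 _ hx₁))

lemma RegVary.exists_pow_le {L : ℝ → ℝ} {β q r : ℝ} (hL : RegVary L β) (hq : β < q) (hr : 1 < r) :
    ∃ x₀ > 0, ∀ z ≥ x₀, ∀ j : ℕ, L (r ^ j * z) ≤ (r ^ q) ^ j * L z := by
  have hr0 : 0 < r := by linarith
  obtain ⟨x₀, hx₀⟩ := eventually_atTop.1 ((hL.2 r hr0).eventually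
    (gt_mem_nhds (Real.rpow_lt_rpow_of_exponent_lt hr hq)))
  refine ⟨max x₀ 1, one_pos.trans_le (le_max_right _ _), fun z hz j => ?_⟩
  have hz0 : 0 < z := one_pos.trans_le ((le_max_right _ _).trans hz)
  induction j with
  | zero => simp
  | succ j ih =>
    have hzj : z ≤ r ^ j * z := le_mul_of_one_le_left hz0.le (one_le_pow₀ hr.le)
    have h1 := hx₀ (r ^ j * z) (((le_max_left _ _).trans hz).trans hzj)
    rw [div_lt_iff₀ (hL.1 _ (hz0.trans_le hzj)), ← mul_assoc, ← pow_succ'] at h1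
    refine h1.le.trans ?_
    rw [pow_succ', mul_assoc]
    gcongr

namespace AsympInv

variable {H b : ℝ → ℝ} {α : ℝ}

lemma exists_sum_div_le (hH : MonoRV H α) (hb : AsympInv H b) (hα : 0 < α) (hα2 : α < 1 / 2) :
    ∃ C > 0, ∀ X ≥ 1, ∀ M : ℕ, ∑ n ∈ Finset.Ico ⌈X⌉₊ M, (n:ℝ) / b n ≤ C * (X ^ 2 / b X) := by
  set q := (α + 1 / 2) / 2 with hq
  have hq0 : 0 < q := by rw [hq]; linarith
  have hq2 : q < 1 / 2 := by rw [hq]; linarith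
  have hqi : 2 < 1 / q := by rw [lt_div_iff₀ hq0]; linarith
  obtain ⟨B, hB, hB'⟩ := hb.le_ratio hH (q := q) (by rw [hq]; linarith) hq0.le
  have hB0 : 0 < B := by linarith
  obtain ⟨D, hD, hD'⟩ := sum_Ico_rpow_neg_le (p := 1 / q - 1) (by linarith)
  refine ⟨B ^ (1 / q) * (D + 1), by positivity, fun X hX M => ?_⟩
  have hX0 : 0 < X := by linarith
  have hbX := hb.pos X
  have hterm : ∀ n ∈ Finset.Ico ⌈X⌉₊ M, (n:ℝ) / b n ≤
      B ^ (1 / q) * X ^ (1 / q) / b X * (n:ℝ) ^ (-(1 / q - 1)) := by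
    intro n hn
    have hXn : X ≤ n := (Nat.le_ceil X).trans (by exact_mod_cast (Finset.mem_Ico.1 hn).1)
    have hn0 : (0:ℝ) < n := hX0.trans_le hXn
    have hbn := hb.pos (n:ℝ)
    have h1 := hB' X n hX hXn
    have h2 := Real.rpow_le_rpow (by positivity) h1 (by positivity : 0 ≤ 1 / q)
    rw [Real.mul_rpow hB0.le (by positivity), ← Real.rpow_mul (by positivity),
      mul_one_div_cancel hq0.ne', Real.rpow_one, Real.div_rpow hn0.le hX0.le] at h2
    have hXq := Real.rpow_pos_of_pos hX0 (1 / q)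
    have hnq := Real.rpow_pos_of_pos hn0 (1 / q)
    have h3 : 1 / b n ≤ B ^ (1 / q) * X ^ (1 / q) / b X / (n:ℝ) ^ (1 / q) := by
      rw [div_div, div_le_div_iff₀ hbn (by positivity), one_mul]
      rw [div_le_iff₀ hXq] at h2
      calc b X * (n:ℝ) ^ (1 / q) ≤ b X * (B ^ (1 / q) * (b n / b X) * X ^ (1 / q)) := by gcongr
        _ = _ := by field_simp
    calc (n:ℝ) / b n = n * (1 / b n) := by ring
      _ ≤ n * (B ^ (1 / q) * X ^ (1 / q) / b X / (n:ℝ) ^ (1 / q)) := by gcongr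
      _ = _ := by
        rw [show -(1 / q - 1) = 1 - 1 / q by ring, Real.rpow_sub hn0, Real.rpow_one]
        ring
  calc _ ≤ ∑ n ∈ Finset.Ico ⌈X⌉₊ M, B ^ (1 / q) * X ^ (1 / q) / b X * (n:ℝ) ^ (-(1 / q - 1)) :=
        Finset.sum_le_sum hterm
    _ ≤ B ^ (1 / q) * X ^ (1 / q) / b X * (D * X ^ (1 - (1 / q - 1))) := by
        rw [← Finset.mul_sum]
        gcongr
        exact hD' X M hX
    _ = B ^ (1 / q) * D * (X ^ 2 / b X) := by
        rw [show 1 - (1 / q - 1) = 2 - 1 / q by ring, Real.rpow_sub hX0]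
        have := Real.rpow_pos_of_pos hX0 (1 / q)
        rw [Real.rpow_two]
        field_simp
    _ ≤ _ := by gcongr; linarith

lemma exists_div_sq_le (hH : MonoRV H α) (hb : AsympInv H b) (hα : 0 < α) (hα2 : α < 1 / 2)
    {q : ℝ} (hq0 : 0 < q) (hq : q < α) :
    ∃ C > 0, ∀ κ ≥ 1, ∀ y ≥ 1, ∀ y' ≥ 1, y' ≤ κ * y →
      b y' / y' ^ 2 ≤ C * κ ^ (1 / q - 2) * (b y / y ^ 2) := by
  obtain ⟨A, hA, hA'⟩ := hb.ratio_le hH hq hq0.le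
  set p := (α + 1 / 2) / 2 with hp
  have hp0 : 0 < p := by rw [hp]; linarith
  have hp2 : p < 1 / 2 := by rw [hp]; linarith
  obtain ⟨B, hB, hB'⟩ := hb.le_ratio hH (q := p) (by rw [hp]; linarith) hp0.le
  have hA0 : 0 < A := by linarith
  have hB0 : 0 < B := by linarith
  have hqi : 2 < 1 / q := by rw [lt_div_iff₀ hq0]; linarith
  have hpi : 2 < 1 / p := by rw [lt_div_iff₀ hp0]; linarith
  refine ⟨max (A ^ (1 / q)) (B ^ (1 / p)), lt_max_of_lt_left (by positivity),
    fun κ hκ y hy y' hy' hyy => ?_⟩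
  have hy0 : 0 < y := by linarith
  have hy0' : 0 < y' := by linarith
  have hby := hb.pos y
  have hby' := hb.pos y'
  have hκ0 : 0 < κ := by linarith
  have hκ1 : 1 ≤ κ ^ (1 / q - 2) := Real.one_le_rpow hκ (by linarith)
  have key : ∀ s D : ℝ, 2 < s → 0 < D → b y' / b y ≤ D * (y' / y) ^ s →
      b y' / y' ^ 2 ≤ D * (y' / y) ^ (s - 2) * (b y / y ^ 2) := by
    intro s D hs hD h
    rw [div_le_iff₀ hby] at h
    rw [Real.rpow_sub (by positivity), Real.rpow_two, div_le_iff₀ (by positivity)]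
    refine h.trans (le_of_eq ?_)
    field_simp
  rcases le_or_gt y y' with hle | hlt
  · have h1 := Real.rpow_le_rpow (by positivity) (hA' y y' hy hle) (by positivity : 0 ≤ 1 / q)
    rw [← Real.rpow_mul (by positivity), mul_one_div_cancel hq0.ne', Real.rpow_one,
      Real.mul_rpow hA0.le (by positivity)] at h1
    refine (key _ _ hqi (by positivity) h1).trans ?_
    gcongr
    · exact le_max_left _ _
    · rwa [div_le_iff₀ hy0]
  · have h1 := Real.rpow_le_rpow (by positivity) (hB' y' y hy' hlt.le) (by positivity : 0 ≤ 1 / p)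
    rw [Real.mul_rpow hB0.le (by positivity), ← Real.rpow_mul (by positivity),
      mul_one_div_cancel hp0.ne', Real.rpow_one] at h1
    have h2 : b y' / b y ≤ B ^ (1 / p) * (y' / y) ^ (1 / p) := by
      rw [Real.div_rpow hy0.le hy0'.le] at h1
      rw [Real.div_rpow hy0'.le hy0.le]
      have a1 := Real.rpow_pos_of_pos hy0 (1 / p)
      have a2 := Real.rpow_pos_of_pos hy0' (1 / p)
      rw [div_le_iff₀ a2, mul_div_assoc', div_mul_eq_mul_div, le_div_iff₀ hby'] at h1
      rw [mul_div_assoc', div_le_div_iff₀ hby a1]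
      linarith
    refine (key _ _ hpi (by positivity) h2).trans ?_
    gcongr ?_ * _
    calc B ^ (1 / p) * (y' / y) ^ (1 / p - 2) ≤ B ^ (1 / p) * 1 := by
          gcongr
          exact Real.rpow_le_one (by positivity) ((div_le_one hy0).2 hlt.le) (by linarith)
      _ ≤ max (A ^ (1 / q)) (B ^ (1 / p)) * κ ^ (1 / q - 2) := by
          gcongr
          exact le_max_right _ _

end AsympInv

end

section

namespace Setup

variable {F : Measure ℝ} [IsProbabilityMeasure F] {ℓ g : ℝ → ℝ} {α : ℝ}

lemma eventually_le_two_mul (S : Setup F ℓ g α) : ∀ᶠ x in atTop, ℓ x ≤ 2 * invTail F x := by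
  filter_upwards [S.tendsto_ratio.eventually (gt_mem_nhds one_lt_two)] with x hx
  exact ((div_lt_iff₀ (S.rv.pos x)).1 hx).le

lemma eventually_le_two_mul' (S : Setup F ℓ g α) : ∀ᶠ x in atTop, invTail F x ≤ 2 * ℓ x := by
  filter_upwards [S.tendsto_ratio.eventually (lt_mem_nhds (show (1 / 2 : ℝ) < 1 by norm_num))]
    with x hx
  linarith [(lt_div_iff₀ (S.rv.pos x)).1 hx]

lemma sum_div_linv_nonneg (S : Setup F ℓ g α) (N M : ℕ) :
    0 ≤ ∑ n ∈ Finset.Ico N M, (n:ℝ) / linv ℓ n :=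
  Finset.sum_nonneg fun n _ => div_nonneg n.cast_nonneg (S.inv.pos _).le

lemma eventually_excess_small_of_lt_half (S : Setup F ℓ g α) (hα2 : α < 1 / 2) {h T η c : ℝ}
    (hT : 0 ≤ T) (hη : η ∈ Ioc (0:ℝ) 1) (hc : 0 < c) (hc1 : c ≤ 1) {L : ℝ → ℝ}
    (hL : RegVaryAny L) (hL1 : ∀ x, 1 ≤ L x) (hLℓ : Tendsto (fun x => L x / ℓ x) atTop (𝓝 0))
    (hI : (fun x => Iof F h η x T) =o[atTop] fun x => ℓ x ^ 2 * linv ℓ (L x) / L x ^ 2)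
    {ε : ℝ} (hε : 0 < ε) : ∀ᶠ x in atTop, excess F h T (c * x) ≠ ⊤ ∧ ∀ M : ℕ,
      (x / invTail F x * ∑ n ∈ Finset.Ico ⌈L x⌉₊ M, n / linv ℓ n) *
        (excess F h T (c * x)).toReal ≤ ε := by
  obtain ⟨β, hβ⟩ := hL
  have hβα : β ≤ α := hβ.le_of_tendsto_div S.regVary hLℓ
  have hα := S.pos
  obtain ⟨hη0, hη1⟩ := hη
  set r := (1 - η / 2)⁻¹ with hr
  have hr1 : 1 < r := by
    rw [hr, one_lt_inv₀ (by linarith)]; linarith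
  have hr0 : 0 < r := by linarith
  have hηr : (1 - η) * r ≤ 1 := by
    rw [hr, mul_inv_le_iff₀ (by linarith)]; linarith
  set e := α ^ 2 / 4 with he
  have he0 : 0 < e := by positivity
  have heα : e < α := by rw [he]; nlinarith
  set q := α - e with hq
  set q' := α + e with hq'
  have hq0 : 0 < q := by rw [hq]; linarith
  have hqi : 2 < 1 / q := by rw [lt_div_iff₀ hq0]; linarith
  set θ := q' * (1 / q - 2) with hθ
  have hqθ : q' + θ < 1 := by
    have h1 : q' + θ = q' * (1 - q) / q := by rw [hθ]; field_simp; ring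
    rw [h1, div_lt_one hq0, hq, hq']
    have h2 : 0 < α ^ 2 := by positivity
    have h3 : α ^ 2 < 1 := by nlinarith
    nlinarith
  obtain ⟨C₁, hC₁, hE⟩ := S.exists_excess_le h hT hη1 hr1 hηr (q := q') (θ := θ)
    (by rw [hq']; linarith) hqθ
  obtain ⟨C₂, hC₂, hsum⟩ := S.inv.exists_sum_div_le S.rv hα hα2
  obtain ⟨C₃, hC₃, hD⟩ := S.inv.exists_div_sq_le S.rv hα hα2 hq0 (by rw [hq]; linarith)
  obtain ⟨x₁, hx₁, hpow⟩ := hβ.exists_pow_le (q := q') (by rw [hq']; linarith) hr1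
  set κ := (c ^ β + 1) * r ^ q' with hκ
  have hcβ : 0 < c ^ β := Real.rpow_pos_of_pos hc β
  have hrq : 1 ≤ r ^ q' := Real.one_le_rpow hr1.le (by rw [hq']; linarith)
  have hκ1 : 1 ≤ κ := by rw [hκ]; nlinarith
  set P := C₂ * (C₁ * (4 * C₃ * κ ^ (1 / q - 2)) * c⁻¹) with hP
  have hP0 : 0 < P := by positivity
  set ε' := ε / P with hε'
  have hε'0 : 0 < ε' := by positivity
  have hIε : ∀ᶠ z in atTop, Iof F h η z T ≤
      4 * ε' * invTail F z ^ 2 * (linv ℓ (L z) / L z ^ 2) := by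
    filter_upwards [hI.def hε'0, S.eventually_le_two_mul, eventually_gt_atTop 0] with z hz hz2 hz0
    have hb := S.inv.pos (L z)
    have hLz := one_pos.trans_le (hL1 z)
    have hℓz := S.regVary.1 z hz0
    rw [Real.norm_of_nonneg (by positivity : 0 ≤ ℓ z ^ 2 * linv ℓ (L z) / L z ^ 2)] at hz
    calc Iof F h η z T ≤ ε' * (ℓ z ^ 2 * linv ℓ (L z) / L z ^ 2) := (le_abs_self _).trans hz
      _ ≤ ε' * ((2 * invTail F z) ^ 2 * linv ℓ (L z) / L z ^ 2) := by gcongr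
      _ = _ := by ring
  obtain ⟨x₂, hx₂⟩ := eventually_atTop.1 hIε
  have hcx : Tendsto (fun x : ℝ => c * x) atTop atTop := tendsto_id.const_mul_atTop hc
  filter_upwards [hcx.eventually_ge_atTop x₁, hcx.eventually_ge_atTop x₂, hcx.eventually_ge_atTop 1,
    eventually_ge_atTop 1,
    (hβ.2 c hc).eventually (gt_mem_nhds (lt_add_one _))] with x h1 h2 h3 h4 h5
  have hx0 : 0 < x := by linarith
  have hLx := one_pos.trans_le (hL1 x)
  have hbL := S.inv.pos (L x)
  have hHx := S.rv.pos x
  rw [div_lt_iff₀ hLx] at h5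
  set A := 4 * ε' * (C₃ * κ ^ (1 / q - 2)) * (linv ℓ (L x) / L x ^ 2) with hA
  have hA0 : 0 ≤ A := by positivity
  have hI' : ∀ j : ℕ, Iof F h η (r ^ (j + 1) * (c * x)) T ≤
      A * (r ^ θ) ^ j * invTail F (r ^ (j + 1) * (c * x)) ^ 2 := by
    intro j
    have hz : c * x ≤ r ^ (j + 1) * (c * x) :=
      le_mul_of_one_le_left (by positivity) (one_le_pow₀ hr1.le)
    refine (hx₂ _ (h2.trans hz)).trans ?_
    have hLz : L (r ^ (j + 1) * (c * x)) ≤ (κ * (r ^ q') ^ j) * L x := by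
      calc L (r ^ (j + 1) * (c * x)) ≤ (r ^ q') ^ (j + 1) * L (c * x) := hpow _ h1 _
        _ ≤ (r ^ q') ^ (j + 1) * ((c ^ β + 1) * L x) := by gcongr
        _ = _ := by rw [hκ, pow_succ]; ring
    have hk1 : 1 ≤ (r ^ q') ^ j := one_le_pow₀ hrq
    have h6 := hD (κ * (r ^ q') ^ j) (one_le_mul_of_one_le_of_one_le hκ1 hk1) (L x) (hL1 x) _
      (hL1 _) hLz
    have h7 : (κ * (r ^ q') ^ j) ^ (1 / q - 2) = κ ^ (1 / q - 2) * (r ^ θ) ^ j := by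
      have h8 : (0:ℝ) ≤ r ^ q' := by positivity
      rw [Real.mul_rpow (by positivity) (by positivity), hθ, Real.rpow_mul hr0.le,
        ← Real.rpow_natCast (r ^ q') j, ← Real.rpow_natCast ((r ^ q') ^ (1 / q - 2)) j,
        ← Real.rpow_mul h8, ← Real.rpow_mul h8, mul_comm (j:ℝ)]
    rw [h7] at h6
    calc _ ≤ 4 * ε' * invTail F (r ^ (j + 1) * (c * x)) ^ 2 *
          (C₃ * (κ ^ (1 / q - 2) * (r ^ θ) ^ j) * (linv ℓ (L x) / L x ^ 2)) := by gcongr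
      _ = _ := by rw [hA]; ring
  have hex := hE A hA0 (c * x) h3 hI'
  have hHc := S.rv.pos (c * x)
  refine ⟨(hex.trans_lt ENNReal.ofReal_lt_top).ne, fun M => ?_⟩
  have hex' : (excess F h T (c * x)).toReal ≤ C₁ * A * c⁻¹ * (invTail F x / x) := by
    refine (ENNReal.toReal_le_of_le_ofReal (by positivity) hex).trans ?_
    calc C₁ * A * (invTail F (c * x) / (c * x)) ≤ C₁ * A * (invTail F x / (c * x)) := by
          gcongr
          exact S.rv.mono (by nlinarith)
      _ = _ := by field_simp
  have hs := hsum (L x) (hL1 x) M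
  have hs0 := S.sum_div_linv_nonneg ⌈L x⌉₊ M
  calc _ ≤ x / invTail F x * (C₂ * (L x ^ 2 / linv ℓ (L x))) *
        (C₁ * A * c⁻¹ * (invTail F x / x)) := by gcongr
    _ = ε' * P := by rw [hA, hP]; field_simp
    _ = ε := by rw [hε']; field_simp
    _ ≤ ε := le_rfl

end Setup

end

section

/-- The function `u(x) = ∫₁ˣ (ℓ(s)/s)² ds`. -/
def sqInt (ℓ : ℝ → ℝ) (x : ℝ) : ℝ := ∫ s in (1:ℝ)..x, (ℓ s / s) ^ 2

lemma sum_Ico_ite_le (p : ℕ → Prop) [DecidablePred p] {N M : ℕ} (hN : 1 ≤ N) {K : ℝ} (hK : 0 ≤ K)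
    (hp : ∀ n ∈ Finset.Ico N M, p n → (n:ℝ) ≤ K) :
    ∑ n ∈ Finset.Ico N M, (if p n then (n:ℝ) else 0) ≤ K ^ 2 := by
  rw [← Finset.sum_filter]
  have hsub : (Finset.Ico N M).filter p ⊆ Finset.Icc 1 ⌊K⌋₊ := by
    intro n hn
    rw [Finset.mem_filter] at hn
    exact Finset.mem_Icc.2 ⟨hN.trans (Finset.mem_Ico.1 hn.1).1, Nat.le_floor (hp n hn.1 hn.2)⟩
  calc ∑ n ∈ (Finset.Ico N M).filter p, (n:ℝ)
      ≤ ∑ n ∈ (Finset.Ico N M).filter p, K :=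
        Finset.sum_le_sum fun n hn => hp n (Finset.mem_filter.1 hn).1 (Finset.mem_filter.1 hn).2
    _ = ((Finset.Ico N M).filter p).card * K := by rw [Finset.sum_const, nsmul_eq_mul]
    _ ≤ K * K := by
        gcongr
        calc ((((Finset.Ico N M).filter p).card : ℕ) : ℝ) ≤ ((Finset.Icc 1 ⌊K⌋₊).card : ℕ) := by
              exact_mod_cast Finset.card_le_card hsub
          _ = ⌊K⌋₊ := by simp
          _ ≤ K := Nat.floor_le hK
    _ = K ^ 2 := by ring

section MonoRV

variable {H b : ℝ → ℝ} {α : ℝ}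

lemma MonoRV.intervalIntegrable_div_sq (hH : MonoRV H α) {x y : ℝ} (hx : 0 < x) (hxy : x ≤ y) :
    IntervalIntegrable (fun s => (H s / s) ^ 2) volume x y := by
  rw [intervalIntegrable_iff_integrableOn_Ioc_of_le hxy]
  refine Measure.integrableOn_of_bounded (M := (H y / x) ^ 2) measure_Ioc_lt_top.ne
    ((hH.mono.measurable.div measurable_id).pow_const 2).aestronglyMeasurable ?_
  refine (ae_restrict_iff' measurableSet_Ioc).2 (Eventually.of_forall fun s hs => ?_)
  have hs0 := hx.trans hs.1
  have := hH.pos s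
  have := hH.pos y
  rw [Real.norm_of_nonneg (by positivity)]
  gcongr
  · exact hH.mono hs.2
  · exact hs.1.le

lemma MonoRV.integral_div_sq_le (hH : MonoRV H α) {c x : ℝ} (hc : 0 < c) (hc1 : c ≤ 1)
    (hx : 0 < x) : ∫ s in (c * x)..x, (H s / s) ^ 2 ≤ (c ^ 2)⁻¹ * (H x ^ 2 / x) := by
  have hcx : c * x ≤ x := by nlinarith
  have hHx := hH.pos x
  calc ∫ s in (c * x)..x, (H s / s) ^ 2 ≤ ∫ s in (c * x)..x, (H x / (c * x)) ^ 2 := by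
        refine intervalIntegral.integral_mono_on hcx
          (hH.intervalIntegrable_div_sq (by positivity) hcx) intervalIntegrable_const ?_
        intro s hs
        have hs0 : 0 < s := (mul_pos hc hx).trans_le hs.1
        have := hH.pos s
        gcongr
        · exact hH.mono hs.2
        · exact hs.1
    _ = (x - c * x) * (H x / (c * x)) ^ 2 := by simp
    _ ≤ x * (H x / (c * x)) ^ 2 := by
        gcongr
        nlinarith [mul_pos hc hx]
    _ = _ := by field_simp

lemma MonoRV.exists_le_mul_comp (hH : MonoRV H α) {c : ℝ} (hc : 0 < c) (hc1 : c ≤ 1)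
    (hα : 0 < α) : ∃ C ≥ 1, ∀ x, 1 ≤ c * x → H x ≤ C * H (c * x) := by
  obtain ⟨C, hC, h⟩ := hH.potter_upper (q := α + 1) (by linarith) (by linarith)
  have h1 : 1 ≤ (c⁻¹) ^ (α + 1) :=
    Real.one_le_rpow ((one_le_inv₀ hc).2 hc1) (by linarith)
  refine ⟨C * (c⁻¹) ^ (α + 1), one_le_mul_of_one_le_of_one_le hC h1, fun x hx => ?_⟩
  have hx0 : 0 < x := by
    by_contra hx0
    nlinarith
  have h2 := h (c * x) x hx (by nlinarith)
  rwa [show x / (c * x) = c⁻¹ by field_simp] at h2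

lemma MonoRV.exists_sq_div_le (hH : MonoRV H α) (hα : 0 < α) : ∃ C > 0, ∀ x ≥ 2,
    H x ^ 2 / x ≤ C * ∫ s in (x / 2)..x, (H s / s) ^ 2 := by
  obtain ⟨C, hC, h⟩ := hH.exists_le_mul_comp (c := 1 / 2) (by norm_num) (by norm_num) hα
  refine ⟨2 * C ^ 2, by positivity, fun x hx => ?_⟩
  have hx0 : 0 < x := by linarith
  have h1 := h x (by linarith)
  rw [one_div_mul_eq_div] at h1
  have hH2 := hH.pos (x / 2)
  have hHx := hH.pos x
  have h2 : (x / 2) * (H (x / 2) / x) ^ 2 ≤ ∫ s in (x / 2)..x, (H s / s) ^ 2 := by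
    calc (x / 2) * (H (x / 2) / x) ^ 2 = ∫ s in (x / 2)..x, (H (x / 2) / x) ^ 2 := by
          simp; ring_nf; simp
      _ ≤ _ := by
        refine intervalIntegral.integral_mono_on (by linarith) intervalIntegrable_const
          (hH.intervalIntegrable_div_sq (by positivity) (by linarith)) ?_
        intro s hs
        have hs0 : 0 < s := by linarith [hs.1]
        have := hH.pos s
        gcongr
        · exact hH.mono hs.1
        · exact hs.2
  calc H x ^ 2 / x ≤ (C * H (x / 2)) ^ 2 / x := by gcongr
    _ = 2 * C ^ 2 * ((x / 2) * (H (x / 2) / x) ^ 2) := by field_simp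
    _ ≤ _ := by gcongr

lemma inv_le_integral_add {x y : ℝ} (hy : 0 < y) (hx : 0 < x) :
    y⁻¹ ≤ (∫ s in Ioc y x, (s ^ 2)⁻¹) + x⁻¹ := by
  rcases le_total x y with h | h
  · rw [Ioc_eq_empty (not_lt.2 h)]
    simp only [Measure.restrict_empty, integral_zero_measure, zero_add]
    gcongr
  · have hd : ∀ s ∈ uIcc y x, HasDerivAt (fun s : ℝ => -s⁻¹) ((s ^ 2)⁻¹) s := by
      intro s hs
      rw [uIcc_of_le h] at hs
      have := (hasDerivAt_inv (hy.trans_le hs.1).ne').fun_neg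
      rwa [neg_neg] at this
    have hi : IntervalIntegrable (fun s : ℝ => (s ^ 2)⁻¹) volume y x := by
      refine ContinuousOn.intervalIntegrable fun s hs => ?_
      rw [uIcc_of_le h] at hs
      have hs0 : s ≠ 0 := (hy.trans_le hs.1).ne'
      exact ContinuousAt.continuousWithinAt (by fun_prop (disch := positivity))
    rw [← intervalIntegral.integral_of_le h, intervalIntegral.integral_eq_sub_of_hasDerivAt hd hi]
    linarith

lemma AsympInv.exists_sum_div_le_integral (hH : MonoRV H α) (hb : AsympInv H b) :
    ∃ C ≥ 1, ∀ y ≥ 1, ∀ x ≥ 1, ∀ δ > 0,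
      ∑ n ∈ Finset.Ico ⌈y⌉₊ ⌈δ * H x⌉₊, n / b n ≤
        C * (∫ s in Ioc (b y) x, (H s / s) ^ 2) + δ ^ 2 * (H x ^ 2 / x) := by
  obtain ⟨C, hC, hCb⟩ := hb.bounds
  refine ⟨C ^ 2, one_le_pow₀ hC, fun y hy x hx δ hδ => ?_⟩
  have hx0 : 0 < x := by linarith
  have hHx := hH.pos x
  have hN : 1 ≤ ⌈y⌉₊ := Nat.one_le_ceil_iff.2 (by linarith)
  set J := Finset.Ico ⌈y⌉₊ ⌈δ * H x⌉₊ with hJ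
  have hby := hb.pos y
  have hInt : ∀ z > 0, IntegrableOn (fun s : ℝ => (s ^ 2)⁻¹) (Ioc z x) := by
    intro z hz
    refine IntegrableOn.mono_set (ContinuousOn.integrableOn_Icc (a := z) (b := x) fun s hs => ?_)
      Ioc_subset_Icc_self
    have hs0 : s ≠ 0 := (hz.trans_le hs.1).ne'
    exact ContinuousAt.continuousWithinAt (by fun_prop (disch := positivity))
  have hterm : ∀ n ∈ J, (n:ℝ) / b n ≤
      (∫ s in Ioc (b y) x, (if b n < s then (n:ℝ) else 0) * (s ^ 2)⁻¹) +
        (if True then (n:ℝ) else 0) * x⁻¹ := by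
    intro n hn
    have hyn : y ≤ n := Nat.ceil_le.1 (Finset.mem_Ico.1 hn).1
    have h1 : (∫ s in Ioc (b y) x, (if b n < s then (n:ℝ) else 0) * (s ^ 2)⁻¹) =
        n * ∫ s in Ioc (b n) x, (s ^ 2)⁻¹ := by
      rw [← integral_const_mul, ← integral_indicator measurableSet_Ioc,
        ← integral_indicator measurableSet_Ioc]
      congr 1
      ext s
      have := hb.mono hyn
      by_cases hs : b n < s
      · simp [indicator, hs, this.trans_lt hs]
      · simp [indicator, hs]
    rw [h1, if_pos trivial, div_eq_mul_inv, ← mul_add]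
    gcongr
    exact inv_le_integral_add (hb.pos _) hx0
  have hint : ∀ n ∈ J, Integrable (fun s : ℝ => (if b n < s then (n:ℝ) else 0) * (s ^ 2)⁻¹)
      (volume.restrict (Ioc (b y) x)) := by
    intro n _
    refine (hInt (b y) hby).bdd_mul (c := (n:ℝ)) ?_ (Eventually.of_forall fun s => ?_)
    · exact (Measurable.ite measurableSet_Ioi measurable_const measurable_const).aestronglyMeasurable
    · split_ifs <;> simp
  have hHint : IntegrableOn (fun s => (H s / s) ^ 2) (Ioc (b y) x) := by
    rcases le_total (b y) x with h | h
    · exact (intervalIntegrable_iff_integrableOn_Ioc_of_le h).1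
        (hH.intervalIntegrable_div_sq hby h)
    · simp [Ioc_eq_empty (not_lt.2 h)]
  refine (Finset.sum_le_sum hterm).trans ?_
  rw [Finset.sum_add_distrib, ← integral_finsetSum _ hint, ← Finset.sum_mul]
  gcongr ?_ + ?_
  · rw [← integral_const_mul]
    refine setIntegral_mono_on (integrable_finsetSum _ hint) (hHint.const_mul _)
      measurableSet_Ioc fun s hs => ?_
    have hs0 : 0 < s := hby.trans hs.1
    have hHs := hH.pos s
    rw [← Finset.sum_mul]
    calc _ ≤ (C * H s) ^ 2 * (s ^ 2)⁻¹ := by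
          gcongr
          refine sum_Ico_ite_le _ hN (by positivity) fun n hn hns => ?_
          have hyn : y ≤ n := Nat.ceil_le.1 (Finset.mem_Ico.1 hn).1
          refine ((hCb n (hy.trans hyn)).1).trans ?_
          gcongr
          exact hH.mono hns.le
      _ = _ := by field_simp
  · calc _ ≤ (δ * H x) ^ 2 * x⁻¹ := by
          gcongr
          refine sum_Ico_ite_le (fun _ => True) hN (by positivity) fun n hn _ => ?_
          exact (Nat.lt_ceil.1 (Finset.mem_Ico.1 hn).2).le
      _ = _ := by field_simp

end MonoRV

end

section

section sqInt

variable {ℓ : ℝ → ℝ}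

lemma sqInt_sub (hi : ∀ x ≥ 1, IntervalIntegrable (fun s => (ℓ s / s) ^ 2) volume 1 x)
    {x y : ℝ} (hx : 1 ≤ x) (hy : 1 ≤ y) :
    sqInt ℓ y - sqInt ℓ x = ∫ s in x..y, (ℓ s / s) ^ 2 :=
  intervalIntegral.integral_interval_sub_left (hi y hy) (hi x hx)

lemma sqInt_mono (hi : ∀ x ≥ 1, IntervalIntegrable (fun s => (ℓ s / s) ^ 2) volume 1 x)
    {x y : ℝ} (hx : 1 ≤ x) (hxy : x ≤ y) : sqInt ℓ x ≤ sqInt ℓ y := by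
  rw [← sub_nonneg, sqInt_sub hi hx (hx.trans hxy)]
  exact intervalIntegral.integral_nonneg hxy fun s _ => by positivity

lemma sqInt_lt (hi : ∀ x ≥ 1, IntervalIntegrable (fun s => (ℓ s / s) ^ 2) volume 1 x)
    (hℓ : ∀ x > 0, 0 < ℓ x) {x y : ℝ} (hx : 1 ≤ x) (hxy : x < y) :
    sqInt ℓ x < sqInt ℓ y := by
  rw [← sub_pos, sqInt_sub hi hx (hx.trans hxy.le)]
  refine intervalIntegral.intervalIntegral_pos_of_pos_on
    ((hi x hx).symm.trans (hi y (hx.trans hxy.le))) (fun s hs => ?_) hxy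
  have hs0 : 0 < s := by linarith [hs.1]
  have := hℓ s hs0
  positivity

lemma sqInt_pos (hi : ∀ x ≥ 1, IntervalIntegrable (fun s => (ℓ s / s) ^ 2) volume 1 x)
    (hℓ : ∀ x > 0, 0 < ℓ x) {x : ℝ} (hx : 1 < x) : 0 < sqInt ℓ x := by
  simpa [sqInt] using sqInt_lt hi hℓ le_rfl hx

end sqInt

namespace Setup

variable {F : Measure ℝ} [IsProbabilityMeasure F] {ℓ g : ℝ → ℝ} {α : ℝ}

lemma exists_sqInt_compare (S : Setup F ℓ g α)
    (hi : ∀ x ≥ 1, IntervalIntegrable (fun s => (ℓ s / s) ^ 2) volume 1 x) :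
    ∃ s₀ > 1, ∀ x ≥ s₀, ∀ y ≥ x,
    (∫ s in x..y, (invTail F s / s) ^ 2) ≤ 4 * (sqInt ℓ y - sqInt ℓ x) ∧
    sqInt ℓ y - sqInt ℓ x ≤ 4 * ∫ s in x..y, (invTail F s / s) ^ 2 := by
  obtain ⟨s₁, hs₁⟩ := eventually_atTop.1 (S.eventually_le_two_mul.and S.eventually_le_two_mul')
  refine ⟨max s₁ 2, one_lt_two.trans_le (le_max_right _ _), fun x hx y hxy => ?_⟩
  have hx1 : s₁ ≤ x := (le_max_left _ _).trans hx
  have hx2 : 2 ≤ x := (le_max_right _ _).trans hx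
  have hI1 := S.rv.intervalIntegrable_div_sq (by linarith : 0 < x) hxy
  have hI2 := ((hi x (by linarith)).symm.trans (hi y (by linarith)))
  rw [sqInt_sub hi (by linarith) (by linarith), ← intervalIntegral.integral_const_mul,
    ← intervalIntegral.integral_const_mul]
  constructor
  · refine intervalIntegral.integral_mono_on hxy hI1 (hI2.const_mul 4) fun s hs => ?_
    have hs0 : 0 < s := by linarith [hs.1]
    have := S.rv.pos s
    calc (invTail F s / s) ^ 2 ≤ (2 * ℓ s / s) ^ 2 := by
          gcongr
          exact (hs₁ s (hx1.trans hs.1)).2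
      _ = _ := by ring
  · refine intervalIntegral.integral_mono_on hxy hI2 (hI1.const_mul 4) fun s hs => ?_
    have hs0 : 0 < s := by linarith [hs.1]
    have := S.regVary.1 s hs0
    calc (ℓ s / s) ^ 2 ≤ (2 * invTail F s / s) ^ 2 := by
          gcongr
          exact (hs₁ s (hx1.trans hs.1)).1
      _ = _ := by ring

lemma exists_sq_div_le_sqInt (S : Setup F ℓ g α)
    (hi : ∀ x ≥ 1, IntervalIntegrable (fun s => (ℓ s / s) ^ 2) volume 1 x) :
    ∃ C > 0, ∀ᶠ x in atTop, invTail F x ^ 2 / x ≤ C * sqInt ℓ x := by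
  obtain ⟨s₀, hs₀, hs⟩ := S.exists_sqInt_compare hi
  obtain ⟨C, hC, h⟩ := S.rv.exists_sq_div_le S.pos
  refine ⟨C * 4, by positivity, ?_⟩
  filter_upwards [eventually_ge_atTop (2 * s₀)] with x hx
  have h1 := (hs (x / 2) (by linarith) x (by linarith)).1
  have h2 : 0 ≤ sqInt ℓ (x / 2) := by
    simpa [sqInt] using sqInt_mono hi le_rfl (by linarith : 1 ≤ x / 2)
  calc _ ≤ C * ∫ s in (x / 2)..x, (invTail F s / s) ^ 2 := h x (by linarith)
    _ ≤ C * (4 * sqInt ℓ x) := by gcongr; linarith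
    _ = _ := by ring

lemma exists_sqInt_le_comp (S : Setup F ℓ g α)
    (hi : ∀ x ≥ 1, IntervalIntegrable (fun s => (ℓ s / s) ^ 2) volume 1 x)
    {c : ℝ} (hc : 0 < c) (hc1 : c ≤ 1) :
    ∃ C > 0, ∀ᶠ x in atTop, sqInt ℓ x ≤ C * sqInt ℓ (c * x) := by
  obtain ⟨s₀, hs₀, hs⟩ := S.exists_sqInt_compare hi
  obtain ⟨C, hC, h⟩ := S.exists_sq_div_le_sqInt hi
  obtain ⟨C₂, hC₂, h₂⟩ := S.rv.exists_le_mul_comp hc hc1 S.pos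
  refine ⟨1 + 4 * (c ^ 2)⁻¹ * (C₂ ^ 2 * C), by positivity, ?_⟩
  have hcx : Tendsto (fun x : ℝ => c * x) atTop atTop := tendsto_id.const_mul_atTop hc
  filter_upwards [hcx.eventually h, hcx.eventually_ge_atTop s₀, eventually_gt_atTop 0]
    with x hx1 hx2 hx0
  have h3 := (hs (c * x) hx2 x (by nlinarith)).2
  have h4 := S.rv.integral_div_sq_le hc hc1 hx0
  have hHx := S.rv.pos x
  have hHc := S.rv.pos (c * x)
  have h5 : invTail F x ^ 2 / x ≤ C₂ ^ 2 * (C * sqInt ℓ (c * x)) := by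
    calc invTail F x ^ 2 / x ≤ (C₂ * invTail F (c * x)) ^ 2 / x := by
          gcongr
          exact h₂ x (by linarith)
      _ ≤ (C₂ * invTail F (c * x)) ^ 2 / (c * x) := by
          gcongr
          nlinarith
      _ = C₂ ^ 2 * (invTail F (c * x) ^ 2 / (c * x)) := by ring
      _ ≤ _ := by gcongr
  calc sqInt ℓ x ≤ sqInt ℓ (c * x) + 4 * ((c ^ 2)⁻¹ * (invTail F x ^ 2 / x)) := by linarith
    _ ≤ sqInt ℓ (c * x) + 4 * ((c ^ 2)⁻¹ * (C₂ ^ 2 * (C * sqInt ℓ (c * x)))) := by gcongr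
    _ = _ := by ring

lemma exists_integral_Ioc_le_sqInt (S : Setup F ℓ g α)
    (hi : ∀ x ≥ 1, IntervalIntegrable (fun s => (ℓ s / s) ^ 2) volume 1 x) :
    ∃ C > 0, ∀ᶠ x in atTop, ∀ a ≥ 1,
    ∫ s in Ioc a x, (invTail F s / s) ^ 2 ≤ C * sqInt ℓ x := by
  obtain ⟨s₀, hs₀, hs⟩ := S.exists_sqInt_compare hi
  set D := ∫ s in (1:ℝ)..s₀, (invTail F s / s) ^ 2 with hD
  have hD0 : 0 ≤ D := intervalIntegral.integral_nonneg hs₀.le fun s _ => by positivity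
  have hu0 := sqInt_pos hi S.regVary.1 hs₀
  refine ⟨D / sqInt ℓ s₀ + 4, by positivity, ?_⟩
  filter_upwards [eventually_ge_atTop s₀] with x hx a ha
  have h1 : ∫ s in Ioc a x, (invTail F s / s) ^ 2 ≤ ∫ s in Ioc 1 x, (invTail F s / s) ^ 2 := by
    refine setIntegral_mono_set ?_ (Eventually.of_forall fun s => by positivity)
      (Ioc_subset_Ioc_left ha).eventuallyLE
    exact (intervalIntegrable_iff_integrableOn_Ioc_of_le (hs₀.le.trans hx)).1
      (S.rv.intervalIntegrable_div_sq one_pos (hs₀.le.trans hx))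
  have h2 : ∫ s in Ioc 1 x, (invTail F s / s) ^ 2 =
      D + ∫ s in s₀..x, (invTail F s / s) ^ 2 := by
    rw [← intervalIntegral.integral_of_le (hs₀.le.trans hx), hD,
      intervalIntegral.integral_add_adjacent_intervals
        (S.rv.intervalIntegrable_div_sq one_pos hs₀.le)
        (S.rv.intervalIntegrable_div_sq (by linarith) hx)]
  have h3 := (hs s₀ le_rfl x hx).1
  have h4 : D ≤ D / sqInt ℓ s₀ * sqInt ℓ x := by
    rw [div_mul_eq_mul_div, le_div_iff₀ hu0]
    gcongr
    exact sqInt_mono hi hs₀.le hx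
  rw [h2] at h1
  linarith

lemma eventually_integral_Ioc_le_mul (S : Setup F ℓ g α)
    (hi : ∀ x ≥ 1, IntervalIntegrable (fun s => (ℓ s / s) ^ 2) volume 1 x)
    {B : ℝ → ℝ} (hB : ∀ x, 1 ≤ B x)
    (hB1 : Tendsto (fun x => sqInt ℓ x / sqInt ℓ (B x)) atTop (𝓝 1)) {ρ : ℝ} (hρ : 0 < ρ) :
    ∀ᶠ x in atTop, ∫ s in Ioc (B x) x, (invTail F s / s) ^ 2 ≤ ρ * sqInt ℓ x := by
  obtain ⟨s₀, hs₀, hs⟩ := S.exists_sqInt_compare hi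
  have hu0 := sqInt_pos hi S.regVary.1 hs₀
  have hu2 : sqInt ℓ s₀ < sqInt ℓ (2 * s₀) := sqInt_lt hi S.regVary.1 hs₀.le (by linarith)
  filter_upwards [eventually_ge_atTop (2 * s₀),
    hB1.eventually (lt_mem_nhds (show (0:ℝ) < 1 by norm_num)),
    hB1.eventually (gt_mem_nhds ((one_lt_div hu0).2 hu2)),
    hB1.eventually (gt_mem_nhds (show (1:ℝ) < 1 + ρ / 4 by linarith))] with x hx h1 h2 h3
  have hux := sqInt_mono hi (by linarith : 1 ≤ 2 * s₀) hx
  have hub : 0 ≤ sqInt ℓ (B x) := by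
    simpa [sqInt] using sqInt_mono hi le_rfl (hB x)
  have hub' : 0 < sqInt ℓ (B x) := by
    refine hub.lt_of_ne fun h0 => ?_
    rw [← h0, div_zero] at h1
    exact h1.false
  have hBs : s₀ ≤ B x := by
    by_contra! hlt
    have h4 := sqInt_mono hi (hB x) hlt.le
    rw [div_lt_div_iff₀ hub' hu0] at h2
    nlinarith
  rw [div_lt_iff₀ hub'] at h3
  rcases le_total (B x) x with hBx | hBx
  · rw [← intervalIntegral.integral_of_le hBx]
    have h5 := (hs _ hBs x hBx).1
    have h6 := sqInt_mono hi (hB x) hBx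
    nlinarith
  · rw [Ioc_eq_empty (not_lt.2 hBx)]
    simp only [Measure.restrict_empty, integral_zero_measure]
    have : 0 < sqInt ℓ x := by linarith
    positivity

lemma exists_excess_le_sqInt (S : Setup F ℓ g α)
    (hi : ∀ x ≥ 1, IntervalIntegrable (fun s => (ℓ s / s) ^ 2) volume 1 x)
    {h T η c : ℝ} (hT : 0 ≤ T) (hη : η ∈ Ioc (0:ℝ) 1) (hc : 0 < c)
    (hc1 : c ≤ 1) : ∃ C > 0, ∀ K ≥ 0, (∀ᶠ z in atTop, Iof F h η z T ≤ K * (ℓ z ^ 2 / sqInt ℓ z)) →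
      ∀ᶠ x in atTop, excess F h T (c * x) ≤
        ENNReal.ofReal (C * K * (invTail F x / x / sqInt ℓ x)) := by
  obtain ⟨hη0, hη1⟩ := hη
  set r := (1 - η / 2)⁻¹ with hr
  have hr1 : 1 < r := by
    rw [hr, one_lt_inv₀ (by linarith)]; linarith
  have hηr : (1 - η) * r ≤ 1 := by
    rw [hr, mul_inv_le_iff₀ (by linarith)]; linarith
  obtain ⟨C₁, hC₁, hE⟩ := S.exists_excess_le h hT hη1 hr1 hηr (q := 2 / 3) (θ := 0)
    (by linarith [S.le_half]) (by norm_num)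
  obtain ⟨C₂, hC₂, hu⟩ := S.exists_sqInt_le_comp hi hc hc1
  refine ⟨C₁ * 4 * C₂ * c⁻¹, by positivity, fun K hK hI => ?_⟩
  obtain ⟨x₁, hx₁⟩ := eventually_atTop.1 (hI.and S.eventually_le_two_mul)
  have hcx : Tendsto (fun x : ℝ => c * x) atTop atTop := tendsto_id.const_mul_atTop hc
  filter_upwards [hu, hcx.eventually_ge_atTop x₁, hcx.eventually_ge_atTop 2,
    eventually_ge_atTop 2] with x h1 h2 h3 h4
  have hx0 : 0 < x := by linarith
  have hux := sqInt_pos hi S.regVary.1 (by linarith : 1 < x)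
  have huc := sqInt_pos hi S.regVary.1 (by linarith : 1 < c * x)
  have hHx := S.rv.pos x
  refine (hE (4 * K / sqInt ℓ (c * x)) (by positivity) (c * x) (by linarith) fun j => ?_).trans
    (ENNReal.ofReal_le_ofReal ?_)
  · have hz : c * x ≤ r ^ (j + 1) * (c * x) :=
      le_mul_of_one_le_left (by positivity) (one_le_pow₀ hr1.le)
    set z := r ^ (j + 1) * (c * x)
    have hz0 : 0 < z := by linarith
    have hℓz := S.regVary.1 z hz0
    obtain ⟨h5, h6⟩ := hx₁ z (h2.trans hz)
    have hHz := S.rv.pos z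
    calc Iof F h η z T ≤ K * (ℓ z ^ 2 / sqInt ℓ z) := h5
      _ ≤ K * ((2 * invTail F z) ^ 2 / sqInt ℓ (c * x)) := by
          gcongr
          exact sqInt_mono hi (by linarith) hz
      _ = _ := by rw [Real.rpow_zero, one_pow]; ring
  · have hHc := S.rv.pos (c * x)
    calc C₁ * (4 * K / sqInt ℓ (c * x)) * (invTail F (c * x) / (c * x))
        ≤ C₁ * (4 * K * (C₂ / sqInt ℓ x)) * (invTail F x / (c * x)) := by
          gcongr ?_ * (?_ / _)
          · rw [div_eq_mul_inv]
            gcongr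
            rw [inv_le_comm₀ huc (by positivity), inv_div, div_le_iff₀ hC₂]
            linarith
          · exact S.rv.mono (by nlinarith)
      _ = _ := by field_simp

lemma exists_sum_mul_excess_le (S : Setup F ℓ g α)
    (hi : ∀ x ≥ 1, IntervalIntegrable (fun s => (ℓ s / s) ^ 2) volume 1 x)
    {h T η c : ℝ} (hT : 0 ≤ T) (hη : η ∈ Ioc (0:ℝ) 1) (hc : 0 < c)
    (hc1 : c ≤ 1) {L : ℝ → ℝ} (hL1 : ∀ x, 1 ≤ L x) :
    ∃ C > 0, ∀ K ≥ 0, (∀ᶠ z in atTop, Iof F h η z T ≤ K * (ℓ z ^ 2 / sqInt ℓ z)) →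
      ∀ ρ ≥ 0, (∀ᶠ x in atTop,
        ∫ s in Ioc (linv ℓ (L x)) x, (invTail F s / s) ^ 2 ≤ ρ * sqInt ℓ x) → ∀ δ > 0,
      ∀ᶠ x in atTop, excess F h T (c * x) ≠ ⊤ ∧
        (x / invTail F x * ∑ n ∈ Finset.Ico ⌈L x⌉₊ ⌈δ * invTail F x⌉₊, n / linv ℓ n) *
          (excess F h T (c * x)).toReal ≤ C * K * (ρ + δ ^ 2) := by
  obtain ⟨C₁, hC₁, hE⟩ := S.exists_excess_le_sqInt hi (h := h) hT hη hc hc1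
  obtain ⟨C₂, hC₂, hsum⟩ := S.inv.exists_sum_div_le_integral S.rv
  obtain ⟨C₃, hC₃, hsq⟩ := S.exists_sq_div_le_sqInt hi
  refine ⟨C₁ * (C₂ + C₃), by positivity, fun K hK hI ρ hρ hint δ hδ => ?_⟩
  filter_upwards [hE K hK hI, hint, hsq, eventually_ge_atTop 2] with x h1 h2 h3 h4
  refine ⟨(h1.trans_lt ENNReal.ofReal_lt_top).ne, ?_⟩
  have hx0 : 0 < x := by linarith
  have hux := sqInt_pos hi S.regVary.1 (by linarith : 1 < x)
  have hHx := S.rv.pos x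
  have h5 := ENNReal.toReal_le_of_le_ofReal (by positivity) h1
  have h6 := hsum (L x) (hL1 x) x (by linarith) δ hδ
  have h7 := S.sum_div_linv_nonneg ⌈L x⌉₊ ⌈δ * invTail F x⌉₊
  have h8 : ∑ n ∈ Finset.Ico ⌈L x⌉₊ ⌈δ * invTail F x⌉₊, (n:ℝ) / linv ℓ n ≤
      (C₂ + C₃) * (ρ + δ ^ 2) * sqInt ℓ x := by
    calc _ ≤ C₂ * (ρ * sqInt ℓ x) + δ ^ 2 * (C₃ * sqInt ℓ x) := by
          refine h6.trans ?_
          gcongr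
      _ ≤ _ := by nlinarith [mul_nonneg (mul_nonneg hC₃.le hρ) hux.le,
          mul_nonneg (mul_nonneg (zero_le_one.trans hC₂) (sq_nonneg δ)) hux.le]
  calc _ ≤ (x / invTail F x * ((C₂ + C₃) * (ρ + δ ^ 2) * sqInt ℓ x)) *
        (C₁ * K * (invTail F x / x / sqInt ℓ x)) := by gcongr
    _ = _ := by field_simp

end Setup

end

section

namespace Setup

variable {F : Measure ℝ} [IsProbabilityMeasure F] {ℓ g : ℝ → ℝ} {α : ℝ}

lemma exists_excess_small_of_integrable (S : Setup F ℓ g α)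
    (hi : ∀ x ≥ 1, IntervalIntegrable (fun s => (ℓ s / s) ^ 2) volume 1 x) {h T η c : ℝ}
    (hT : 0 ≤ T) (hη : η ∈ Ioc (0:ℝ) 1) (hc : 0 < c) (hc1 : c ≤ 1) {L : ℝ → ℝ}
    (hL1 : ∀ x, 1 ≤ L x)
    (hO : Tendsto (fun x => sqInt ℓ x / sqInt ℓ (linv ℓ (L x))) atTop (𝓝 1) →
      (fun x => Iof F h η x T) =O[atTop] fun x => ℓ x ^ 2 / sqInt ℓ x)
    (ho : ¬ Tendsto (fun x => sqInt ℓ x / sqInt ℓ (linv ℓ (L x))) atTop (𝓝 1) →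
      (fun x => Iof F h η x T) =o[atTop] fun x => ℓ x ^ 2 / sqInt ℓ x)
    {ε : ℝ} (hε : 0 < ε) : ∃ δ₁ > 0, ∀ δ > 0, δ ≤ δ₁ → ∀ᶠ x in atTop,
      excess F h T (c * x) ≠ ⊤ ∧
        (x / invTail F x * ∑ n ∈ Finset.Ico ⌈L x⌉₊ ⌈δ * invTail F x⌉₊, n / linv ℓ n) *
          (excess F h T (c * x)).toReal ≤ ε := by
  obtain ⟨C, hC, hmain⟩ := S.exists_sum_mul_excess_le hi (h := h) hT hη hc hc1 hL1
  have hbound : ∀ K, (∀ᶠ z in atTop, ‖Iof F h η z T‖ ≤ K * ‖ℓ z ^ 2 / sqInt ℓ z‖) →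
      ∀ᶠ z in atTop, Iof F h η z T ≤ K * (ℓ z ^ 2 / sqInt ℓ z) := by
    intro K hK
    filter_upwards [hK, eventually_gt_atTop 1] with z hz hz1
    have hu := sqInt_pos hi S.regVary.1 hz1
    rw [Real.norm_of_nonneg (by positivity : 0 ≤ ℓ z ^ 2 / sqInt ℓ z)] at hz
    exact (le_abs_self _).trans hz
  by_cases hr : Tendsto (fun x => sqInt ℓ x / sqInt ℓ (linv ℓ (L x))) atTop (𝓝 1)
  · obtain ⟨K, hK, hIK⟩ := (hO hr).exists_pos
    have hI := hbound K hIK.bound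
    have hρ : 0 < ε / (2 * (C * K)) := by positivity
    refine ⟨min 1 (ε / (2 * (C * K))), by positivity, fun δ hδ hδ1 => ?_⟩
    filter_upwards [hmain K hK.le hI _ hρ.le
      (S.eventually_integral_Ioc_le_mul hi (fun x => S.inv.one_le _) hr hρ) δ hδ] with x hx
    refine ⟨hx.1, hx.2.trans ?_⟩
    have h1 : δ ≤ 1 := hδ1.trans (min_le_left _ _)
    have h2 : δ ≤ ε / (2 * (C * K)) := hδ1.trans (min_le_right _ _)
    calc C * K * (ε / (2 * (C * K)) + δ ^ 2)
        ≤ C * K * (ε / (2 * (C * K)) + ε / (2 * (C * K))) := by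
          gcongr
          nlinarith
      _ = ε := by field_simp; ring
  · obtain ⟨D, hD, hint⟩ := S.exists_integral_Ioc_le_sqInt hi
    have hK : 0 < ε / (C * (D + 1)) := by positivity
    refine ⟨1, one_pos, fun δ hδ hδ1 => ?_⟩
    filter_upwards [hmain _ hK.le (hbound _ ((ho hr).def hK)) D hD.le
      (hint.mono fun x hx => hx _ (S.inv.one_le _)) δ hδ] with x hx
    refine ⟨hx.1, hx.2.trans ?_⟩
    calc C * (ε / (C * (D + 1))) * (D + δ ^ 2) ≤ C * (ε / (C * (D + 1))) * (D + 1) := by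
          gcongr
          nlinarith
      _ = ε := by field_simp

lemma exists_excess_small_of_half (S : Setup F ℓ g α) {h T η c : ℝ}
    (hT : 0 ≤ T) (hη : η ∈ Ioc (0:ℝ) 1) (hc : 0 < c) (hc1 : c ≤ 1) {L : ℝ → ℝ}
    (hL1 : ∀ x, 1 ≤ L x)
    (hO : Tendsto (fun x => sqInt ℓ x / sqInt ℓ (linv ℓ (L x))) atTop (𝓝 1) →
      (fun x => Iof F h η x T) =O[atTop] fun x => ℓ x ^ 2 / sqInt ℓ x)
    (ho : ¬ Tendsto (fun x => sqInt ℓ x / sqInt ℓ (linv ℓ (L x))) atTop (𝓝 1) →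
      (fun x => Iof F h η x T) =o[atTop] fun x => ℓ x ^ 2 / sqInt ℓ x)
    {ε : ℝ} (hε : 0 < ε) : ∃ δ₁ > 0, ∀ δ > 0, δ ≤ δ₁ → ∀ᶠ x in atTop,
      excess F h T (c * x) ≠ ⊤ ∧
        (x / invTail F x * ∑ n ∈ Finset.Ico ⌈L x⌉₊ ⌈δ * invTail F x⌉₊, n / linv ℓ n) *
          (excess F h T (c * x)).toReal ≤ ε := by
  by_cases hi : ∀ x ≥ 1, IntervalIntegrable (fun s => (ℓ s / s) ^ 2) volume 1 x
  · exact S.exists_excess_small_of_integrable hi hT hη hc hc1 hL1 hO ho hε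
  push Not at hi
  obtain ⟨x₁, hx₁, hni⟩ := hi
  have hu : ∀ x ≥ x₁, sqInt ℓ x = 0 := fun x hx =>
    intervalIntegral.integral_undef fun hI => hni (hI.mono_set (by
      rw [uIcc_of_le hx₁, uIcc_of_le (hx₁.trans hx)]
      exact Icc_subset_Icc_right hx))
  have hr : ¬ Tendsto (fun x => sqInt ℓ x / sqInt ℓ (linv ℓ (L x))) atTop (𝓝 1) := by
    intro hr
    obtain ⟨x, hx, hx'⟩ := ((eventually_ge_atTop x₁).and
      (hr.eventually (lt_mem_nhds (show (0:ℝ) < 1 by norm_num)))).exists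
    rw [hu x hx, zero_div] at hx'
    exact hx'.false
  obtain ⟨hη0, hη1⟩ := hη
  set r := (1 - η / 2)⁻¹ with hr
  have hr1 : 1 < r := by
    rw [hr, one_lt_inv₀ (by linarith)]; linarith
  have hηr : (1 - η) * r ≤ 1 := by
    rw [hr, mul_inv_le_iff₀ (by linarith)]; linarith
  obtain ⟨C, hC, hE⟩ := S.exists_excess_le h hT hη1 hr1 hηr (q := 2 / 3) (θ := 0)
    (by linarith [S.le_half]) (by norm_num)
  obtain ⟨x₂, hx₂⟩ := eventually_atTop.1 ((ho ‹_›).def one_pos)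
  have hcx : Tendsto (fun x : ℝ => c * x) atTop atTop := tendsto_id.const_mul_atTop hc
  refine ⟨1, one_pos, fun δ _ _ => ?_⟩
  filter_upwards [hcx.eventually_ge_atTop x₁, hcx.eventually_ge_atTop x₂,
    hcx.eventually_ge_atTop 1] with x h1 h2 h3
  have hex := hE 0 le_rfl (c * x) h3 fun j => by
    have hz : c * x ≤ r ^ (j + 1) * (c * x) :=
      le_mul_of_one_le_left (by linarith) (one_le_pow₀ hr1.le)
    have h4 := hx₂ _ (h2.trans hz)
    rw [hu _ (h1.trans hz), div_zero, norm_zero, mul_zero] at h4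
    rw [zero_mul, zero_mul]
    exact (le_abs_self _).trans h4
  have hex0 : excess F h T (c * x) = 0 := by simpa using hex
  rw [hex0]
  simpa using hε.le

/-- The contribution of `L(x) ≤ n < δ / F̄(x)` to the renewal measure. -/
lemma exists_small_le (S : Setup F ℓ g α) {h T η : ℝ} (hh : 0 < h)
    (hT : 0 ≤ T) (hη : η ∈ Ioc (0:ℝ) 1) {L : ℝ → ℝ} (hL : RegVaryAny L)
    (hL1 : ∀ x, 1 ≤ L x) (hLℓ : Tendsto (fun x => L x / ℓ x) atTop (𝓝 0))
    (hb : α < 1 / 2 → (fun x => Iof F h η x T) =o[atTop] fun x => ℓ x ^ 2 * linv ℓ (L x) / L x ^ 2)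
    (hO : α = 1 / 2 → Tendsto (fun x => sqInt ℓ x / sqInt ℓ (linv ℓ (L x))) atTop (𝓝 1) →
      (fun x => Iof F h η x T) =O[atTop] fun x => ℓ x ^ 2 / sqInt ℓ x)
    (ho : α = 1 / 2 → ¬ Tendsto (fun x => sqInt ℓ x / sqInt ℓ (linv ℓ (L x))) atTop (𝓝 1) →
      (fun x => Iof F h η x T) =o[atTop] fun x => ℓ x ^ 2 / sqInt ℓ x)
    {ε : ℝ} (hε : 0 < ε) : ∃ δ₁ > 0, ∀ δ > 0, δ ≤ δ₁ → ∀ᶠ x in atTop,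
      x / invTail F x * ∑ n ∈ Finset.Ico ⌈L x⌉₊ ⌈δ * invTail F x⌉₊,
        (convPow F n).real (Ioc x (x + h)) ≤ ε := by
  obtain ⟨c, hc, hc1, C, hC, δ₀, hδ₀, -, x₀, -, hmain⟩ := S.exists_sum_small_le hh hT
  have hε' : 0 < ε / (2 * C) := by positivity
  have hex : ∃ δ₁ > 0, ∀ δ > 0, δ ≤ δ₁ → ∀ᶠ x in atTop,
      excess F h T (c * x) ≠ ⊤ ∧
        (x / invTail F x * ∑ n ∈ Finset.Ico ⌈L x⌉₊ ⌈δ * invTail F x⌉₊, n / linv ℓ n) *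
          (excess F h T (c * x)).toReal ≤ ε / (2 * C) := by
    rcases S.le_half.lt_or_eq with hα | hα
    · exact ⟨1, one_pos, fun δ _ _ =>
        (S.eventually_excess_small_of_lt_half hα hT hη hc hc1 hL hL1 hLℓ (hb hα) hε').mono
          fun x hx => ⟨hx.1, hx.2 _⟩⟩
    · exact S.exists_excess_small_of_half hT hη hc hc1 hL1 (hO hα) (ho hα) hε'
  obtain ⟨δ₁, hδ₁, hδ₁'⟩ := hex
  refine ⟨min δ₁ (min δ₀ (ε / (2 * C))), by positivity, fun δ hδ hδle => ?_⟩
  have h1 : δ ≤ δ₁ := hδle.trans (min_le_left _ _)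
  have h2 : δ ≤ δ₀ := hδle.trans ((min_le_right _ _).trans (min_le_left _ _))
  have h3 : δ ≤ ε / (2 * C) := hδle.trans ((min_le_right _ _).trans (min_le_right _ _))
  filter_upwards [hδ₁' δ hδ h1, eventually_ge_atTop x₀] with x hx hx0
  have hN : 1 ≤ ⌈L x⌉₊ := Nat.one_le_ceil_iff.2 (one_pos.trans_le (hL1 x))
  refine (hmain δ hδ h2 x hx0 _ hN hx.1).trans ?_
  calc _ ≤ C * (ε / (2 * C)) + C * (ε / (2 * C)) := by
        rw [mul_assoc C]
        gcongr
        exact hx.2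
    _ = ε := by field_simp; ring

lemma tendsto_integral_gammaFn (S : Setup F ℓ g α) :
    Tendsto (fun p : ℝ × ℝ => (∫ v in p.1..p.2, gammaFn g α v).re) (𝓝[>] 0 ×ˢ atTop)
      (𝓝 (α * ∫ t in Ioi 0, t ^ (-α) * g t)) := by
  have h0 := S.integral_gammaFn
  have h1 : ((∫ v in Ioi (0:ℝ), gammaFn g α v)).re = α * ∫ t in Ioi (0:ℝ), t ^ (-α) * g t := by
    rw [h0, Complex.ofReal_re]
  rw [← h1]
  refine (Complex.continuous_re.tendsto _).comp ?_
  have hI := S.integrableOn_gammaFn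
  have hsplit : ∀ᶠ p : ℝ × ℝ in 𝓝[>] 0 ×ˢ atTop,
      (∫ v in (0:ℝ)..p.2, gammaFn g α v) - (∫ v in (0:ℝ)..p.1, gammaFn g α v) =
        ∫ v in p.1..p.2, gammaFn g α v := by
    filter_upwards [prod_mem_prod self_mem_nhdsWithin (Ioi_mem_atTop (0:ℝ))] with p hp
    have hp1 : 0 < p.1 := hp.1
    have hp2 : 0 < p.2 := hp.2
    refine intervalIntegral.integral_interval_sub_left ?_ ?_
    · exact (intervalIntegrable_iff_integrableOn_Ioc_of_le hp2.le).2
        (hI.mono_set Ioc_subset_Ioi_self)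
    · exact (intervalIntegrable_iff_integrableOn_Ioc_of_le hp1.le).2
        (hI.mono_set Ioc_subset_Ioi_self)
  refine Tendsto.congr' hsplit ?_
  rw [← sub_zero (∫ v in Ioi (0:ℝ), gammaFn g α v)]
  refine Tendsto.sub ?_ ?_
  · exact (intervalIntegral_tendsto_integral_Ioi 0 hI tendsto_id).comp tendsto_snd
  · have hcont : ContinuousOn (fun y => ∫ v in (0:ℝ)..y, gammaFn g α v) (Icc 0 1) :=
      intervalIntegral.continuousOn_primitive_interval
        (((integrableOn_Icc_iff_integrableOn_Ioc).2 (hI.mono_set Ioc_subset_Ioi_self)).mono_set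
          (by rw [uIcc_of_le zero_le_one]))  |>.mono (by rw [uIcc_of_le zero_le_one])
    have h2 := (hcont 0 (by simp)).tendsto
    rw [intervalIntegral.integral_same] at h2
    refine (h2.mono_left ?_).comp tendsto_fst
    rw [nhdsWithin_Icc_eq_nhdsGE zero_lt_one]
    exact nhdsWithin_mono _ Ioi_subset_Ici_self

end Setup

end

section

/-- If the contributions of `n < δ / F̄(x)` are negligible as `δ → 0`, the strong renewal theorem
holds. -/
lemma Setup.srtHolds {F : Measure ℝ} [IsProbabilityMeasure F] {ℓ g : ℝ → ℝ} {α h : ℝ}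
    (S : Setup F ℓ g α) (hspan : SpanOK F h)
    (hsmall : ∀ ε > 0, ∃ δ₁ > 0, ∀ δ > 0, δ ≤ δ₁ → ∀ᶠ x in atTop,
      x / invTail F x * ∑ n ∈ Finset.range ⌈δ * invTail F x⌉₊,
        (convPow F n).real (Ioc x (x + h)) ≤ ε) : SRTholds F h α g := by
  have hh := hspan.1
  set A := α * ∫ t in Ioi (0:ℝ), t ^ (-α) * g t with hA
  obtain ⟨C, hC, hlarge⟩ := S.exists_large_le h
  rw [SRTholds, show α * h * ∫ t in Ioi (0:ℝ), t ^ (-α) * g t = h * A by rw [hA]; ring,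
    Metric.tendsto_nhds]
  intro ε hε
  set e := ε / 5 with he
  have he0 : 0 < e := by positivity
  obtain ⟨δ₁, hδ₁, hδ₁'⟩ := hsmall e he0
  have hΔlim : Tendsto (fun Δ : ℝ => C * Δ ^ (-(1 / 2) : ℝ)) atTop (𝓝 0) := by
    simpa using (tendsto_rpow_neg_atTop (by norm_num : (0:ℝ) < 1 / 2)).const_mul C
  obtain ⟨⟨δ, Δ⟩, hint, ⟨hδ, hδle⟩, hΔ1, hΔ⟩ :=
    ((S.tendsto_integral_gammaFn.eventually (Metric.ball_mem_nhds _ (div_pos he0 hh))).and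
      (prod_mem_prod (Ioo_mem_nhdsGT (lt_min hδ₁ one_pos))
        ((eventually_gt_atTop 1).and (hΔlim.eventually (gt_mem_nhds he0))))).exists
  simp only at hint hδ hδle hΔ1 hΔ
  have hδ1 : δ < 1 := hδle.trans_le (min_le_right _ _)
  rw [Real.dist_eq, lt_div_iff₀ hh] at hint
  have hmid := (S.tendsto_mid hspan hδ (hδ1.trans hΔ1)).eventually (Metric.ball_mem_nhds _ he0)
  filter_upwards [hmid, hδ₁' δ hδ (hδle.le.trans (min_le_left _ _)), eventually_ge_atTop 1]
    with x hx1 hx2 hx3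
  have hHx := S.rv.pos x
  have hx0 : 0 < x := by linarith
  set f : ℕ → ℝ := fun n => (convPow F n).real (Ioc x (x + h)) with hf
  have hf0 : ∀ n, 0 ≤ f n := fun n => measureReal_nonneg
  set N := ⌈δ * invTail F x⌉₊ with hN
  set M := ⌈Δ * invTail F x⌉₊ with hM
  have hNM : N ≤ M := Nat.ceil_mono (by gcongr; linarith)
  set k := x / invTail F x with hk
  have hk0 : 0 < k := by positivity
  have hxk : x * rtail F x = k := by rw [hk, invTail, div_inv_eq_mul]
  rw [hxk, renewal_toReal]
  have hsum : Summable f := S.summable_convPow h hx3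
  have hlow : k * ∑ n ∈ Finset.Ico N M, f n ≤ k * ∑' n, f n := by
    gcongr
    exact hsum.sum_le_tsum _ fun n _ => hf0 n
  have hupp : k * ∑' n, f n ≤ e + k * (∑ n ∈ Finset.Ico N M, f n) + C * Δ ^ (-(1 / 2) : ℝ) := by
    rw [← tsum_mul_left]
    refine Real.tsum_le_of_sum_range_le (fun n => mul_nonneg hk0.le (hf0 n)) fun m => ?_
    rw [← Finset.mul_sum]
    have h1 : ∑ n ∈ Finset.range m, f n ≤ ∑ n ∈ Finset.range (max m M), f n :=
      Finset.sum_le_sum_of_subset_of_nonneg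
        (Finset.range_mono (le_max_left _ _)) fun n _ _ => hf0 n
    rw [Finset.range_eq_Ico (max m M),
      ← Finset.sum_Ico_consecutive f (Nat.zero_le M) (le_max_right m M),
      ← Finset.sum_Ico_consecutive f (Nat.zero_le N) hNM, ← Finset.range_eq_Ico N] at h1
    have h2 : k * ∑ n ∈ Finset.Ico M (max m M), f n ≤ _ := hlarge Δ hΔ1.le x hx3 (max m M)
    have h3 := mul_le_mul_of_nonneg_left h1 hk0.le
    rw [mul_add, mul_add] at h3
    linarith
  rw [Real.dist_eq] at hx1
  rw [Real.dist_eq, abs_lt]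
  have h4 := abs_lt.1 hx1
  have h5 : |h * (∫ v in δ..Δ, gammaFn g α v).re - h * A| < e := by
    rw [← mul_sub, abs_mul, abs_of_pos hh, mul_comm]
    exact hint
  have h6 := abs_lt.1 h5
  constructor <;> linarith [h4.1, h4.2, h6.1, h6.2]

/-- The contributions of `n < L(x)` and of `L(x) ≤ n < δ / F̄(x)` may be controlled separately. -/
lemma Setup.exists_sum_range_le {F : Measure ℝ} [IsProbabilityMeasure F] {ℓ g : ℝ → ℝ} {α h : ℝ}
    (S : Setup F ℓ g α) {L : ℝ → ℝ}
    (hL : Tendsto (fun x => (x / ℓ x) *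
      ∑ n ∈ Finset.range ⌈L x⌉₊, (convPow F n).real (Ioc x (x + h))) atTop (𝓝 0))
    (hsmall : ∀ ε > 0, ∃ δ₁ > 0, ∀ δ > 0, δ ≤ δ₁ → ∀ᶠ x in atTop,
      x / invTail F x * ∑ n ∈ Finset.Ico ⌈L x⌉₊ ⌈δ * invTail F x⌉₊,
        (convPow F n).real (Ioc x (x + h)) ≤ ε) :
    ∀ ε > 0, ∃ δ₁ > 0, ∀ δ > 0, δ ≤ δ₁ → ∀ᶠ x in atTop,
      x / invTail F x * ∑ n ∈ Finset.range ⌈δ * invTail F x⌉₊,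
        (convPow F n).real (Ioc x (x + h)) ≤ ε := by
  intro ε hε
  obtain ⟨δ₁, hδ₁, hsum⟩ := hsmall (ε / 2) (by positivity)
  refine ⟨δ₁, hδ₁, fun δ hδ hle => ?_⟩
  filter_upwards [hsum δ hδ hle, hL.eventually (gt_mem_nhds (show 0 < ε / 4 by positivity)),
    S.eventually_le_two_mul, eventually_gt_atTop 0] with x h1 h2 h3 hx0
  have hHx := S.rv.pos x
  have hℓx := S.regVary.1 x hx0
  have h4 : x / invTail F x * ∑ n ∈ Finset.range ⌈L x⌉₊, (convPow F n).real (Ioc x (x + h)) ≤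
      ε / 2 := by
    calc _ ≤ 2 * (x / ℓ x) * ∑ n ∈ Finset.range ⌈L x⌉₊, (convPow F n).real (Ioc x (x + h)) := by
          have h5 : x / invTail F x ≤ 2 * (x / ℓ x) := by
            rw [← mul_div_assoc, div_le_div_iff₀ hHx hℓx]
            nlinarith
          exact mul_le_mul_of_nonneg_right h5 (Finset.sum_nonneg fun n _ => measureReal_nonneg)
      _ ≤ _ := by rw [mul_assoc]; linarith
  have hsub : Finset.range ⌈δ * invTail F x⌉₊ ⊆
      Finset.range ⌈L x⌉₊ ∪ Finset.Ico ⌈L x⌉₊ ⌈δ * invTail F x⌉₊ := by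
    intro n hn
    simp only [Finset.mem_union, Finset.mem_range, Finset.mem_Ico] at hn ⊢
    lia
  set f : ℕ → ℝ := fun n => (convPow F n).real (Ioc x (x + h)) with hf
  have hf0 : ∀ n, 0 ≤ f n := fun n => measureReal_nonneg
  have h6 : ∑ n ∈ Finset.range ⌈δ * invTail F x⌉₊, f n ≤ ∑ n ∈ Finset.range ⌈L x⌉₊, f n +
      ∑ n ∈ Finset.Ico ⌈L x⌉₊ ⌈δ * invTail F x⌉₊, f n := by
    refine (Finset.sum_le_sum_of_subset_of_nonneg hsub fun n _ _ => hf0 n).trans ?_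
    rw [← Finset.sum_union_inter]
    exact le_add_of_nonneg_right (Finset.sum_nonneg fun n _ => hf0 n)
  calc _ ≤ x / invTail F x * (∑ n ∈ Finset.range ⌈L x⌉₊, f n +
        ∑ n ∈ Finset.Ico ⌈L x⌉₊ ⌈δ * invTail F x⌉₊, f n) := by gcongr
    _ ≤ _ := by rw [mul_add]; linarith

end

end SRT

/-- Theorem 1.1 of the paper: integral criteria for the SRT
when `α ∈ (0,1/2]`. -/
theorem srt_alpha_le_half
    (F : Measure ℝ) [IsProbabilityMeasure F] (α h : ℝ) (ℓ : ℝ → ℝ)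
    (hα : α ∈ Set.Ioc (0:ℝ) (1/2)) (hℓ : RegVary ℓ α)
    (hRT : RightTail F ℓ) (hTR : TailRatio F) (hspan : SpanOK F h)
    (L : ℝ → ℝ) (hLreg : RegVaryAny L) (hL1 : ∀ x, 1 ≤ L x)
    (T : ℝ) (hT : 0 ≤ T) (η : ℝ) (hη : η ∈ Set.Ioc (0:ℝ) 1)
    (ha1 : Tendsto (fun x => L x / ℓ x) atTop (nhds 0))
    (ha2 : Tendsto (fun x => (x / ℓ x) *
        ∑ n ∈ Finset.range ⌈L x⌉₊, ((convPow F n) (Set.Ioc x (x + h))).toReal)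
      atTop (nhds 0))
    (hb : α < 1/2 →
      (fun x => Iof F h η x T) =o[atTop]
        fun x => ℓ x ^ 2 * linv ℓ (L x) / L x ^ 2)
    (hc1 : α = 1/2 →
      Tendsto (fun x => (∫ s in (1:ℝ)..x, (ℓ s / s) ^ 2) /
          ∫ s in (1:ℝ)..(linv ℓ (L x)), (ℓ s / s) ^ 2) atTop (nhds 1) →
      (fun x => Iof F h η x T) =O[atTop]
        fun x => ℓ x ^ 2 / ∫ s in (1:ℝ)..x, (ℓ s / s) ^ 2)
    (hc2 : α = 1/2 →
      ¬ Tendsto (fun x => (∫ s in (1:ℝ)..x, (ℓ s / s) ^ 2) /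
          ∫ s in (1:ℝ)..(linv ℓ (L x)), (ℓ s / s) ^ 2) atTop (nhds 1) →
      (fun x => Iof F h η x T) =o[atTop]
        fun x => ℓ x ^ 2 / ∫ s in (1:ℝ)..x, (ℓ s / s) ^ 2)
    (g : ℝ → ℝ) (hg : StableLimit F ℓ g) :
    SRTholds F h α g := by
  have S : Setup F ℓ g α := ⟨hα.1, hα.2, hℓ, hRT, hg⟩
  exact S.srtHolds hspan (S.exists_sum_range_le ha2 fun ε hε =>
    S.exists_small_le hspan.1 hT hη hLreg hL1 ha1 hb hc1 hc2 hε)
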